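/- arXiv:1304.2448 — 5 statements merged into one kernel-verified Lean document; each statement's English description precedes it below -/
import Mathlib

section
/- Every simple binary matroid of rank 4 with no AG(3,2)-minor has at most 11 elements. -/
open Matroid Set

variable {α : Type*}

/-- Deletion of a set of elements from a matroid. -/
def Matroid.del (M : Matroid α) (D : Set α) : Matroid α := M ↾ (M.E \ D)

/-- Contraction of a set of elements in a matroid, defined by duality. -/
def Matroid.con (M : Matroid α) (C : Set α) : Matroid α := ((M✶).del C)✶

/-- `N` is a minor of `M` if it is obtained from `M` by a contraction followed by a deletion. -/
def Matroid.IsMinorOf (N M : Matroid α) : Prop := ∃ C D : Set α, N = (M.con C).del D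

/-- `C` is a circuit of `M`: a dependent set all of whose proper subsets are independent. -/
def Matroid.IsCircuitSet (M : Matroid α) (C : Set α) : Prop :=
  M.Dep C ∧ ∀ D ⊂ C, M.Indep D

/-- A matroid is simple if it has no circuits of size one or two, equivalently every
one- or two-element subset of the ground set is independent. -/
def Matroid.IsSimpleM (M : Matroid α) : Prop := ∀ e ∈ M.E, ∀ f ∈ M.E, M.Indep {e, f}

/-- The rank of a set `X` in a matroid `M`: the supremum of the sizes of independent
subsets of `X`. -/
noncomputable def Matroid.rks (M : Matroid α) (X : Set α) : ℕ :=
  sSup {n : ℕ | ∃ I ⊆ X, M.Indep I ∧ I.ncard = n}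

/-- The rank of a matroid. -/
noncomputable def Matroid.rkM (M : Matroid α) : ℕ := M.rks M.E

/-- `M` is represented over the field `F` by the vector assignment `φ`:
a subset of the ground set is independent iff `φ` is linearly independent on it. -/
def Matroid.IsRepBy (M : Matroid α) (F : Type*) [Field F] {W : Type*} [AddCommGroup W]
    [Module F W] (φ : α → W) : Prop :=
  ∀ I ⊆ M.E, (M.Indep I ↔ LinearIndependent F (I.restrict φ))

/-- `M` is representable over the field `F`. -/
def Matroid.IsRepOver (M : Matroid α) (F : Type) [Field F] : Prop :=
  ∃ (n : ℕ) (φ : α → (Fin n → F)), M.IsRepBy F φ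

/-- A binary matroid is one representable over the two-element field `GF(2)`. -/
def Matroid.IsBinaryM (M : Matroid α) : Prop := M.IsRepOver (ZMod 2)

/-- A regular matroid is one representable over every field. -/
def Matroid.IsRegularM (M : Matroid α) : Prop := ∀ (F : Type) [Field F], M.IsRepOver F

/-- `M` is isomorphic to the binary vector matroid on the set of vectors `V`:
there is a representation of `M` over `GF(2)` mapping the ground set bijectively to `V`. -/
def Matroid.IsBinaryIsoTo (M : Matroid α) {W : Type*} [AddCommGroup W] [Module (ZMod 2) W]
    (V : Set W) : Prop :=
  ∃ φ : α → W, M.IsRepBy (ZMod 2) φ ∧ Set.BijOn φ M.E V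

/-- The eight points of the binary affine cube `AG(3,2)`: the vectors `(1, x)` in `GF(2)⁴`. -/
def agVecs : Set (Fin 4 → ZMod 2) := {x | x 0 = 1}

/-- `M` has a minor isomorphic to `AG(3,2)`. -/
def Matroid.HasAGMinor (M : Matroid α) : Prop :=
  ∃ N : Matroid α, N.IsMinorOf M ∧ N.IsBinaryIsoTo agVecs

/-- The seven points of the Fano plane `F₇`: the nonzero vectors of `GF(2)³`. -/
def fanoVecs : Set (Fin 3 → ZMod 2) := {x | x ≠ 0}

/-- The vectors `eᵢ + eⱼ` (`i ≠ j`) representing the graphic matroid `M(K_n)`. -/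
def kVecs (n : ℕ) : Set (Fin n → ZMod 2) :=
  {x | ∃ i j : Fin n, i ≠ j ∧ x = Pi.single i 1 + Pi.single j 1}

/-- `ℓ` is a line (3-element circuit) of `M` through `x`. -/
def Matroid.IsLineThru (M : Matroid α) (x : α) (ℓ : Set α) : Prop :=
  M.IsCircuitSet ℓ ∧ ℓ.ncard = 3 ∧ x ∈ ℓ

/-- A matroid is connected if it is nonempty and every two distinct elements of the
ground set lie in a common circuit. -/
def Matroid.IsConnectedM (M : Matroid α) : Prop :=
  M.E.Nonempty ∧ ∀ e ∈ M.E, ∀ f ∈ M.E, e ≠ f →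
    ∃ C, M.IsCircuitSet C ∧ e ∈ C ∧ f ∈ C

/-- A matroid is 3-connected if it is connected and has no 2-separation, i.e. no partition
`(A, B)` of the ground set with `|A| ≥ 2`, `|B| ≥ 2` and `r(A) + r(B) - r(M) ≤ 1`. -/
def Matroid.IsThreeConnected (M : Matroid α) : Prop :=
  M.IsConnectedM ∧ ¬ ∃ A B : Set α, A ∪ B = M.E ∧ Disjoint A B ∧
    2 ≤ A.ncard ∧ 2 ≤ B.ncard ∧ M.rks A + M.rks B ≤ M.rkM + 1

theorem exists_functional_aux (S : Finset (Fin 4 → ZMod 2)) (hS : S.card ≤ 3) :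
    ∃ f : (Fin 4 → ZMod 2) →ₗ[ZMod 2] ZMod 2, f ≠ 0 ∧ ∀ x ∈ S, f x = 0 := by
  have h1 : Module.finrank (ZMod 2) (Submodule.span (ZMod 2) (S : Set (Fin 4 → ZMod 2))) ≤ 3 :=
    (finrank_span_finset_le_card S).trans hS
  have hlt : Submodule.span (ZMod 2) (S : Set (Fin 4 → ZMod 2)) < ⊤ := by
    rw [lt_top_iff_ne_top]
    intro h
    rw [h, finrank_top] at h1
    simp at h1
  obtain ⟨f, hf, hle⟩ := Submodule.exists_le_ker_of_lt_top _ hlt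
  exact ⟨f, hf, fun x hx => hle (Submodule.subset_span hx)⟩

theorem exists_equiv_aux (f : (Fin 4 → ZMod 2) →ₗ[ZMod 2] ZMod 2) (hf : f ≠ 0) :
    ∃ T : (Fin 4 → ZMod 2) →ₗ[ZMod 2] (Fin 4 → ZMod 2),
      Function.Injective T ∧ ∀ x, T x 0 = f x := by
  obtain ⟨k, hk⟩ : ∃ k, f (Pi.single k 1) ≠ 0 := by
    by_contra! h
    exact hf (LinearMap.pi_ext' fun i => LinearMap.ext_ring (by simpa using h i))
  refine ⟨LinearMap.pi fun i => if i = 0 then f else LinearMap.proj (Equiv.swap 0 k i), ?_, ?_⟩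
  · rw [← LinearMap.ker_eq_bot, LinearMap.ker_eq_bot']
    intro x hx
    have h0 : f x = 0 := by simpa using congrFun hx 0
    have hj : ∀ j, j ≠ k → x j = 0 := by
      intro j hj
      have h := congrFun hx (Equiv.swap 0 k j)
      have hne : Equiv.swap 0 k j ≠ 0 := by
        intro h'
        apply hj
        have := congrArg (Equiv.swap 0 k) h'
        simpa using this
      simpa [hne] using h
    have hx' : x = x k • Pi.single k 1 := by
      ext j
      by_cases h : j = k
      · subst h; simp
      · simp [hj j h, h]
    rw [hx', map_smul, smul_eq_mul] at h0
    have hxk : x k = 0 := (mul_eq_zero.1 h0).resolve_right hk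
    rw [hx', hxk, zero_smul]
  · intro x; simp

theorem rank_four_bound {α : Type*} (M : Matroid α)
    (hbin : M.IsBinaryM) (hsimple : M.IsSimpleM) (hrank : M.rkM = 4)
    (hAG : ¬ M.HasAGMinor) :
    M.E.ncard ≤ 11 := by
  classical
  by_contra! hcard
  apply hAG
  have hfin : M.E.Finite := Set.finite_of_ncard_pos (by omega)
  obtain ⟨n, φ, hφ⟩ := hbin
  -- a maximum independent set
  set A : Set ℕ := {n : ℕ | ∃ I ⊆ M.E, M.Indep I ∧ I.ncard = n} with hA
  have hbdd : BddAbove A := ⟨M.E.ncard, by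
    rintro _ ⟨I, hI, -, rfl⟩
    exact Set.ncard_le_ncard hI hfin⟩
  have hsup : sSup A = 4 := hrank
  have hmem : sSup A ∈ A := Nat.sSup_mem ⟨0, ∅, by simp, by simp, by simp⟩ hbdd
  rw [hsup] at hmem
  obtain ⟨I, hIE, hI, hI4⟩ := hmem
  have hIfin : I.Finite := hfin.subset hIE
  have hIli : LinearIndepOn (ZMod 2) φ I := (hφ I hIE).1 hI
  have hspan : ∀ e ∈ M.E, φ e ∈ Submodule.span (ZMod 2) (φ '' I) := by
    intro e he
    by_cases heI : e ∈ I
    · exact Submodule.subset_span ⟨e, heI, rfl⟩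
    by_contra hne
    have hins : insert e I ⊆ M.E := Set.insert_subset he hIE
    have h5 : M.Indep (insert e I) := (hφ _ hins).2 (hIli.insert hne)
    have h6 : (insert e I).ncard ≤ sSup A := le_csSup hbdd ⟨_, hins, h5, rfl⟩
    rw [Set.ncard_insert_of_notMem heI hIfin] at h6
    omega
  set W := Submodule.span (ZMod 2) (φ '' I) with hW
  have hWrank : Module.finrank (ZMod 2) W = 4 := by
    haveI := hIfin.fintype
    have := finrank_span_eq_card (R := ZMod 2) (b := fun i : I => φ i) hIli
    rw [hW, Set.image_eq_range, this, ← hI4, ← Nat.card_eq_fintype_card, Nat.card_coe_set_eq]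
  let L : W ≃ₗ[ZMod 2] (Fin 4 → ZMod 2) := LinearEquiv.ofFinrankEq _ _ (by simp [hWrank])
  obtain ⟨g, hg⟩ := LinearMap.exists_extend (L : W →ₗ[ZMod 2] (Fin 4 → ZMod 2))
  have hgW : ∀ x (hx : x ∈ W), g x = L ⟨x, hx⟩ := fun x hx => LinearMap.congr_fun hg ⟨x, hx⟩
  have hginj : Set.InjOn g W := by
    intro x hx y hy h
    rw [hgW x hx, hgW y hy] at h
    simpa using L.injective h
  have hφinj : Set.InjOn φ M.E := by
    intro x hx y hy h
    have h2 := (hφ {x, y} (by rintro z (rfl | rfl) <;> assumption)).1 (hsimple x hx y hy)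
    have := h2.injective (a₁ := ⟨x, by simp⟩) (a₂ := ⟨y, by simp⟩) h
    simpa using this
  have hφne : ∀ x ∈ M.E, φ x ≠ 0 := by
    intro x hx
    have h2 := (hφ {x, x} (by rintro z (rfl | rfl) <;> assumption)).1 (hsimple x hx x hx)
    exact h2.ne_zero ⟨x, by simp⟩
  have hψinj : Set.InjOn (fun e => g (φ e)) M.E := by
    intro x hx y hy h
    exact hφinj hx hy (hginj (hspan x hx) (hspan y hy) h)
  have hψne : ∀ x ∈ M.E, g (φ x) ≠ 0 := by
    intro x hx h
    exact hφne x hx (hginj (hspan x hx) W.zero_mem (by rw [h, map_zero]))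
  -- the missing points
  let P : Finset (Fin 4 → ZMod 2) := (hfin.image fun e => g (φ e)).toFinset
  have hPcard : 12 ≤ P.card := by
    rw [← Set.ncard_eq_toFinset_card, Set.ncard_image_of_injOn hψinj]
    omega
  have hP0 : (0 : Fin 4 → ZMod 2) ∉ P := by
    simp only [P, Set.Finite.mem_toFinset]
    rintro ⟨e, he, h⟩
    exact hψne e he h
  have hScard : (insert 0 P)ᶜ.card ≤ 3 := by
    rw [Finset.card_compl, Finset.card_insert_of_notMem hP0]
    simp [ZMod.card]
    omega
  obtain ⟨f, hf, hfS⟩ := exists_functional_aux _ hScard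
  obtain ⟨T, hT, hT0⟩ := exists_equiv_aux f hf
  have hTs : Function.Surjective T := LinearMap.injective_iff_surjective.1 hT
  have hcon : M.con ∅ = M := by
    rw [Matroid.con, Matroid.del, Set.diff_empty, Matroid.restrict_ground_eq_self, Matroid.dual_dual]
  refine ⟨(M.con ∅).del {e | f (g (φ e)) ≠ 1}, ⟨_, _, rfl⟩, fun e => T (g (φ e)), ?_, ?_⟩
  · rw [hcon]
    intro J hJ
    have hJE : J ⊆ M.E := fun x hx => (hJ hx).1
    have h1 : (M.del {e | f (g (φ e)) ≠ 1}).Indep J ↔ M.Indep J := by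
      rw [Matroid.del, Matroid.restrict_indep_iff]
      exact and_iff_left hJ
    rw [h1, hφ J hJE]
    have hle : Submodule.span (ZMod 2) (Set.range (J.restrict φ)) ≤ W := by
      rw [Submodule.span_le]
      rintro _ ⟨⟨x, hx⟩, rfl⟩
      exact hspan x (hJE hx)
    refine (LinearMap.linearIndependent_iff_of_injOn (T ∘ₗ g) (v := J.restrict φ) ?_).symm
    intro x hx y hy h
    exact hginj (hle hx) (hle hy) (hT h)
  · rw [hcon]
    refine ⟨?_, ?_, ?_⟩
    · rintro e ⟨-, he⟩
      simpa [agVecs, hT0] using he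
    · rintro x ⟨hx, -⟩ y ⟨hy, -⟩ h
      exact hψinj hx hy (hT h)
    · intro y hy
      obtain ⟨x, rfl⟩ := hTs y
      have hfx : f x = 1 := by rw [← hT0]; exact hy
      have hxP : x ∈ insert 0 P := by
        by_contra h
        rw [hfS x (Finset.mem_compl.2 h)] at hfx
        exact zero_ne_one hfx
      rw [Finset.mem_insert] at hxP
      rcases hxP with rfl | hxP
      · simp at hfx
      simp only [P, Set.Finite.mem_toFinset] at hxP
      obtain ⟨e, he, rfl⟩ := hxP
      exact ⟨e, ⟨he, by simpa using hfx⟩, rfl⟩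
end

section
/- Let M be a simple binary matroid of rank 4 with no AG(3,2)-minor and with exactly 11 elements. Then M is isomorphic to M(K_5)^+, the unique one-point rank-preserving extension of M(K_5). -/
open Matroid Set

variable {α : Type*}

/-- The eleven points of `M(K₅)⁺`, the unique one-point rank-preserving extension
of `M(K₅)`, given by the columns of the matrix in the paper. -/
def mk5plusVecs : Set (Fin 4 → ZMod 2) :=
  {![1,1,0,0], ![1,0,1,0], ![1,0,0,1], ![1,0,0,0], ![0,1,1,0], ![0,1,0,1],
    ![0,1,0,0], ![0,0,1,1], ![0,0,1,0], ![0,0,0,1], ![0,1,1,1]}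

/-- Composing a representation with a linear map injective on the span of the image. -/
lemma Matroid.IsRepBy.comp_aux {M : Matroid α} {W W' : Type*} [AddCommGroup W]
    [Module (ZMod 2) W] [AddCommGroup W'] [Module (ZMod 2) W'] {φ : α → W}
    (h : M.IsRepBy (ZMod 2) φ) (L : W →ₗ[ZMod 2] W')
    (hL : Disjoint (Submodule.span (ZMod 2) (φ '' M.E)) (LinearMap.ker L)) :
    M.IsRepBy (ZMod 2) (fun a => L (φ a)) := by
  intro I hI
  rw [h I hI]
  have := L.linearIndependent_iff_of_disjoint (v := fun x : I => φ x)
    (hL.mono_left (Submodule.span_mono (by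
      rintro _ ⟨x, rfl⟩; exact ⟨x, hI x.2, rfl⟩)))
  exact this.symm

/-- A rank-four binary matroid with finite ground set is represented in `GF(2)⁴`. -/
lemma exists_rep_four (M : Matroid α) (hbin : M.IsBinaryM) (hrank : M.rkM = 4)
    (hfin : M.E.Finite) :
    ∃ ψ : α → (Fin 4 → ZMod 2), M.IsRepBy (ZMod 2) ψ := by
  obtain ⟨n, φ, hφ⟩ := hbin
  set S : Set ℕ := {n : ℕ | ∃ I ⊆ M.E, M.Indep I ∧ I.ncard = n} with hS
  have hsup : sSup S = 4 := hrank
  have hbdd : BddAbove S := by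
    refine ⟨M.E.ncard, ?_⟩
    rintro m ⟨I, hI, -, rfl⟩
    exact Set.ncard_le_ncard hI hfin
  have hne : S.Nonempty := ⟨0, ∅, by simp, M.empty_indep, by simp⟩
  have hmem : 4 ∈ S := hsup ▸ Nat.sSup_mem hne hbdd
  obtain ⟨I, hIE, hI, hIc⟩ := hmem
  have hIfin : I.Finite := hfin.subset hIE
  have hlin : LinearIndepOn (ZMod 2) φ I := (hφ I hIE).1 hI
  have hspan : φ '' M.E ⊆ Submodule.span (ZMod 2) (φ '' I) := by
    rintro _ ⟨e, he, rfl⟩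
    by_contra hcon
    have heI : e ∉ I := fun h => hcon (Submodule.subset_span ⟨e, h, rfl⟩)
    have h5 := hlin.insert hcon
    have hsub : insert e I ⊆ M.E := Set.insert_subset he hIE
    have hind : M.Indep (insert e I) := (hφ _ hsub).2 h5
    have : (insert e I).ncard ≤ sSup S := le_csSup hbdd ⟨_, hsub, hind, rfl⟩
    rw [Set.ncard_insert_of_notMem heI hIfin, hIc, hsup] at this
    omega
  set W := Submodule.span (ZMod 2) (φ '' I) with hW
  have hWr : Module.finrank (ZMod 2) W = Module.finrank (ZMod 2) (Fin 4 → ZMod 2) := by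
    have := hIfin.fintype
    have h1 := finrank_span_eq_card (R := ZMod 2) (b := fun x : I => φ x) hlin
    rw [← Set.image_eq_range] at h1
    rw [hW, h1, Module.finrank_fin_fun, ← hIc, Set.ncard_eq_toFinset_card', Set.toFinset_card]
  let e : W ≃ₗ[ZMod 2] (Fin 4 → ZMod 2) := LinearEquiv.ofFinrankEq _ _ hWr
  obtain ⟨L, hL⟩ := LinearMap.exists_extend (e : W →ₗ[ZMod 2] (Fin 4 → ZMod 2))
  refine ⟨fun a => L (φ a), hφ.comp_aux L ?_⟩
  refine Disjoint.mono_left (Submodule.span_le.2 hspan) ?_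
  rw [Submodule.disjoint_def]
  intro x hx hx0
  have h1 : e ⟨x, hx⟩ = L x := (LinearMap.congr_fun hL ⟨x, hx⟩).symm
  rw [LinearMap.mem_ker.1 hx0] at h1
  have h2 := e.map_eq_zero_iff.1 h1
  simpa using h2

/-- Every nonzero functional on `GF(2)⁴` is the first coordinate in some coordinate system. -/
lemma exists_equiv_functional (f : (Fin 4 → ZMod 2) →ₗ[ZMod 2] ZMod 2) (hf : f ≠ 0) :
    ∃ g : (Fin 4 → ZMod 2) ≃ₗ[ZMod 2] (Fin 4 → ZMod 2), ∀ x, g x 0 = f x := by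
  obtain ⟨i, hi⟩ : ∃ i, f (Pi.single i 1) ≠ 0 := by
    by_contra! hcon
    apply hf
    ext i
    simpa using hcon i
  let g : (Fin 4 → ZMod 2) →ₗ[ZMod 2] (Fin 4 → ZMod 2) :=
    LinearMap.pi fun j => if j = 0 then f else
      if j = i then LinearMap.proj 0 else LinearMap.proj j
  have hg : ∀ x j, g x j = if j = 0 then f x else if j = i then x 0 else x j := by
    intro x j
    simp only [g, LinearMap.pi_apply]
    split_ifs <;> rfl
  have hinj : Function.Injective g := by
    rw [← LinearMap.ker_eq_bot, LinearMap.ker_eq_bot']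
    intro x hx
    have h0 : f x = 0 := by simpa [hx] using (hg x 0).symm
    have hj : ∀ j, j ≠ i → x j = 0 := by
      intro j hji
      by_cases hj0 : j = 0
      · subst hj0
        have := hg x i
        simpa [hx, Ne.symm hji] using this.symm
      · simpa [hx, hj0, hji] using (hg x j).symm
    have hxs : x = x i • Pi.single i (1 : ZMod 2) := by
      ext j
      by_cases hji : j = i
      · subst hji; simp
      · simp [hji, hj j hji]
    have hxi : x i = 0 := by
      rw [hxs, map_smul, smul_eq_mul] at h0
      exact (mul_eq_zero.1 h0).resolve_right hi
    rw [hxs, hxi, zero_smul]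
  refine ⟨LinearEquiv.ofInjectiveEndo g hinj, fun x => ?_⟩
  simp [hg]

lemma del_isMinorOf (M : Matroid α) (D : Set α) : (M.del D).IsMinorOf M := by
  refine ⟨∅, D, ?_⟩
  have h : M.con ∅ = M := by
    rw [Matroid.con, Matroid.del, Set.sdiff_empty, Matroid.restrict_ground_eq_self,
      Matroid.dual_dual]
  rw [h]

/-- The four nonzero vectors missing from `mk5plusVecs`. -/
def missVecs : Fin 4 → (Fin 4 → ZMod 2) :=
  ![![1,1,1,0], ![1,1,0,1], ![1,0,1,1], ![1,1,1,1]]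

lemma mem_mk5plus_iff (x : Fin 4 → ZMod 2) :
    x ∈ mk5plusVecs ↔ x ≠ 0 ∧ x ∉ Set.range missVecs := by
  simp only [mk5plusVecs, Set.mem_insert_iff, Set.mem_singleton_iff, Set.mem_range, missVecs]
  revert x
  decide

lemma missVecs_indep : LinearIndependent (ZMod 2) missVecs := by
  rw [Fintype.linearIndependent_iff]
  unfold missVecs
  decide

theorem rank_four_extremal {α : Type*} (M : Matroid α)
    (hbin : M.IsBinaryM) (hsimple : M.IsSimpleM) (hrank : M.rkM = 4)
    (hAG : ¬ M.HasAGMinor) (hsize : M.E.ncard = 11) :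
    M.IsBinaryIsoTo mk5plusVecs := by
  classical
  have hfin : M.E.Finite := Set.finite_of_ncard_ne_zero (by omega)
  obtain ⟨ψ, hψ⟩ := exists_rep_four M hbin hrank hfin
  have hpair : ∀ e ∈ M.E, ∀ f ∈ M.E, LinearIndepOn (ZMod 2) ψ {e, f} := fun e he f hf =>
    (hψ _ (Set.insert_subset he (Set.singleton_subset_iff.2 hf))).1 (hsimple e he f hf)
  have hinj : Set.InjOn ψ M.E := fun e he f hf hef =>
    (hpair e he f hf).injOn (by simp) (by simp) hef
  have hne0 : ∀ e ∈ M.E, ψ e ≠ 0 := fun e he => (hpair e he e he).ne_zero (by simp)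
  -- the missing points
  set T : Set (Fin 4 → ZMod 2) := {x | x ≠ 0 ∧ x ∉ ψ '' M.E} with hT
  have hTc : T.ncard = 4 := by
    have h1 : T = (insert 0 (ψ '' M.E))ᶜ := by
      ext x; simp [hT]
    have h0 : (0 : Fin 4 → ZMod 2) ∉ ψ '' M.E := by
      rintro ⟨e, he, h⟩; exact hne0 e he h
    rw [h1, Set.ncard_compl, Set.ncard_insert_of_notMem h0 (hfin.image ψ),
      hinj.ncard_image, hsize]
    simp
  have hspan : Submodule.span (ZMod 2) T = ⊤ := by
    by_contra hcon
    obtain ⟨f, hf0, hf⟩ := Submodule.exists_le_ker_of_lt_top _ (lt_top_iff_ne_top.2 hcon)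
    obtain ⟨g, hg⟩ := exists_equiv_functional f hf0
    apply hAG
    refine ⟨M.del {e | f (ψ e) ≠ 1}, del_isMinorOf _ _, fun a => g (ψ a), ?_, ?_, ?_, ?_⟩
    · have hr := hψ.comp_aux (g : (Fin 4 → ZMod 2) →ₗ[ZMod 2] (Fin 4 → ZMod 2)) (by simp)
      intro I hI
      have hI' : I ⊆ M.E \ {e | f (ψ e) ≠ 1} := hI
      rw [Matroid.del, Matroid.restrict_indep_iff, and_iff_left hI']
      exact hr I (hI'.trans Set.sdiff_subset)
    · intro a ha
      have ha' : a ∈ M.E \ {e | f (ψ e) ≠ 1} := ha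
      simpa [agVecs, hg] using ha'.2
    · intro a ha b hb hab
      exact hinj ha.1 hb.1 (g.injective hab)
    · intro y hy
      have hfy : f (g.symm y) = 1 := by rw [← hg]; simpa [agVecs] using hy
      have hyT : g.symm y ∉ T := by
        intro h
        have := LinearMap.mem_ker.1 (hf (Submodule.subset_span h))
        rw [hfy] at this
        exact one_ne_zero this
      have hy0 : g.symm y ≠ 0 := by
        intro h
        rw [h, map_zero] at hfy
        exact zero_ne_one hfy
      obtain ⟨e, he, hey⟩ : g.symm y ∈ ψ '' M.E := by
        by_contra h; exact hyT ⟨hy0, h⟩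
      refine ⟨e, ⟨he, ?_⟩, ?_⟩
      · simp [hey, hfy]
      · simp [hey]
  obtain ⟨t, ht⟩ : ∃ t : Fin 4 → (Fin 4 → ZMod 2), Set.range t = T := by
    have hc : Nat.card T = 4 := by rw [Nat.card_coe_set_eq, hTc]
    refine ⟨fun i => ((Finite.equivFinOfCardEq hc).symm i : T), ?_⟩
    have h2 := (Finite.equivFinOfCardEq hc).symm.surjective.range_comp (Subtype.val : T → _)
    rw [Subtype.range_coe] at h2
    exact h2
  let b := basisOfTopLeSpanOfCardEqFinrank (R := ZMod 2) t (by rw [ht, hspan]) (by simp)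
  let c := basisOfLinearIndependentOfCardEqFinrank missVecs_indep (by simp)
  let g := b.equiv c (Equiv.refl _)
  have hgt : ∀ i, g (t i) = missVecs i := by
    intro i
    have h1 : g (b i) = c i := b.equiv_apply i c (Equiv.refl _)
    simpa [b, c] using h1
  have hgT : ∀ x, g x ∈ Set.range missVecs ↔ x ∈ T := by
    intro x
    rw [← ht]
    constructor
    · rintro ⟨i, hi⟩
      exact ⟨i, g.injective (by rw [hgt, hi])⟩
    · rintro ⟨i, rfl⟩
      exact ⟨i, (hgt i).symm⟩
  refine ⟨fun a => g (ψ a), hψ.comp_aux (g : (Fin 4 → ZMod 2) →ₗ[ZMod 2] (Fin 4 → ZMod 2)) (by simp), ?_, ?_, ?_⟩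
  · intro a ha
    rw [mem_mk5plus_iff, hgT]
    refine ⟨by simpa using hne0 a ha, fun h => h.2 ⟨a, ha, rfl⟩⟩
  · intro a ha b hb hab
    exact hinj ha hb (g.injective hab)
  · intro y hy
    rw [mem_mk5plus_iff, ← g.apply_symm_apply y, hgT] at hy
    have hy0 : g.symm y ≠ 0 := by
      intro h; exact hy.1 (by simp [h])
    obtain ⟨e, he, hey⟩ : g.symm y ∈ ψ '' M.E := by
      by_contra h; exact hy.2 ⟨hy0, h⟩
    exact ⟨e, he, by simp [hey]⟩
end

section
/- Every simple binary matroid of rank 5 with no AG(3,2)-minor has at most 15 elements. -/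
open Matroid Set

variable {α : Type*}

namespace RFB

/-- The vector of `GF(2)^5` whose coordinates are the low five bits of `k`. -/
def vec (k : ℕ) : Fin 5 → ZMod 2 := fun i => if k.testBit i then 1 else 0

/-- Parity of the low five bits. -/
def par (k : ℕ) : Bool :=
  xor (k.testBit 0) (xor (k.testBit 1) (xor (k.testBit 2) (xor (k.testBit 3) (k.testBit 4))))

/-- `mask` contains `e`, and contracting `e` gives the complement of the hyperplane `g`. -/
def ag (mask e g : ℕ) : Bool :=
  Nat.blt e 32 && Nat.blt 0 g && Nat.blt g 32 && mask.testBit e && !par (g &&& e) &&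
    (List.range 32).all fun v =>
      !par (g &&& v) || mask.testBit v || mask.testBit (v ^^^ e)

/-- Odd vectors which are not basis vectors. -/
def wt3 : List ℕ := [7, 11, 13, 14, 19, 21, 22, 25, 26, 28, 31]

/-- Nonzero even vectors. -/
def evens : List ℕ := [3, 5, 6, 9, 10, 12, 15, 17, 18, 20, 23, 24, 27, 29, 30]

/-- Mask of a list. -/
def maskOf : List ℕ → ℕ
  | [] => 0
  | a :: l => (1 <<< a) ||| maskOf l

/-- Exhaustive search with a bounded number of exclusions. -/
def search : List (ℕ × List (ℕ × ℕ × ℕ)) → ℕ → ℕ → Bool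
  | [], _, _ => false
  | (v, cls) :: rest, cur, s =>
    (match s with
      | 0 => true
      | s' + 1 => search rest cur s') &&
    ((cls.any fun m => Nat.beq (m.1 &&& (cur ||| (1 <<< v))) m.1) ||
      search rest (cur ||| (1 <<< v)) s)

/-- The clauses, for each of the six configurations of missing odd vectors. -/
def cases : List (List ℕ × ℕ × List (ℕ × List (ℕ × ℕ × ℕ))) := [
  ([], 10, [
    (15, [(32768, 7, 8)]),
    (23, [(8388608, 7, 16)]),
    (27, [(134217728, 11, 16)]),
    (29, [(536870912, 13, 16)]),
    (30, [(1073741824, 14, 16)]),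
    (3, []),
    (5, [(40, 7, 6)]),
    (6, [(96, 7, 3), (72, 7, 5)]),
    (9, [(520, 11, 10), (544, 13, 12)]),
    (10, [(1536, 11, 3), (1032, 11, 9), (1088, 14, 12)]),
    (12, [(4608, 13, 5), (4128, 13, 9), (5120, 14, 6), (4160, 14, 10)]),
    (17, [(131080, 19, 18), (131104, 21, 20), (131584, 25, 24)]),
    (18, [(393216, 19, 3), (262152, 19, 17), (262208, 22, 20), (263168, 26, 24)]),
    (20, []),
    (24, [])]),
  ([7], 9, [
    (27, [(134217728, 11, 16)]),
    (29, [(536870912, 13, 16)]),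
    (30, [(1073741824, 14, 16)]),
    (15, []),
    (10, [(33792, 13, 2)]),
    (17, []),
    (18, [(393216, 19, 3), (263168, 26, 24)]),
    (12, [(36864, 11, 4), (5120, 14, 6)]),
    (9, [(1536, 11, 3), (4608, 13, 5), (33280, 14, 1), (131584, 25, 24)]),
    (23, [(8650752, 21, 2), (8519680, 22, 1), (8421376, 31, 24)]),
    (20, [(9437184, 19, 4), (1179648, 21, 5), (1310720, 22, 6), (1052672, 28, 24)]),
    (24, []),
    (3, []),
    (6, [(17826376, 9, 18), (25166920, 10, 21), (16912456, 12, 18), (17072200, 15, 21)]),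
    (5, [(17039968, 9, 20), (25166376, 9, 22), (17826856, 10, 17), (16909408, 10, 20), (17043496, 12, 17), (25170016, 12, 19), (17858656, 15, 19), (16941096, 15, 22)])]),
  ([31], 9, [
    (29, []),
    (15, [(536903680, 13, 18)]),
    (30, [(1073774592, 14, 17), (1610612736, 28, 3)]),
    (5, [(1073741856, 26, 4)]),
    (6, [(96, 7, 3), (536870976, 25, 4)]),
    (27, [(134250496, 11, 20), (134217792, 25, 2), (671088640, 25, 6), (134217760, 26, 1), (1207959552, 26, 5)]),
    (17, [(163840, 14, 1), (1073872896, 14, 16), (131104, 21, 20)]),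
    (3, [(72, 7, 5), (40, 7, 6), (131080, 19, 18), (536870920, 28, 1), (1073741832, 28, 2)]),
    (9, [(520, 11, 10), (544, 13, 12), (1073742336, 22, 8), (131584, 25, 24)]),
    (10, [(1536, 11, 3), (1032, 11, 9), (1088, 14, 12), (536871936, 21, 8)]),
    (23, [(8421376, 7, 24), (142606336, 19, 12), (8389632, 21, 2), (545259520, 21, 10), (8389120, 22, 1), (1082130432, 22, 9)]),
    (24, [(16809984, 7, 8), (25165824, 7, 16), (16908288, 25, 9), (16777728, 25, 17), (16778240, 26, 18)]),
    (20, [(1081344, 11, 4), (135266304, 11, 16), (1179648, 21, 5), (1048608, 21, 17), (1048640, 22, 18)]),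
    (18, []),
    (12, [])]),
  ([7, 11], 8, [
    (29, [(536870912, 13, 16)]),
    (30, [(1073741824, 14, 16)]),
    (17, []),
    (18, [(393216, 19, 3)]),
    (20, []),
    (23, [(9437184, 19, 4)]),
    (24, []),
    (27, [(150994944, 19, 8)]),
    (3, [(18087944, 19, 17), (17956872, 19, 18), (25427976, 19, 21), (25296904, 19, 22), (135528456, 19, 25), (135397384, 19, 26), (142868488, 19, 29), (142737416, 19, 30)]),
    (5, []),
    (6, []),
    (9, [(134349408, 9, 20), (17039968, 9, 20), (142737952, 17, 12), (135397952, 17, 12), (18088480, 18, 12), (25428544, 18, 12), (135266856, 20, 1), (17826376, 20, 10), (142606920, 23, 5), (25166376, 23, 14)]),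
    (10, [(1632, 13, 12), (1312288, 5, 24), (8521248, 5, 24), (8652352, 6, 24), (1181248, 6, 24), (16909408, 10, 20), (134480992, 10, 20), (25297952, 17, 12), (17957952, 17, 12), (135529504, 18, 12), (142869568, 18, 12), (135267400, 20, 2), (17826856, 20, 9), (142607400, 23, 6), (25166920, 23, 13)]),
    (12, [(4672, 13, 5), (5152, 13, 9), (135270496, 12, 19), (135271936, 12, 19), (25170016, 12, 19), (25171456, 12, 19), (1184776, 17, 6), (134352936, 17, 6), (8524296, 17, 10), (16912456, 17, 10), (1315336, 18, 5), (134484040, 18, 5), (8655880, 18, 9), (17043496, 18, 9), (135532576, 20, 11), (135401536, 20, 11), (25301024, 23, 11), (25432128, 23, 11), (25432576, 24, 7), (25302016, 24, 7), (135401984, 27, 7), (135533568, 27, 7)]),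
    (15, [(33856, 13, 2), (33312, 13, 14), (38400, 13, 7), (36960, 13, 11)])]),
  ([7, 25], 8, [
    (23, []),
    (29, []),
    (30, [(1082130432, 14, 16), (1610612736, 26, 4)]),
    (9, []),
    (18, [(8650752, 21, 2)]),
    (20, [(537919488, 13, 16), (9437184, 19, 4), (1310720, 22, 6)]),
    (6, []),
    (15, [(1073774592, 22, 8), (8421376, 31, 24)]),
    (10, [(33792, 13, 2), (263168, 26, 24), (8390208, 14, 12), (1073743424, 14, 28)]),
    (12, [(36864, 11, 4), (5120, 14, 6), (536875008, 21, 8), (1052672, 28, 24), (8393280, 14, 10), (1073746496, 14, 26)]),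
    (27, [(134479872, 11, 16), (134218752, 19, 8), (1207959552, 28, 2), (671088640, 31, 6)]),
    (24, [(562036800, 31, 10), (159383616, 31, 12), (553680960, 31, 18), (151027776, 31, 20), (553649728, 6, 8), (150999616, 6, 8)]),
    (17, [(1212480, 22, 18), (426048, 22, 20), (1074921536, 22, 26), (1074135104, 22, 28), (554041408, 6, 16), (152174656, 6, 16), (1181248, 6, 24), (397888, 6, 24)]),
    (5, [(1050144, 13, 12), (1081888, 13, 14), (536872480, 13, 28), (536904224, 13, 30), (397344, 21, 20), (8523808, 21, 22), (537264160, 21, 28), (545390624, 21, 30), (152043552, 28, 12), (1091567648, 28, 14), (150999072, 28, 20), (1090523168, 28, 22), (1090520608, 5, 8), (151028256, 5, 8), (1090912288, 5, 16), (159514656, 5, 16), (8521248, 5, 24), (426528, 5, 24), (16909408, 10, 20), (17039968, 18, 12), (134349408, 27, 28)]),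
    (3, [(266760, 11, 10), (295432, 11, 14), (134222344, 11, 26), (134251016, 11, 30), (1180680, 19, 18), (8520712, 19, 22), (16912456, 12, 18), (16941096, 15, 22), (17826376, 20, 10), (25166376, 23, 14), (537002568, 29, 26), (1073873448, 30, 30)])]),
  ([7, 31], 8, [
    (12, []),
    (17, []),
    (18, [(393216, 19, 3)]),
    (10, [(5120, 14, 6), (263168, 26, 24)]),
    (27, [(134221824, 19, 8)]),
    (20, [(135266304, 11, 16), (1179648, 21, 5), (1310720, 22, 6), (1052672, 28, 24)]),
    (24, []),
    (6, [(151126080, 25, 11)]),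
    (29, [(537133056, 13, 16), (536871936, 21, 8), (671088640, 25, 6), (553779264, 25, 13)]),
    (23, [(159645760, 6, 16), (563085376, 6, 16)]),
    (9, [(1536, 11, 3), (4608, 13, 5), (131584, 25, 24), (9437760, 22, 19), (8651328, 22, 21), (150995520, 25, 19), (553648704, 25, 21)]),
    (3, [(8654856, 19, 21), (8523784, 19, 22), (142868488, 19, 29), (142737416, 19, 30), (554696712, 28, 13), (553652232, 28, 21), (562167816, 3, 16), (142606920, 9, 2), (17826376, 9, 18), (25166920, 10, 21), (16912456, 12, 18)]),
    (30, [(1073872896, 14, 16), (1073742336, 22, 8), (1207959552, 26, 5), (1610612736, 28, 3), (1083179072, 22, 27), (1082392640, 22, 29), (1091567624, 28, 14), (1090523144, 28, 22), (1099169800, 3, 16), (1082134600, 12, 2)]),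
    (15, [(1082376, 11, 13), (1081864, 11, 14), (134251528, 11, 29), (134251016, 11, 30), (168000, 14, 11), (164928, 14, 13), (1073778752, 14, 27), (1073775680, 14, 29), (553681416, 3, 8), (1090552840, 3, 8), (8684040, 3, 24), (8553480, 3, 24), (151028800, 6, 8), (553685056, 6, 8), (9471040, 6, 24), (8687680, 6, 24), (17072200, 18, 13), (545292360, 29, 29)]),
    (5, [(299040, 13, 11), (295456, 13, 14), (536907808, 13, 27), (536904224, 13, 30), (9438240, 21, 19), (8520736, 21, 22), (25166376, 9, 22), (25170016, 12, 19), (16941096, 17, 14), (17858656, 20, 11), (142639200, 27, 27), (1082163240, 30, 30)])])]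

/-- The odd vectors known to be present. -/
def amask (X : List ℕ) : ℕ := maskOf (wt3.filter fun k => !X.contains k)

/-- Validity of a case. -/
def caseOK (c : List ℕ × ℕ × List (ℕ × List (ℕ × ℕ × ℕ))) : Bool :=
  Nat.beq (c.2.1 + c.1.length) 10 &&
  (c.2.2.all fun x => x.2.all fun m => ag (amask c.1 ||| m.1) m.2.1 m.2.2) &&
  (c.2.2.map Prod.fst).all (fun v => evens.contains v) &&
  evens.all (fun v => (c.2.2.map Prod.fst).contains v) &&
  Nat.beq c.2.2.length 15 &&
  search c.2.2 0 c.2.1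

theorem cases_ok : cases.all caseOK = true := by decide +kernel

/-- Action of a permutation on encoded vectors. -/
def pm (σ : Equiv.Perm (Fin 5)) (k : ℕ) : ℕ :=
  (if k.testBit (σ 0) then 1 else 0) + (if k.testBit (σ 1) then 2 else 0) +
  (if k.testBit (σ 2) then 4 else 0) + (if k.testBit (σ 3) then 8 else 0) +
  (if k.testBit (σ 4) then 16 else 0)

theorem perm_ok : ∀ p ∈ wt3, ∀ q ∈ wt3, p ≤ q → ∃ σ : Equiv.Perm (Fin 5),
    ∃ X ∈ cases.map Prod.fst, X.length = ({p, q} : Finset ℕ).card ∧ ∀ k ∈ wt3, k ∉ X →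
      pm σ k ≠ p ∧
      pm σ k ≠ q := by
  decide +kernel

theorem vec_pm (σ : Equiv.Perm (Fin 5)) (k : ℕ) : vec (pm σ k) = vec k ∘ σ := by
  have h : ∀ b0 b1 b2 b3 b4 : Bool, ∀ i : Fin 5,
    ((if b0 then 1 else 0) + (if b1 then 2 else 0) +
  (if b2 then 4 else 0) + (if b3 then 8 else 0) +
  (if b4 then 16 else 0) : ℕ).testBit i = ![b0, b1, b2, b3, b4] i := by decide
  funext i
  have h2 : (pm σ k).testBit i = k.testBit (σ i) := by
    rw [pm, h]
    fin_cases i <;> rfl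
  simp only [vec, Function.comp, h2]

theorem pm_mem (σ : Equiv.Perm (Fin 5)) : ∀ k ∈ wt3, pm σ k ∈ wt3 := by
  revert σ
  decide +kernel

theorem vec_xor (a b : ℕ) : vec (a ^^^ b) = vec a + vec b := by
  funext i
  simp only [vec, Nat.testBit_xor, Pi.add_apply]
  cases a.testBit i <;> cases b.testBit i <;> decide

theorem vec_dot : ∀ g < 32, ∀ v < 32, ∑ i, vec g i * vec v i = if par (g &&& v) then 1 else 0 := by
  decide +kernel

theorem vec_sum : ∀ v < 32, ∑ i, vec v i = if par v then 1 else 0 := by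
  decide +kernel

theorem vec_ne : ∀ g < 32, 0 < g → vec g ≠ 0 := by
  decide +kernel

theorem vec_surj : ∀ x : Fin 5 → ZMod 2, ∃ k < 32, vec k = x := by
  decide +kernel

theorem vec_inj : ∀ k < 32, ∀ l < 32, vec k = vec l → k = l := by
  decide +kernel

theorem dot_count : ∀ v : Fin 5 → ZMod 2, v ≠ 0 →
    (Finset.univ.filter fun w : Fin 5 → ZMod 2 => w ≠ 0 ∧ ∑ i, w i * v i = 0).card = 15 := by
  decide +kernel
end RFB

namespace RFB
open Module

/-- The geometric certificate of an `AG(3,2)`-minor. -/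
def AGc {V : Type*} [AddCommGroup V] [Module (ZMod 2) V] (S : Set V) : Prop :=
  (∃ e ∈ S, ∃ g : V →ₗ[ZMod 2] ZMod 2, g ≠ 0 ∧ g e = 0 ∧ ∀ v, g v = 1 → v ∈ S ∨ v + e ∈ S) ∨
  (∃ f h : V →ₗ[ZMod 2] ZMod 2, f ≠ 0 ∧ h ≠ 0 ∧ f ≠ h ∧ ∀ v, h v = 1 → f v = 1 → v ∈ S)

/-- The vector with code `k` in a basis. -/
noncomputable def bv {V : Type*} [AddCommGroup V] [Module (ZMod 2) V]
    (β : Basis (Fin 5) (ZMod 2) V) (k : ℕ) : V := β.equivFun.symm (vec k)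

section
variable {V : Type*} [AddCommGroup V] [Module (ZMod 2) V] (β : Basis (Fin 5) (ZMod 2) V)

theorem zmod2 : ∀ x : ZMod 2, x = 0 ∨ x = 1 := by decide

theorem bv_surj (x : V) : ∃ k < 32, bv β k = x := by
  obtain ⟨k, hk, h⟩ := vec_surj (β.equivFun x)
  exact ⟨k, hk, by rw [bv, h]; simp⟩

theorem bv_inj {k l : ℕ} (hk : k < 32) (hl : l < 32) (h : bv β k = bv β l) : k = l :=
  vec_inj k hk l hl (β.equivFun.symm.injective h)

theorem bv_zero : bv β 0 = 0 := by
  have : vec 0 = 0 := by funext i; simp [vec]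
  simp [bv, this]

theorem bv_reindex (σ : Equiv.Perm (Fin 5)) (k : ℕ) :
    bv (β.reindex σ) k = bv β (pm σ k) := by
  simp only [bv, vec_pm, Basis.equivFun_symm_apply, Basis.reindex_apply]
  rw [← Equiv.sum_comp σ]
  simp

theorem bv_h (h : V →ₗ[ZMod 2] ZMod 2) (hβ : ∀ i, h (β i) = 1) {k : ℕ} (hk : k < 32) :
    h (bv β k) = if par k then 1 else 0 := by
  rw [← vec_sum k hk, bv, Basis.equivFun_symm_apply, map_sum]
  simp [hβ]

theorem clause_sound (S : Set V) (mask e g : ℕ) (hag : ag mask e g = true)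
    (hm : ∀ k < 32, mask.testBit k = true → bv β k ∈ S) : AGc S := by
  simp only [ag, Bool.and_eq_true, Nat.blt_eq, List.all_eq_true, List.mem_range,
    Bool.or_eq_true, Bool.not_eq_true'] at hag
  obtain ⟨⟨⟨⟨⟨he, hg0⟩, hg⟩, hme⟩, hpe⟩, hall⟩ := hag
  let G : V →ₗ[ZMod 2] ZMod 2 := ∑ i, vec g i • β.coord i
  have hG : ∀ k < 32, G (bv β k) = if par (g &&& k) then 1 else 0 := by
    intro k hk
    rw [← vec_dot g hg k hk]
    simp [G, bv, LinearMap.sum_apply, Finsupp.single_apply, mul_comm]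
  left
  refine ⟨bv β e, hm e he hme, G, ?_, ?_, ?_⟩
  · intro h0
    apply vec_ne g hg hg0
    funext i
    have : G (β i) = 0 := by rw [h0]; rfl
    simpa [G, LinearMap.sum_apply, Finsupp.single_apply] using this
  · rw [hG e he, hpe]; rfl
  · intro v hv
    obtain ⟨k, hk, rfl⟩ := bv_surj β v
    rw [hG k hk] at hv
    rcases hall k hk with (h1 | h1) | h1
    · rw [h1] at hv; simp at hv
    · exact Or.inl (hm k hk h1)
    · right
      have := hm (k ^^^ e) (Nat.xor_lt_two_pow (n := 5) hk he) h1
      rwa [bv, vec_xor, map_add] at this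

theorem maskOf_testBit (l : List ℕ) (k : ℕ) : (maskOf l).testBit k = true ↔ k ∈ l := by
  induction l with
  | nil => simp [maskOf]
  | cons a l ih =>
    rw [maskOf, Nat.testBit_or, Bool.or_eq_true, ih, List.mem_cons, Nat.one_shiftLeft,
      Nat.testBit_two_pow]
    simp [eq_comm]

theorem search_cons (v : ℕ) (cls : List (ℕ × ℕ × ℕ)) (rest : List (ℕ × List (ℕ × ℕ × ℕ)))
    (cur s : ℕ) : search ((v, cls) :: rest) cur s =
    ((match s with
      | 0 => true
      | s' + 1 => search rest cur s') &&
    ((cls.any fun m => Nat.beq (m.1 &&& (cur ||| (1 <<< v))) m.1) ||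
      search rest (cur ||| (1 <<< v)) s)) := by
  cases s <;> rfl

theorem search_sound (P : ℕ → Bool) (L : List (ℕ × List (ℕ × ℕ × ℕ))) :
    ∀ cur s, (∀ x ∈ L, ∀ m ∈ x.2, ∃ k, m.1.testBit k = true ∧ P k = false) →
      (∀ k, cur.testBit k = true → P k = true) → search L cur s = true →
      s < (L.map Prod.fst).countP (fun k => !P k) := by
  induction L with
  | nil => intro cur s _ _ h; simp [search] at h
  | cons x rest ih =>
    obtain ⟨v, cls⟩ := x
    intro cur s hcl hcur hs
    have hcl' := fun x hx => hcl x (List.mem_cons_of_mem _ hx)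
    rw [search_cons, Bool.and_eq_true] at hs
    obtain ⟨h1, h2⟩ := hs
    rw [List.map_cons, List.countP_cons]
    cases hP : P v
    · simp only [Bool.not_false, if_true]
      cases s with
      | zero => omega
      | succ s' =>
        have := ih cur s' hcl' hcur h1
        omega
    · have hcur' : ∀ k, (cur ||| (1 <<< v)).testBit k = true → P k = true := by
        intro k hk
        rw [Nat.testBit_or, Bool.or_eq_true, Nat.one_shiftLeft, Nat.testBit_two_pow] at hk
        rcases hk with hk | hk
        · exact hcur k hk
        · simp at hk; rw [← hk]; exact hP
      rw [Bool.or_eq_true] at h2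
      rcases h2 with h2 | h2
      · exfalso
        rw [List.any_eq_true] at h2
        obtain ⟨m, hm, hb⟩ := h2
        have hb := Nat.eq_of_beq_eq_true hb
        obtain ⟨k, hk, hPk⟩ := hcl _ List.mem_cons_self m hm
        rw [← hb, Nat.testBit_and, Bool.and_eq_true] at hk
        rw [hcur' k hk.2] at hPk
        cases hPk
      · have := ih _ s hcl' hcur' h2
        simpa using this

theorem ag_lt : ∀ k ∈ wt3, k < 32 := by decide
theorem ev_lt : ∀ k ∈ evens, k < 32 := by decide

open Classical in
theorem final (S : Set V) (X : List ℕ) (hX : X ∈ cases.map Prod.fst)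
    (hodd : ∀ k ∈ wt3, k ∉ X → bv β k ∈ S)
    (hcount : (evens.countP fun k => !decide (bv β k ∈ S)) + X.length ≤ 10) : AGc S := by
  by_contra hS
  obtain ⟨c, hc, rfl⟩ := List.mem_map.1 hX
  have hok := List.all_eq_true.1 cases_ok c hc
  simp only [caseOK, Bool.and_eq_true] at hok
  obtain ⟨⟨⟨⟨⟨h1, h2⟩, h3⟩, h4⟩, h5⟩, h6⟩ := hok
  have h1 := Nat.eq_of_beq_eq_true h1
  have h5 := Nat.eq_of_beq_eq_true h5
  have key := search_sound (fun k => decide (k < 32 → bv β k ∈ S)) c.2.2 0 c.2.1 ?_ (by simp) h6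
  · have hsub : evens ⊆ c.2.2.map Prod.fst := by
      intro v hv
      simpa using List.all_eq_true.1 h4 v hv
    have hnd : evens.Nodup := by decide
    have hperm : evens.Perm (c.2.2.map Prod.fst) :=
      (hnd.subperm hsub).perm_of_length_le (by rw [List.length_map, h5]; decide)
    rw [← hperm.countP_eq] at key
    have : (evens.countP fun k => !decide (k < 32 → bv β k ∈ S)) =
        evens.countP fun k => !decide (bv β k ∈ S) := by
      apply List.countP_congr
      intro k hk
      have := ev_lt k hk
      simp [this]
    rw [this] at key
    omega
  · intro x hx m hm
    have hag := List.all_eq_true.1 (List.all_eq_true.1 h2 x hx) m hm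
    by_contra hno
    push Not at hno
    apply hS
    refine clause_sound β S _ _ _ hag ?_
    intro k hk hbit
    rw [Nat.testBit_or, Bool.or_eq_true] at hbit
    rcases hbit with hbit | hbit
    · rw [amask, maskOf_testBit, List.mem_filter] at hbit
      exact hodd k hbit.1 (by simpa using hbit.2)
    · have := hno k hbit
      simp at this
      exact this hk
end
end RFB

namespace RFB
open Module

section
variable {V : Type*} [AddCommGroup V] [Module (ZMod 2) V]

open Classical in
theorem cnt (β : Basis (Fin 5) (ZMod 2) V) (S Q : Finset V) (l : List ℕ) (hl : l.Nodup)
    (hlt : ∀ k ∈ l, k < 32) (hQ : ∀ v, v ∈ Q ↔ ∃ k ∈ l, bv β k = v ∧ bv β k ∈ S) :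
    Q.card = l.countP fun k => decide (bv β k ∈ S) := by
  have : Q = ((l.filter fun k => decide (bv β k ∈ S)).map (bv β)).toFinset := by
    ext v
    rw [hQ, List.mem_toFinset, List.mem_map]
    constructor
    · rintro ⟨k, hk, h1, h2⟩
      exact ⟨k, List.mem_filter.2 ⟨hk, by simpa using h2⟩, h1⟩
    · rintro ⟨k, hk, h1⟩
      rw [List.mem_filter] at hk
      exact ⟨k, hk.1, h1, by simpa using hk.2⟩
  rw [this, List.toFinset_card_of_nodup, List.length_map, List.countP_eq_length_filter]
  refine List.Nodup.map_on ?_ (hl.filter _)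
  intro x hx y hy hxy
  exact bv_inj β (hlt x (List.mem_filter.1 hx).1) (hlt y (List.mem_filter.1 hy).1) hxy

theorem par_split : ∀ k < 32, (par k = false → k ∈ 0 :: evens) ∧
    (par k = true → k ∈ [1, 2, 4, 8, 16] ++ wt3) := by decide
theorem ev_par : ∀ k ∈ 0 :: evens, k < 32 ∧ par k = false := by decide
theorem od_par : ∀ k ∈ [1, 2, 4, 8, 16] ++ wt3, k < 32 ∧ par k = true := by decide

theorem bv_basis (β : Basis (Fin 5) (ZMod 2) V) : ∀ k ∈ [1, 2, 4, 8, 16], ∃ i, bv β k = β i := by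
  have key : ∀ k ∈ [1, 2, 4, 8, 16], ∃ i : Fin 5, vec k = Pi.single i 1 := by decide
  intro k hk
  obtain ⟨i, hi⟩ := key k hk
  refine ⟨i, ?_⟩
  rw [bv, hi]
  simp

open Classical in
theorem counts (β : Basis (Fin 5) (ZMod 2) V) (S : Finset V) (h0 : 0 ∉ S) (hc : S.card = 16)
    (h : V →ₗ[ZMod 2] ZMod 2) (hβ : ∀ i, h (β i) = 1) (hβS : ∀ i, β i ∉ S) :
    (evens.countP fun k => !decide (bv β k ∈ S)) + (S.filter fun v => h v = 0).card = 15 ∧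
    (wt3.filter fun k => !decide (bv β k ∈ S)).length + 5 = (S.filter fun v => h v = 0).card := by
  have e1 := cnt β S (S.filter fun v => h v = 0) (0 :: evens) (by decide)
    (fun k hk => (ev_par k hk).1) (by
      intro v
      rw [Finset.mem_filter]
      constructor
      · rintro ⟨hv, hh⟩
        obtain ⟨k, hk, rfl⟩ := bv_surj β v
        rw [bv_h β h hβ hk] at hh
        refine ⟨k, (par_split k hk).1 ?_, rfl, hv⟩
        by_contra hp
        simp [hp] at hh
      · rintro ⟨k, hk, rfl, hS⟩
        refine ⟨hS, ?_⟩
        rw [bv_h β h hβ (ev_par k hk).1, (ev_par k hk).2]; rfl)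
  have e2 := cnt β S (S.filter fun v => ¬ h v = 0) ([1, 2, 4, 8, 16] ++ wt3) (by decide)
    (fun k hk => (od_par k hk).1) (by
      intro v
      rw [Finset.mem_filter]
      constructor
      · rintro ⟨hv, hh⟩
        obtain ⟨k, hk, rfl⟩ := bv_surj β v
        rw [bv_h β h hβ hk] at hh
        refine ⟨k, (par_split k hk).2 ?_, rfl, hv⟩
        by_contra hp
        simp [hp] at hh
      · rintro ⟨k, hk, rfl, hS⟩
        refine ⟨hS, ?_⟩
        rw [bv_h β h hβ (od_par k hk).1, (od_par k hk).2]; decide)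
  have e3 := Finset.card_filter_add_card_filter_not (s := S) (fun v => h v = 0)
  have e4 : ([1, 2, 4, 8, 16].countP fun k => decide (bv β k ∈ S)) = 0 := by
    rw [List.countP_eq_zero]
    intro k hk
    obtain ⟨i, hi⟩ := bv_basis β k hk
    simp [hi, hβS i]
  rw [List.countP_append, e4] at e2
  rw [List.countP_cons, bv_zero] at e1
  simp only [h0, decide_false, Bool.false_eq_true, if_false] at e1
  have e5 := List.length_eq_countP_add_countP (fun k => decide (bv β k ∈ S)) (l := evens)
  have e6 := List.length_eq_countP_add_countP (fun k => decide (bv β k ∈ S)) (l := wt3)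
  rw [← List.countP_eq_length_filter]
  have l1 : evens.length = 15 := rfl
  have l2 : wt3.length = 11 := rfl
  have e7 : ∀ l : List ℕ, (l.countP fun k => !decide (bv β k ∈ S)) =
      l.countP fun k => decide (¬ (decide (bv β k ∈ S) = true)) := by
    intro l; congr 1; funext k; simp
  rw [e7, e7]
  omega

open Classical in
theorem stepB (β : Basis (Fin 5) (ZMod 2) V) (S : Finset V) (h0 : 0 ∉ S) (hc : S.card = 16)
    (h : V →ₗ[ZMod 2] ZMod 2) (hβ : ∀ i, h (β i) = 1) (hβS : ∀ i, β i ∉ S)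
    (hb : (S.filter fun v => h v = 0).card ≤ 7) : AGc (S : Set V) := by
  obtain ⟨c1, c2⟩ := counts β S h0 hc h hβ hβS
  obtain ⟨E, hE⟩ : ∃ E, E = wt3.filter fun k => !decide (bv β k ∈ S) := ⟨_, rfl⟩
  have hmem : ∀ k, k ∈ E ↔ k ∈ wt3 ∧ bv β k ∉ S := by
    intro k; rw [hE, List.mem_filter]; simp
  have hnd : E.Nodup := by rw [hE]; exact List.Nodup.filter _ (by decide)
  rw [← hE] at c2
  have main : ∀ p q, p ≤ q → (∀ k, k ∈ E ↔ k = p ∨ k = q) →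
      ({p, q} : Finset ℕ).card = E.length → AGc (S : Set V) := by
    intro p q hpq hEpq hcard
    obtain ⟨σ, X, hX, hlen, hk⟩ := perm_ok p ((hmem p).1 ((hEpq p).2 (Or.inl rfl))).1 q
      ((hmem q).1 ((hEpq q).2 (Or.inr rfl))).1 hpq
    obtain ⟨d1, d2⟩ := counts (β.reindex σ) S h0 hc h (by simp [hβ]) (by simp [hβS])
    refine final (β.reindex σ) S X hX ?_ ?_
    · intro k hk1 hk2
      obtain ⟨n1, n2⟩ := hk k hk1 hk2
      rw [bv_reindex]
      by_contra hn
      rcases (hEpq _).1 ((hmem (pm σ k)).2 ⟨pm_mem σ k hk1, hn⟩) with h | h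
      · exact n1 h
      · exact n2 h
    · simp only [Finset.mem_coe]
      omega
  match E, hnd, c2, hmem, main with
  | [], _, c2, hmem, _ =>
    refine final β S [] (by decide) ?_ ?_
    · intro k hk _
      by_contra hn
      have := (hmem k).2 ⟨hk, hn⟩
      simp at this
    · simp only [Finset.mem_coe, List.length_nil] at *
      omega
  | [p], _, _, _, main => exact main p p le_rfl (by simp) (by simp)
  | [p, q], hnd, _, _, main =>
    have hpq : p ≠ q := by simpa using hnd
    rcases le_total p q with hle | hle
    · exact main p q hle (by simp) (by simp [Finset.card_pair hpq])
    · exact main q p hle (by simp [or_comm]) (by simp [Finset.card_pair hpq.symm])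
  | _ :: _ :: _ :: _, _, c2, _, _ =>
    simp only [List.length_cons] at c2
    omega
end

theorem stepA (S : Finset (Fin 5 → ZMod 2)) (h0 : 0 ∉ S) (hc : S.card = 16) :
    ∃ h : (Fin 5 → ZMod 2) →ₗ[ZMod 2] ZMod 2, h ≠ 0 ∧ (S.filter fun v => h v = 0).card ≤ 7 := by
  classical
  by_contra hno
  push Not at hno
  let W : Finset (Fin 5 → ZMod 2) := Finset.univ.filter fun w => w ≠ 0
  have hW : W.card = 31 := by decide +kernel
  have key : ∀ w ∈ W, 8 ≤ (S.filter fun v => ∑ i, w i * v i = 0).card := by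
    intro w hw
    have hw0 : w ≠ 0 := by simpa [W] using hw
    have := hno (∑ i, w i • LinearMap.proj i) (by
      intro hz
      apply hw0
      funext i
      have := LinearMap.congr_fun hz (Pi.single i 1)
      simpa [LinearMap.sum_apply, Pi.single_apply] using this)
    refine Nat.succ_le_of_lt ?_
    simpa [LinearMap.sum_apply] using this
  have s1 : ∑ w ∈ W, (S.filter fun v => ∑ i, w i * v i = 0).card =
      ∑ v ∈ S, (W.filter fun w => ∑ i, w i * v i = 0).card := by
    simp only [Finset.card_filter]
    exact Finset.sum_comm
  have s2 : ∑ v ∈ S, (W.filter fun w => ∑ i, w i * v i = 0).card = ∑ v ∈ S, 15 := by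
    refine Finset.sum_congr rfl fun v hv => ?_
    rw [← dot_count v (fun hz => h0 (hz ▸ hv)), Finset.filter_filter]
  have s3 := Finset.card_nsmul_le_sum W _ 8 key
  rw [s1, s2, Finset.sum_const, hc, hW] at s3
  simp at s3

theorem core (S : Finset (Fin 5 → ZMod 2)) (h0 : 0 ∉ S) (hc : S.card = 16) :
    AGc (S : Set (Fin 5 → ZMod 2)) := by
  classical
  obtain ⟨h, hh, hb⟩ := stepA S h0 hc
  by_cases hsp : ⊤ ≤ Submodule.span (ZMod 2) {v | h v = 1 ∧ v ∉ S}
  · let β0 := Basis.ofSpan hsp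
    have hm : ∀ i, β0 i ∈ {v | h v = 1 ∧ v ∉ S} := by
      intro i
      exact Basis.ofSpan_subset hsp ⟨i, rfl⟩
    have : Fintype _ := FiniteDimensional.fintypeBasisIndex β0
    have hcard := Module.finrank_eq_card_basis β0
    rw [Module.finrank_fin_fun] at hcard
    let β := β0.reindex (Fintype.equivFinOfCardEq hcard.symm)
    refine stepB β S h0 hc h ?_ ?_ hb
    · intro i; simp only [β, Basis.reindex_apply]; exact (hm _).1
    · intro i; simp only [β, Basis.reindex_apply]; exact (hm _).2
  · obtain ⟨f, hf, hker⟩ := Submodule.exists_le_ker_of_lt_top _ (lt_top_iff_ne_top.2 (fun h => hsp h.ge))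
    right
    have hfT : ∀ v, h v = 1 → f v = 1 → v ∈ S := by
      intro v h1 h2
      by_contra hv
      have := hker (Submodule.subset_span (show v ∈ {v | h v = 1 ∧ v ∉ S} from ⟨h1, hv⟩))
      rw [LinearMap.mem_ker, h2] at this
      exact one_ne_zero this
    by_cases hfh : f = h
    · -- then the whole affine space lies in `S`
      obtain ⟨f', hf', hne⟩ : ∃ f' : (Fin 5 → ZMod 2) →ₗ[ZMod 2] ZMod 2, f' ≠ 0 ∧ f' ≠ h := by
        by_contra hno
        push Not at hno
        have n : ∀ i : Fin 5, (LinearMap.proj i : (Fin 5 → ZMod 2) →ₗ[ZMod 2] ZMod 2) ≠ 0 := by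
          intro i hz
          have := LinearMap.congr_fun hz (Pi.single i 1)
          simp at this
        have e := (hno _ (n 0)).trans (hno _ (n 1)).symm
        have := LinearMap.congr_fun e (Pi.single 0 1)
        simp at this
      exact ⟨f', h, hf', hh, hne, fun v h1 _ => hfT v h1 (by rw [hfh]; exact h1)⟩
    · exact ⟨f, h, hf, hh, hfh, hfT⟩
end RFB

namespace RFB
open Module

theorem coord4 {K : Type*} [AddCommGroup K] [Module (ZMod 2) K] [FiniteDimensional (ZMod 2) K]
    (hK : finrank (ZMod 2) K = 4) (h : K →ₗ[ZMod 2] ZMod 2) (hh : h ≠ 0) :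
    ∃ L : K ≃ₗ[ZMod 2] (Fin 4 → ZMod 2), ∀ x, L x 0 = h x := by
  have hr : LinearMap.range h = ⊤ := LinearMap.range_eq_top.2 (LinearMap.surjective hh)
  have h3 : finrank (ZMod 2) (LinearMap.ker h) = 3 := by
    have := LinearMap.finrank_range_add_finrank_ker h
    rw [hr, finrank_top, Module.finrank_self, hK] at this
    omega
  let u : LinearMap.ker h ≃ₗ[ZMod 2] (Fin 3 → ZMod 2) :=
    LinearEquiv.ofFinrankEq _ _ (by rw [h3]; simp)
  obtain ⟨U, hU⟩ := LinearMap.exists_extend u.toLinearMap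
  let L0 : K →ₗ[ZMod 2] (Fin 4 → ZMod 2) :=
    LinearMap.pi (Fin.cons h fun i => (LinearMap.proj i).comp U)
  have hinj : Function.Injective L0 := by
    rw [← LinearMap.ker_eq_bot, LinearMap.ker_eq_bot']
    intro x hx
    have hx0 : h x = 0 := congrFun hx 0
    have hxU : U x = 0 := by
      funext i
      exact congrFun hx i.succ
    have : u ⟨x, hx0⟩ = 0 := by
      have := LinearMap.congr_fun hU ⟨x, hx0⟩
      simp only [LinearMap.comp_apply, Submodule.subtype_apply] at this
      rw [hxU] at this
      exact this.symm
    have := (LinearEquiv.map_eq_zero_iff u).1 this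
    exact congrArg Subtype.val this
  refine ⟨LinearEquiv.ofInjectiveOfFinrankEq L0 hinj (by rw [hK]; simp), ?_⟩
  intro x
  rfl

theorem mkMinor {α : Type*} {V : Type*} [AddCommGroup V] [Module (ZMod 2) V]
    (M : Matroid α) (ψ : α → V) (C : Set α) (P : α → Prop) (L : V →ₗ[ZMod 2] (Fin 4 → ZMod 2))
    (hs : ∀ y ∈ agVecs, ∃ a ∈ (M ／ C).E, P a ∧ L (ψ a) = y)
    (hind : ∀ I ⊆ (M ／ C).E, (∀ a ∈ I, P a) →
      ((M ／ C).Indep I ↔ LinearIndepOn (ZMod 2) (L ∘ ψ) I)) : M.HasAGMinor := by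
  have : Nonempty α := by
    obtain ⟨a, -⟩ := hs (fun _ => 1) rfl
    exact ⟨a⟩
  choose! c hcE hcP hcL using hs
  have hsub : c '' agVecs ⊆ (M ／ C).E := by
    rintro _ ⟨y, hy, rfl⟩
    exact hcE y hy
  refine ⟨(M ／ C) ↾ (c '' agVecs), ⟨C, (M ／ C).E \ (c '' agVecs), ?_⟩, L ∘ ψ, ?_, ?_⟩
  · exact (Matroid.delete_compl hsub).symm
  · intro I hI
    rw [Matroid.restrict_ground_eq] at hI
    rw [Matroid.restrict_indep_iff, and_iff_left hI]
    refine hind I (hI.trans hsub) ?_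
    intro a ha
    obtain ⟨y, hy, rfl⟩ := hI ha
    exact hcP y hy
  · rw [Matroid.restrict_ground_eq]
    refine ⟨?_, ?_, ?_⟩
    · rintro _ ⟨y, hy, rfl⟩
      simpa [hcL y hy] using hy
    · rintro _ ⟨y, hy, rfl⟩ _ ⟨z, hz, rfl⟩ hyz
      simp only [Function.comp, hcL y hy, hcL z hz] at hyz
      rw [hyz]
    · intro y hy
      exact ⟨c y, ⟨y, hy, rfl⟩, hcL y hy⟩

theorem minor_of_AGc {α : Type*} (M : Matroid α) (ψ : α → (Fin 5 → ZMod 2))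
    (hrep : M.IsRepBy (ZMod 2) ψ) (hsimple : M.IsSimpleM) (S : Set (Fin 5 → ZMod 2))
    (hS : S ⊆ ψ '' M.E) (hAG : AGc S) : M.HasAGMinor := by
  have hrep' : ∀ I ⊆ M.E, (M.Indep I ↔ LinearIndepOn (ZMod 2) ψ I) := hrep
  rcases hAG with ⟨e, he, g, hg, hge, hgS⟩ | ⟨f, h, hf, hh, hfh, hfS⟩
  · obtain ⟨a, ha, rfl⟩ := hS he
    have hai : M.Indep {a} := by simpa using hsimple a ha a ha
    have hane : ψ a ≠ 0 := by
      have := (hrep' {a} (by simpa using ha)).1 hai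
      simpa using this
    obtain ⟨Q, hQdef⟩ : ∃ Q, Q = Submodule.span (ZMod 2) (ψ '' {a}) := ⟨_, rfl⟩
    have hQ : Q ≤ LinearMap.ker g := by
      rw [hQdef, Submodule.span_le]
      rintro _ ⟨b, rfl, rfl⟩
      exact hge
    have hQ4 : finrank (ZMod 2) ((Fin 5 → ZMod 2) ⧸ Q) = 4 := by
      have h1 := Submodule.finrank_quotient_add_finrank Q
      have h2 : finrank (ZMod 2) Q = 1 := by
        rw [hQdef, Set.image_singleton]
        exact finrank_span_singleton hane
      rw [h2, Module.finrank_fin_fun] at h1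
      omega
    obtain ⟨L, hL⟩ := coord4 hQ4 (Q.liftQ g hQ) (by
      intro hz
      apply hg
      apply LinearMap.ext
      intro x
      have := LinearMap.congr_fun hz (Q.mkQ x)
      rwa [Submodule.mkQ_apply, Submodule.liftQ_apply] at this)
    have hLa : L (Q.mkQ (ψ a)) = 0 := by
      have : Q.mkQ (ψ a) = 0 := by
        rw [Submodule.mkQ_apply, Submodule.Quotient.mk_eq_zero]
        rw [hQdef]
        exact Submodule.subset_span ⟨a, rfl, rfl⟩
      rw [this, map_zero]
    refine mkMinor M ψ {a} (fun _ => True) (L.toLinearMap.comp Q.mkQ) ?_ ?_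
    · intro y hy
      obtain ⟨q, rfl⟩ := L.surjective y
      obtain ⟨x, rfl⟩ := Q.mkQ_surjective q
      have hy1 : L (Q.mkQ x) 0 = 1 := hy
      have hgx : g x = 1 := by
        rw [hL] at hy1
        simpa using hy1
      have : ∃ b ∈ M.E, L (Q.mkQ (ψ b)) = L (Q.mkQ x) := by
        rcases hgS x hgx with h | h
        · obtain ⟨b, hb, hbx⟩ := hS h
          exact ⟨b, hb, by rw [hbx]⟩
        · obtain ⟨b, hb, hbx⟩ := hS h
          exact ⟨b, hb, by rw [hbx, map_add, map_add, hLa, add_zero]⟩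
      obtain ⟨b, hb, hbx⟩ := this
      refine ⟨b, ⟨hb, ?_⟩, trivial, hbx⟩
      rintro rfl
      rw [← hbx, hLa] at hy1
      simp at hy1
    · intro I hI _
      have haI : a ∉ I := fun h => (hI h).2 rfl
      have hIE : I ⊆ M.E := fun x hx => (hI hx).1
      rw [hai.contract_indep_iff, and_iff_right (by simpa using haI), Set.union_comm,
        hrep' _ (Set.union_subset (by simpa using ha) hIE),
        linearIndepOn_union_iff_quotient (by simpa using haI),
        and_iff_right ((hrep' {a} (by simpa using ha)).1 hai), ← hQdef]
      exact (L.toLinearMap.linearIndepOn_iff_of_injOn (v := Q.mkQ ∘ ψ) (s := I)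
        L.injective.injOn).symm
  · obtain ⟨v0, hv1, hv2⟩ : ∃ v, f v = 1 ∧ h v = 1 := by
      obtain ⟨a, ha⟩ := LinearMap.surjective hf 1
      obtain ⟨b, hb⟩ := LinearMap.surjective hh 1
      rcases zmod2 (h a) with h1 | h1
      · rcases zmod2 (f b) with h2 | h2
        · exact ⟨a + b, by simp [ha, h2], by simp [hb, h1]⟩
        · exact ⟨b, h2, hb⟩
      · exact ⟨a, ha, h1⟩
    have char2 : ∀ x y : ZMod 2, x + y = 0 ↔ x = y := by decide
    let K := LinearMap.ker (f + h)
    have hK : ∀ x, x ∈ K ↔ f x = h x := by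
      intro x
      rw [LinearMap.mem_ker, LinearMap.add_apply, char2]
    have hfh0 : f + h ≠ 0 := by
      intro hz
      apply hfh
      apply LinearMap.ext
      intro x
      rw [← hK, LinearMap.mem_ker, hz]; rfl
    have hK4 : finrank (ZMod 2) K = 4 := by
      have := LinearMap.finrank_range_add_finrank_ker (f + h)
      rw [LinearMap.range_eq_top.2 (LinearMap.surjective hfh0), finrank_top,
        Module.finrank_self, Module.finrank_fin_fun] at this
      change finrank (ZMod 2) (LinearMap.ker (f + h)) = 4
      omega
    obtain ⟨L, hL⟩ := coord4 hK4 (h.comp K.subtype) (by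
      intro hz
      have := LinearMap.congr_fun hz ⟨v0, (hK v0).2 (hv1.trans hv2.symm)⟩
      simp [hv2] at this)
    obtain ⟨L', hL'⟩ := LinearMap.exists_extend L.toLinearMap
    have hLL : ∀ x (hx : x ∈ K), L' x = L ⟨x, hx⟩ := fun x hx =>
      LinearMap.congr_fun hL' ⟨x, hx⟩
    refine mkMinor M ψ ∅ (fun a => ψ a ∈ K) L' ?_ ?_
    · intro y hy
      obtain ⟨⟨x, hx⟩, rfl⟩ := L.surjective y
      have hy1 : L ⟨x, hx⟩ 0 = 1 := hy
      have hhx : h x = 1 := by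
        rw [hL] at hy1
        simpa using hy1
      obtain ⟨b, hb, hbx⟩ := hS (hfS x hhx (((hK x).1 hx).trans hhx))
      exact ⟨b, by simpa using hb, by rw [hbx]; exact hx, by rw [hbx, hLL x hx]⟩
    · intro I hI hIK
      rw [Matroid.contract_empty] at hI ⊢
      rw [hrep' I hI]
      refine (L'.linearIndepOn_iff_of_injOn ?_).symm
      have hle : Submodule.span (ZMod 2) (ψ '' I) ≤ K := by
        rw [Submodule.span_le]
        rintro _ ⟨b, hb, rfl⟩
        exact hIK b hb
      intro x hx y hy hxy
      rw [hLL x (hle hx), hLL y (hle hy)] at hxy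
      exact congrArg Subtype.val (L.injective hxy)

theorem exists_rep {α : Type*} (M : Matroid α) (hbin : M.IsBinaryM) (hrank : M.rkM = 5) :
    ∃ ψ : α → (Fin 5 → ZMod 2), M.IsRepBy (ZMod 2) ψ := by
  obtain ⟨n, φ, hφ⟩ := hbin
  have hφ' : ∀ I ⊆ M.E, (M.Indep I ↔ LinearIndepOn (ZMod 2) φ I) := hφ
  have hfin : ∀ I, M.Indep I → I.Finite := by
    intro I hI
    have : LinearIndependent (ZMod 2) (fun i : I => φ i) := (hφ' I hI.subset_ground).1 hI
    have := this.finite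
    exact Set.toFinite I
  let R := {n : ℕ | ∃ I ⊆ M.E, M.Indep I ∧ I.ncard = n}
  have hR : sSup R = 5 := hrank
  have hbdd : BddAbove R := by
    by_contra hb
    rw [Nat.sSup_of_not_bddAbove hb] at hR
    omega
  have hne : R.Nonempty := ⟨0, ∅, Set.empty_subset _, M.empty_indep, Set.ncard_empty _⟩
  obtain ⟨I, hIE, hI, hI5⟩ : 5 ∈ R := hR ▸ Nat.sSup_mem hne hbdd
  have hILI := (hφ' I hIE).1 hI
  have hspan : Submodule.span (ZMod 2) (φ '' M.E) = Submodule.span (ZMod 2) (φ '' I) := by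
    apply le_antisymm
    · rw [Submodule.span_le]
      rintro _ ⟨a, ha, rfl⟩
      by_contra hn
      have haI : a ∉ I := fun h => hn (Submodule.subset_span ⟨a, h, rfl⟩)
      have h6 : M.Indep (insert a I) := by
        rw [hφ' _ (Set.insert_subset ha hIE)]
        exact hILI.insert hn
      have : (insert a I).ncard ∈ R := ⟨_, Set.insert_subset ha hIE, h6, rfl⟩
      have := le_csSup hbdd this
      rw [Set.ncard_insert_of_notMem haI (hfin I hI)] at this
      omega
    · exact Submodule.span_mono (Set.image_mono hIE)
  let W := Submodule.span (ZMod 2) (φ '' M.E)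
  have hW : finrank (ZMod 2) W = 5 := by
    change finrank (ZMod 2) (Submodule.span (ZMod 2) (φ '' M.E)) = 5
    rw [hspan, Set.image_eq_range]
    have := (hfin I hI).fintype
    rw [finrank_span_eq_card hILI, ← Nat.card_eq_fintype_card, Nat.card_coe_set_eq, hI5]
  let L : W ≃ₗ[ZMod 2] (Fin 5 → ZMod 2) := LinearEquiv.ofFinrankEq _ _ (by rw [hW]; simp)
  obtain ⟨L', hL'⟩ := LinearMap.exists_extend L.toLinearMap
  have hLL : ∀ x (hx : x ∈ W), L' x = L ⟨x, hx⟩ := fun x hx =>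
    LinearMap.congr_fun hL' ⟨x, hx⟩
  refine ⟨L' ∘ φ, ?_⟩
  intro J hJ
  rw [hφ' J hJ]
  refine (L'.linearIndepOn_iff_of_injOn ?_).symm
  have hle : Submodule.span (ZMod 2) (φ '' J) ≤ W := Submodule.span_mono (Set.image_mono hJ)
  intro x hx y hy hxy
  rw [hLL x (hle hx), hLL y (hle hy)] at hxy
  exact congrArg Subtype.val (L.injective hxy)

end RFB

theorem rank_five_bound {α : Type*} (M : Matroid α)
    (hbin : M.IsBinaryM) (hsimple : M.IsSimpleM) (hrank : M.rkM = 5)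
    (hAG : ¬ M.HasAGMinor) :
    M.E.ncard ≤ 15 := by
  classical
  by_contra hlt
  push Not at hlt
  obtain ⟨ψ, hψ⟩ := RFB.exists_rep M hbin hrank
  obtain ⟨T, hTE, hT⟩ := Set.exists_subset_card_eq (show 16 ≤ M.E.ncard from hlt)
  have hTfin : T.Finite := Set.finite_of_ncard_pos (by omega)
  have hinj : Set.InjOn ψ M.E := by
    intro a ha b hb hab
    by_contra hne
    have h2 : LinearIndepOn (ZMod 2) ψ {a, b} :=
      (hψ {a, b} (by rintro x (rfl | rfl) <;> assumption)).1 (hsimple a ha b hb)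
    exact hne (h2.injOn (by simp) (by simp) hab)
  apply hAG
  refine RFB.minor_of_AGc M ψ hψ hsimple ((hTfin.toFinset.image ψ : Finset _) : Set _) ?_
    (RFB.core _ ?_ ?_)
  · intro x hx
    simp only [Finset.coe_image, Set.Finite.coe_toFinset] at hx
    exact Set.image_mono hTE hx
  · intro h0
    rw [Finset.mem_image] at h0
    obtain ⟨a, ha, ha0⟩ := h0
    have haE := hTE (hTfin.mem_toFinset.1 ha)
    have h1 : LinearIndepOn (ZMod 2) ψ {a, a} :=
      (hψ {a, a} (by simpa using haE)).1 (hsimple a haE a haE)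
    simp [ha0] at h1
  · rw [Finset.card_image_of_injOn, ← Set.ncard_eq_toFinset_card T hTfin, hT]
    intro a ha b hb hab
    exact hinj (hTE (by simpa using ha)) (hTE (by simpa using hb)) hab
end

section
/- Let M be a simple binary matroid of rank 6 with no AG(3,2)-minor and with exactly 21 elements. Then M is isomorphic to M(K_7). -/
open Matroid Set

variable {α : Type*}

namespace AGK

/-! ### Linear algebra over the two-element field -/

/-- The space of binary vectors of length `n`. -/
abbrev V (n : ℕ) : Type := Fin n → ZMod 2

lemma add_self_V {n : ℕ} (x : V n) : x + x = 0 := by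
  funext i
  exact CharTwo.add_self_eq_zero (x i)

lemma zmod_cases (a : ZMod 2) : a = 0 ∨ a = 1 := by
  revert a; decide

lemma zmod_ne_zero {a : ZMod 2} (h : a ≠ 0) : a = 1 := (zmod_cases a).resolve_left h

lemma add_cancel_V {n : ℕ} (x y : V n) : x + y + y = x := by
  rw [add_assoc, add_self_V, add_zero]

lemma eq_of_add_eq_zero {n : ℕ} {x y : V n} (h : x + y = 0) : x = y := by
  have := add_cancel_V x y
  rw [h, zero_add] at this
  exact this.symm

/-- Fewer than `n` vectors are annihilated by some nonzero functional. -/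
lemma exists_functional {n : ℕ} (T : Finset (V n)) (hT : T.card < n) :
    ∃ h : V n →ₗ[ZMod 2] ZMod 2, h ≠ 0 ∧ ∀ x ∈ T, h x = 0 := by
  have hlt : Submodule.span (ZMod 2) (T : Set (V n)) < ⊤ := by
    rw [lt_top_iff_ne_top]
    intro htop
    have h1 := finrank_span_finset_le_card (R := ZMod 2) T
    rw [Set.finrank, htop, finrank_top, Module.finrank_fin_fun] at h1
    omega
  obtain ⟨f, hf, hle⟩ := Submodule.exists_le_ker_of_lt_top _ hlt
  exact ⟨f, hf, fun x hx => hle (Submodule.subset_span hx)⟩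

/-- Projection from a nonzero vector. -/
lemma exists_proj {n : ℕ} (e : V (n + 1)) (he : e ≠ 0) :
    ∃ p : V (n + 1) →ₗ[ZMod 2] V n, Function.Surjective p ∧ ∀ x, p x = 0 ↔ x = 0 ∨ x = e := by
  obtain ⟨i, hi⟩ : ∃ i, e i ≠ 0 := Function.ne_iff.mp he
  have hi1 := zmod_ne_zero hi
  let p : V (n + 1) →ₗ[ZMod 2] V n :=
    (LinearMap.funLeft (ZMod 2) (ZMod 2) i.succAbove).comp
      (LinearMap.id + (LinearMap.proj i).smulRight e)
  have hp : ∀ x j, p x j = x (i.succAbove j) + x i * e (i.succAbove j) := fun x j => rfl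
  refine ⟨p, ?_, ?_⟩
  · intro z
    refine ⟨Fin.insertNth i (0 : ZMod 2) z, ?_⟩
    funext j
    rw [hp]
    simp
  · intro x
    constructor
    · intro h0
      have key : x + x i • e = 0 := by
        funext k
        rcases Fin.eq_self_or_eq_succAbove i k with rfl | ⟨j, rfl⟩
        · simp [hi1, CharTwo.add_self_eq_zero]
        · have := congrFun h0 j
          rw [hp] at this
          simpa using this
      have hx := eq_of_add_eq_zero key
      rcases zmod_cases (x i) with h | h
      · left; rw [hx, h, zero_smul]
      · right; rw [hx, h, one_smul]
    · rintro (rfl | rfl)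
      · exact map_zero p
      · funext j
        rw [hp, hi1, one_mul]
        exact CharTwo.add_self_eq_zero _

lemma proj_eq_iff {n m : ℕ} {e : V n} {p : V n →ₗ[ZMod 2] V m}
    (hp : ∀ x, p x = 0 ↔ x = 0 ∨ x = e) (x y : V n) : p x = p y ↔ x = y ∨ x = y + e := by
  have h1 : p x = p y ↔ p (x + y) = 0 := by
    rw [map_add]
    constructor
    · intro h; rw [h]; exact add_self_V _
    · exact eq_of_add_eq_zero
  rw [h1, hp]
  constructor
  · rintro (h | h)
    · exact Or.inl (eq_of_add_eq_zero h)
    · right; rw [← h, add_comm x y, ← add_assoc, add_self_V, zero_add]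
  · rintro (rfl | rfl)
    · left; exact add_self_V _
    · right; rw [add_comm y e]; exact add_cancel_V _ _

/-! ### Character sums -/

/-- The nontrivial character of the two-element field. -/
def chi (a : ZMod 2) : ℤ := if a = 0 then 1 else -1

lemma chi_add (a b : ZMod 2) : chi (a + b) = chi a * chi b := by
  revert a b; decide

lemma sum_chi {n : ℕ} (x : V n) :
    ∑ h : V n, chi (h ⬝ᵥ x) = if x = 0 then (2 : ℤ) ^ n else 0 := by
  split_ifs with hx
  · subst hx
    simp [chi]
  · obtain ⟨i, hi⟩ : ∃ i, x i ≠ 0 := Function.ne_iff.mp hx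
    have hi1 := zmod_ne_zero hi
    have h1 : ∑ h : V n, chi (h ⬝ᵥ x) = ∑ h : V n, chi ((h + Pi.single i 1) ⬝ᵥ x) :=
      (Equiv.sum_comp (Equiv.addRight (Pi.single i (1 : ZMod 2) : V n))
        (fun h : V n => chi (h ⬝ᵥ x))).symm
    have h2 : ∀ h : V n, chi ((h + Pi.single i 1) ⬝ᵥ x) = - chi (h ⬝ᵥ x) := by
      intro h
      rw [add_dotProduct, chi_add, single_dotProduct, hi1]
      simp [chi]
    simp_rw [h2, Finset.sum_neg_distrib] at h1
    omega

/-- The character sum of a set. -/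
def cs {n : ℕ} (S : Finset (V n)) (h : V n) : ℤ := ∑ x ∈ S, chi (h ⬝ᵥ x)

lemma cs_zero {n : ℕ} (S : Finset (V n)) : cs S 0 = S.card := by
  simp [cs, chi]

lemma moment1 {n : ℕ} (S : Finset (V n)) (h0 : 0 ∉ S) : ∑ h : V n, cs S h = 0 := by
  unfold cs
  rw [Finset.sum_comm]
  refine Finset.sum_eq_zero fun x hx => ?_
  rw [sum_chi, if_neg]
  rintro rfl
  exact h0 hx

lemma moment2 {n : ℕ} (S : Finset (V n)) :
    ∑ h : V n, cs S h ^ 2 = 2 ^ n * S.card := by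
  have h1 : ∀ h : V n, cs S h ^ 2 = ∑ x ∈ S, ∑ y ∈ S, chi (h ⬝ᵥ (x + y)) := by
    intro h
    rw [sq, cs, Finset.sum_mul_sum]
    simp_rw [dotProduct_add, chi_add]
  simp_rw [h1]
  rw [Finset.sum_comm]
  have h2 : ∀ x ∈ S, ∑ h : V n, ∑ y ∈ S, chi (h ⬝ᵥ (x + y)) = 2 ^ n := by
    intro x hx
    rw [Finset.sum_comm]
    simp_rw [sum_chi]
    rw [Finset.sum_eq_single x]
    · rw [if_pos (add_self_V x)]
    · intro y _ hy
      rw [if_neg]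
      intro h
      exact hy (eq_of_add_eq_zero h).symm
    · intro h; exact absurd hx h
  rw [Finset.sum_congr rfl h2]
  simp [mul_comm]

lemma moment3 {n : ℕ} (S : Finset (V n)) :
    ∑ h : V n, cs S h ^ 3 = 2 ^ n * ∑ x ∈ S, ((S.filter fun y => x + y ∈ S).card : ℤ) := by
  have h1 : ∀ h : V n, cs S h ^ 3 =
      ∑ x ∈ S, ∑ y ∈ S, ∑ z ∈ S, chi (h ⬝ᵥ (x + y + z)) := by
    intro h
    rw [pow_succ, sq, cs, Finset.sum_mul_sum, Finset.sum_mul]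
    refine Finset.sum_congr rfl fun x _ => ?_
    rw [Finset.sum_mul]
    refine Finset.sum_congr rfl fun y _ => ?_
    rw [Finset.mul_sum]
    refine Finset.sum_congr rfl fun z _ => ?_
    rw [dotProduct_add, dotProduct_add, chi_add, chi_add]
  simp_rw [h1]
  rw [Finset.sum_comm, Finset.mul_sum]
  refine Finset.sum_congr rfl fun x _ => ?_
  rw [Finset.sum_comm, Finset.card_filter]
  push_cast
  rw [Finset.mul_sum]
  refine Finset.sum_congr rfl fun y _ => ?_
  rw [Finset.sum_comm]
  simp_rw [sum_chi]
  split_ifs with hy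
  · rw [Finset.sum_eq_single (x + y)]
    · rw [if_pos (add_self_V _), mul_one]
    · intro z _ hz
      rw [if_neg]
      intro h
      exact hz (eq_of_add_eq_zero h).symm
    · intro h; exact absurd hy h
  · rw [mul_zero]
    refine Finset.sum_eq_zero fun z hz => ?_
    rw [if_neg]
    intro h
    rw [eq_of_add_eq_zero h] at hy
    exact hy hz

/-- The functional given by a coefficient vector. -/
def dotL {n : ℕ} (h : V n) : V n →ₗ[ZMod 2] ZMod 2 where
  toFun x := h ⬝ᵥ x
  map_add' x y := dotProduct_add h x y
  map_smul' c x := dotProduct_smul c h x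

lemma dotL_ne_zero {n : ℕ} {h : V n} (hh : h ≠ 0) : dotL h ≠ 0 := by
  obtain ⟨i, hi⟩ : ∃ i, h i ≠ 0 := Function.ne_iff.mp hh
  intro h0
  apply hi
  have := LinearMap.congr_fun h0 (Pi.single i 1)
  simpa [dotL] using this

lemma cs_eq {n : ℕ} (S : Finset (V n)) (h : V n) :
    cs S h = S.card - 2 * (S.filter fun x => dotL h x = 1).card := by
  unfold cs
  rw [Finset.card_filter, Finset.card_eq_sum_ones]
  push_cast
  rw [Finset.mul_sum, ← Finset.sum_sub_distrib]
  refine Finset.sum_congr rfl fun x _ => ?_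
  change chi (dotL h x) = _
  generalize dotL h x = a
  revert a; decide

/-- Moment argument: a functional with a large character sum. -/
lemma exists_large {n : ℕ} (S : Finset (V n)) (h0 : 0 ∉ S) (k : ℤ)
    (hk : ∀ x ∈ S, k ≤ ((S.filter fun y => x + y ∈ S).card : ℤ)) (a b : ℤ)
    (hneg : (b - 2 * a) * (2 ^ n * S.card) + b * a ^ 2 * 2 ^ n - 2 ^ n * (S.card * k)
      < (b - S.card) * (S.card + a) ^ 2) :
    ∃ h : V n →ₗ[ZMod 2] ZMod 2, h ≠ 0 ∧
      b < S.card - 2 * (S.filter fun x => h x = 1).card := by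
  by_contra hcon
  push Not at hcon
  have hle : ∀ h : V n, h ≠ 0 → cs S h ≤ b := by
    intro h hh
    rw [cs_eq]
    exact hcon (dotL h) (dotL_ne_zero hh)
  have h3 : (S.card : ℤ) * k ≤ ∑ x ∈ S, ((S.filter fun y => x + y ∈ S).card : ℤ) := by
    have := Finset.card_nsmul_le_sum S _ k hk
    simpa using this
  have hsum : ∑ h : V n, (b - cs S h) * (cs S h + a) ^ 2 =
      (b - 2 * a) * (2 ^ n * S.card) + b * a ^ 2 * 2 ^ n -
        2 ^ n * ∑ x ∈ S, ((S.filter fun y => x + y ∈ S).card : ℤ) := by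
    have hexp : ∀ h : V n, (b - cs S h) * (cs S h + a) ^ 2 =
        (b - 2 * a) * cs S h ^ 2 + (2 * a * b - a ^ 2) * cs S h + b * a ^ 2 - cs S h ^ 3 := by
      intro h; ring
    simp_rw [hexp]
    rw [Finset.sum_sub_distrib, Finset.sum_add_distrib, Finset.sum_add_distrib,
      ← Finset.mul_sum, ← Finset.mul_sum, moment1 S h0, moment2, moment3]
    simp
    ring
  have hge : (b - S.card) * (S.card + a) ^ 2 ≤ ∑ h : V n, (b - cs S h) * (cs S h + a) ^ 2 := by
    rw [← Finset.add_sum_erase _ _ (Finset.mem_univ (0 : V n)), cs_zero]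
    have : 0 ≤ ∑ h ∈ Finset.univ.erase (0 : V n), (b - cs S h) * (cs S h + a) ^ 2 := by
      refine Finset.sum_nonneg fun h hh => ?_
      have := hle h (Finset.ne_of_mem_erase hh)
      have : 0 ≤ b - cs S h := by omega
      positivity
    linarith
  have hpow : (2 : ℤ) ^ n * (S.card * k) ≤
      2 ^ n * ∑ x ∈ S, ((S.filter fun y => x + y ∈ S).card : ℤ) :=
    mul_le_mul_of_nonneg_left h3 (by positivity)
  linarith

/-! ### Counting lines through a point -/

lemma card_partner {n : ℕ} (S : Finset (V n)) (e : V n) (N : ℕ)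
    (hN : (Finset.univ.filter fun x => x ∈ S ∨ x + e ∈ S).card ≤ N) :
    2 * S.card ≤ N + (S.filter fun y => e + y ∈ S).card := by
  have h1 : (S ∪ S.image (· + e)).card + (S ∩ S.image (· + e)).card = 2 * S.card := by
    rw [Finset.card_union_add_card_inter, Finset.card_image_of_injective _ (add_left_injective e)]
    ring
  have himg : ∀ x, x ∈ S.image (· + e) ↔ x + e ∈ S := by
    intro x
    rw [Finset.mem_image]
    constructor
    · rintro ⟨y, hy, rfl⟩
      rwa [add_cancel_V]
    · intro h
      exact ⟨x + e, h, add_cancel_V x e⟩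
  have h2 : S ∪ S.image (· + e) = Finset.univ.filter fun x => x ∈ S ∨ x + e ∈ S := by
    ext x
    rw [Finset.mem_union, himg]
    simp
  have h3 : S ∩ S.image (· + e) = S.filter fun y => e + y ∈ S := by
    ext x
    rw [Finset.mem_inter, himg, Finset.mem_filter, add_comm]
  rw [h2, h3] at h1
  omega

/-- Rank-five form of having no AG(3,2) minor. -/
def Free5 {n : ℕ} (Q : Finset (V n)) : Prop :=
  ∀ f ∈ Q, ∀ h : V n →ₗ[ZMod 2] ZMod 2, h ≠ 0 → h f = 0 →
    ∃ x, h x = 1 ∧ x ∉ Q ∧ x + f ∉ Q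

/-- Rank-six form of having no AG(3,2) minor. -/
def Free6 {n : ℕ} (S : Finset (V n)) : Prop :=
  ∀ e ∈ S, ∀ f ∈ S, e ≠ f → ∀ h : V n →ₗ[ZMod 2] ZMod 2, h ≠ 0 → h e = 0 → h f = 0 →
    ∃ x, h x = 1 ∧ x ∉ S ∧ x + e ∉ S ∧ x + f ∉ S ∧ x + e + f ∉ S

lemma lines5 (Q : Finset (V 5)) (h0 : 0 ∉ Q) (hQ : Free5 Q) (hcard : Q.card = 16)
    (f : V 5) (hf : f ∈ Q) : 8 ≤ (Q.filter fun y => f + y ∈ Q).card := by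
  have hf0 : f ≠ 0 := fun h => h0 (h ▸ hf)
  obtain ⟨p, hsurj, hp⟩ := exists_proj f hf0
  set Z : Finset (V 5) := Finset.univ.filter fun x => ¬ (x ∈ Q ∨ x + f ∈ Q) with hZ
  have hZ8 : 8 ≤ Z.card := by
    by_contra hlt
    have hfib : 2 * (Z.image p).card ≤ Z.card := by
      refine Finset.mul_card_image_le_card (s := Z) (f := p) 2 ?_
      intro a ha
      obtain ⟨x, hx, rfl⟩ := Finset.mem_image.mp ha
      have hne : x ≠ x + f := by
        intro h
        apply hf0
        simpa using h.symm
      refine (Finset.card_pair hne).ge.trans (Finset.card_le_card ?_)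
      intro y hy
      rw [Finset.mem_insert, Finset.mem_singleton] at hy
      rw [Finset.mem_filter, proj_eq_iff hp]
      refine ⟨?_, hy⟩
      rcases hy with rfl | rfl
      · exact hx
      · rw [hZ, Finset.mem_filter] at hx ⊢
        refine ⟨Finset.mem_univ _, ?_⟩
        rw [add_cancel_V, or_comm]
        exact hx.2
    obtain ⟨h, hh, hv⟩ := exists_functional (Z.image p) (by omega)
    obtain ⟨x, hx1, hx2, hx3⟩ := hQ f hf (h.comp p)
      (by
        intro hc
        apply hh
        ext1 z
        obtain ⟨y, hy⟩ := hsurj (Pi.single z 1)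
        have := LinearMap.congr_fun hc y
        simp only [LinearMap.comp_apply, hy] at this
        ext
        simpa using this)
      (by rw [LinearMap.comp_apply, (hp f).2 (Or.inr rfl), map_zero])
    have hxZ : x ∈ Z := by
      rw [hZ, Finset.mem_filter]
      exact ⟨Finset.mem_univ _, by tauto⟩
    have := hv (p x) (Finset.mem_image_of_mem _ hxZ)
    rw [LinearMap.comp_apply, this] at hx1
    exact zero_ne_one hx1
  have htot := Finset.card_filter_add_card_filter_not (s := (Finset.univ : Finset (V 5)))
    (fun x => x ∈ Q ∨ x + f ∈ Q)
  have hu : (Finset.univ : Finset (V 5)).card = 32 := by simp [Finset.card_univ, ZMod.card]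
  rw [hZ] at hZ8
  have := card_partner Q f 24 (by omega)
  omega

lemma lines6 (hB : ∀ Q : Finset (V 5), 0 ∉ Q → Free5 Q → Q.card ≤ 15)
    (S : Finset (V 6)) (h0 : 0 ∉ S) (hS : Free6 S) (hcard : S.card = 21)
    (e : V 6) (he : e ∈ S) : 10 ≤ (S.filter fun y => e + y ∈ S).card := by
  have he0 : e ≠ 0 := fun h => h0 (h ▸ he)
  obtain ⟨p, hsurj, hp⟩ := exists_proj e he0
  set Q : Finset (V 5) := (S.image p).erase 0 with hQdef
  have hmem : ∀ x, p x ∈ Q → x ∈ S ∨ x + e ∈ S := by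
    intro x hx
    obtain ⟨y, hy, hyx⟩ := Finset.mem_image.mp (Finset.mem_of_mem_erase hx)
    rcases (proj_eq_iff hp y x).1 hyx with rfl | rfl
    · exact Or.inl hy
    · exact Or.inr hy
  have hfree : Free5 Q := by
    intro f hf h hh hhf
    obtain ⟨y, hy, rfl⟩ := Finset.mem_image.mp (Finset.mem_of_mem_erase hf)
    have hne : e ≠ y := by
      rintro rfl
      exact Finset.ne_of_mem_erase hf ((hp e).2 (Or.inr rfl))
    obtain ⟨x, hx1, hx2, hx3, hx4, hx5⟩ := hS e he y hy hne (h.comp p)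
      (by
        intro hc
        apply hh
        ext1 z
        obtain ⟨y, hy⟩ := hsurj (Pi.single z 1)
        have := LinearMap.congr_fun hc y
        simp only [LinearMap.comp_apply, hy] at this
        ext
        simpa using this)
      (by rw [LinearMap.comp_apply, (hp e).2 (Or.inr rfl), map_zero]) hhf
    refine ⟨p x, hx1, fun hc => ?_, fun hc => ?_⟩
    · rcases hmem x hc with h | h
      · exact hx2 h
      · exact hx3 h
    · rw [← map_add] at hc
      rcases hmem _ hc with h | h
      · exact hx4 h
      · rw [add_right_comm] at h
        exact hx5 h
  have h15 := hB Q (Finset.notMem_erase _ _) hfree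
  have hle : (Finset.univ.filter fun x => x ∈ S ∨ x + e ∈ S).card ≤ 32 := by
    set T : Finset (V 6) := Finset.univ.filter fun x => x ∈ S ∨ x + e ∈ S with hT
    have h1 : T.card ≤ 2 * (T.image p).card := by
      refine Finset.card_le_mul_card_image T 2 ?_
      intro a ha
      obtain ⟨x, _, rfl⟩ := Finset.mem_image.mp ha
      refine le_trans (Finset.card_le_card (t := {x, x + e}) ?_) Finset.card_le_two
      intro y hy
      rw [Finset.mem_filter, proj_eq_iff hp] at hy
      simpa using hy.2
    have h2 : T.image p ⊆ insert 0 Q := by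
      intro q hq
      obtain ⟨x, hx, rfl⟩ := Finset.mem_image.mp hq
      rw [Finset.mem_insert]
      by_cases hx0 : p x = 0
      · exact Or.inl hx0
      · right
        refine Finset.mem_erase.2 ⟨hx0, ?_⟩
        rw [hT, Finset.mem_filter] at hx
        rcases hx.2 with h | h
        · exact Finset.mem_image_of_mem _ h
        · have : p x = p (x + e) := ((proj_eq_iff hp x (x + e)).2 (Or.inr (add_cancel_V _ _).symm))
          rw [this]
          exact Finset.mem_image_of_mem _ h
    have h3 := Finset.card_le_card h2
    have h4 := Finset.card_insert_le (0 : V 5) Q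
    omega
  have := card_partner S e 32 hle
  omega

end AGK

namespace AGK

/-! ### A verified case analysis in rank five

Vectors of length five are coded by the natural numbers below 32.  A `Tree` records a case
analysis on which vectors lie in a given set; `check` verifies that every branch is refuted. -/

/-- Case trees.  Leaves: `c` (a cardinality is violated), `d c` (too few lines through the
point `c`), `g e a` (contracting `e` gives AG(3,2) outside the hyperplane `a`);
`n v l r` branches on the membership of `v`. -/
inductive Tree : Type
  | c : Tree
  | d : ℕ → Tree
  | g : ℕ → ℕ → Tree
  | n : ℕ → Tree → Tree → Tree

/-- Parity of the number of ones among the lowest five bits. -/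
def par (n : ℕ) : Bool :=
  n.testBit 0 ^^ n.testBit 1 ^^ n.testBit 2 ^^ n.testBit 3 ^^ n.testBit 4

def odds : List ℕ := [1, 2, 4, 8, 16, 7, 11, 13, 14, 19, 21, 22, 25, 26, 28, 31]
def evens : List ℕ := [3, 5, 6, 9, 10, 12, 15, 17, 18, 20, 23, 24, 27, 29, 30]

/-- Number of elements of the list that lie in the mask. -/
def pc (l : List ℕ) (m : ℕ) : ℕ := l.countP (fun n => m.testBit n)

/-- `i` is the mask of vectors known to be inside, `o` of those known to be outside. -/
def check : Tree → ℕ → ℕ → Bool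
  | .c, i, o => Nat.ble 7 (pc odds i) || Nat.ble 6 (pc evens o) || Nat.ble 12 (pc odds o) ||
      Nat.ble 16 (pc odds o + pc evens o)
  | .d c, i, o => odds.contains c && i.testBit c &&
      Nat.ble 3 (odds.countP fun d => i.testBit d && o.testBit (c ^^^ d))
  | .g e a, i, _ => i.testBit e && !(par (a &&& e)) &&
      ((List.range 32).any fun x => par (a &&& x)) &&
      (List.range 32).all fun x => !(par (a &&& x)) || i.testBit x || i.testBit (x ^^^ e)
  | .n v l r, i, o => check l (i ||| (1 <<< v)) o && check r i (o ||| (1 <<< v))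

def treeA : Tree :=
  (.n 7 (.n 11 .c (.n 13 .c (.n 14 .c (.n 19 .c (.n 21 .c (.n 22 .c (.n 25 .c (.n 26 .c (.n 28 .c
  (.n 31 .c (.n 3 (.n 5 (.n 6 (.n 9 (.n 17 (.n 27 (.g 27 28) (.n 29 (.g 29 26) (.n 30 (.g 30 30)
  (.n 10 (.n 12 (.n 15 (.g 16 7) (.n 23 (.n 24 (.g 23 23) (.d 8)) (.d 7))) (.n 15 (.n 20 (.n 24
  (.g 20 23) (.d 8)) (.d 4)) (.d 8))) (.n 12 (.n 15 (.n 18 (.n 24 (.g 18 23) (.d 8)) (.d 2)) (.d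
  8)) (.d 8)))))) (.n 18 (.n 20 (.n 23 (.n 24 (.g 9 15) (.d 16)) (.d 16)) (.d 16)) (.d 16))) (.n
  10 (.n 12 (.n 15 (.n 17 (.n 24 (.g 17 23) (.d 8)) (.d 1)) (.d 8)) (.d 8)) (.d 8))) (.n 9 (.n 10
  (.n 12 (.n 15 (.g 16 7) (.d 7)) (.d 4)) (.d 2)) (.d 1))) (.n 6 (.n 9 (.n 10 (.n 12 (.n 15 (.g
  16 7) (.d 7)) (.d 4)) (.d 2)) (.d 1)) (.d 1))) (.n 5 (.n 6 (.n 9 (.n 10 (.n 12 (.n 15 (.g 16 7)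
  (.d 7)) (.d 4)) (.d 2)) (.d 1)) (.d 1)) (.d 1))))))))))))) (.n 11 (.n 13 .c (.n 14 .c (.n 19 .c
  (.n 21 .c (.n 22 .c (.n 25 .c (.n 26 .c (.n 28 .c (.n 31 .c (.n 3 (.n 5 (.n 6 (.n 12 (.n 15 (.g
  16 11) (.n 9 (.n 10 (.n 20 (.n 27 (.g 20 11) (.d 11)) (.d 4)) (.d 11)) (.d 11))) (.n 9 (.n 10
  (.n 15 (.n 20 (.n 24 (.g 20 11) (.d 8)) (.d 4)) (.d 4)) (.d 8)) (.d 8))) (.n 9 (.n 10 (.n 12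
  (.n 15 (.n 18 (.n 20 (.g 18 27) (.d 4)) (.d 2)) (.d 4)) (.d 4)) (.d 2)) (.d 2))) (.n 6 (.n 9
  (.n 10 (.n 12 (.n 15 (.n 17 (.n 20 (.g 17 27) (.d 4)) (.d 1)) (.d 4)) (.d 4)) (.d 1)) (.d 1))
  (.d 4))) (.n 5 (.n 6 (.n 9 (.n 10 (.n 12 (.n 15 (.g 16 11) (.d 11)) (.d 8)) (.d 1)) (.d 1)) (.d
  2)) (.d 1)))))))))))) (.n 3 (.n 12 (.n 13 (.n 14 .c (.n 19 .c (.n 21 .c (.n 22 .c (.n 25 .c (.n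
  26 .c (.n 28 .c (.n 31 .c (.n 5 (.n 10 (.n 27 (.g 16 6) (.n 6 (.n 15 (.g 16 13) (.n 9 (.n 18
  (.n 29 (.g 18 13) (.d 13)) (.d 2)) (.d 13))) (.n 9 (.n 15 (.n 18 (.n 20 (.g 18 13) (.d 4)) (.d
  2)) (.d 2)) (.d 4)))) (.n 6 (.n 9 (.n 15 (.n 18 (.n 24 (.g 18 13) (.d 8)) (.d 2)) (.d 2)) (.d
  8)) (.d 2))) (.n 6 (.n 9 (.n 10 (.n 15 (.g 16 13) (.d 13)) (.d 8)) (.d 1)) (.d 4))))))))))) (.n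
  14 (.n 19 .c (.n 21 .c (.n 22 .c (.n 25 .c (.n 26 .c (.n 28 .c (.n 31 .c (.n 5 (.n 9 (.n 15 (.g
  16 14) (.n 6 (.n 10 (.n 17 (.n 30 (.g 17 14) (.d 14)) (.d 1)) (.d 14)) (.d 14))) (.n 6 (.n 10
  (.n 15 (.n 17 (.n 24 (.g 17 14) (.d 8)) (.d 1)) (.d 1)) (.d 8)) (.d 8))) (.n 6 (.n 9 (.n 10 (.n
  15 (.n 17 (.n 20 (.g 17 14) (.d 4)) (.d 1)) (.d 1)) (.d 4)) (.d 1)) (.d 4)))))))))) (.n 5 (.n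
  18 (.n 24 (.n 19 (.n 21 .c (.n 22 .c (.n 25 .c (.n 26 .c (.n 28 .c (.n 31 .c (.n 6 (.n 15 (.g
  19 11) (.n 23 (.g 12 19) (.n 27 (.g 12 19) (.d 19)))) (.n 10 (.n 23 (.g 12 19) (.d 4)) (.d
  2))))))))) (.n 21 (.n 22 .c (.n 25 .c (.n 26 .c (.n 28 .c (.n 31 .c (.n 6 (.n 9 (.g 21 10) (.n
  10 (.n 29 (.g 3 23) (.d 8)) (.d 8))) (.n 10 (.n 23 (.g 10 21) (.d 2)) (.d 2)))))))) (.n 6 (.n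
  25 (.n 15 (.g 18 27) (.n 22 .c (.n 23 (.g 12 29) (.n 26 .c (.n 27 (.g 6 25) (.n 29 (.g 6 25)
  (.d 25))))))) (.n 31 (.n 9 (.g 31 10) (.n 10 (.g 31 29) (.d 8))) (.n 27 (.n 15 (.g 1 20) (.n 20
  (.g 27 27) (.n 17 (.n 22 (.g 12 30) (.n 26 (.g 5 26) (.n 28 (.g 27 28) (.n 9 (.n 30 (.g 4 26)
  (.n 10 (.n 23 (.g 4 19) (.n 29 (.g 4 25) .c)) (.n 23 (.n 29 (.g 1 10) .c) .c))) (.n 10 (.n 29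
  (.g 4 25) (.n 23 (.n 30 (.g 1 22) .c) .c)) (.d 8)))))) (.d 16)))) (.n 26 (.n 9 (.n 10 (.n 15
  (.g 1 20) (.n 17 (.n 30 (.g 5 26) (.d 26)) (.d 1))) (.d 26)) (.d 1)) (.n 9 (.n 22 (.n 15 (.g 22
  14) (.n 23 (.g 9 22) (.n 30 (.g 3 23) (.d 22)))) (.n 28 (.n 15 (.g 18 30) (.n 23 (.g 1 10) (.n
  29 (.g 3 28) (.n 30 (.g 3 28) (.d 28))))) (.n 17 (.n 30 (.g 30 30) (.n 10 (.n 23 (.g 23 23) (.n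
  29 (.g 29 29) (.n 15 (.n 20 (.g 15 15) .c) .c))) (.n 15 (.n 20 (.g 15 15) (.n 23 (.n 29 (.g 1
  10) .c) .c)) (.n 20 (.n 23 (.n 29 (.g 1 10) .c) .c) .c)))) (.n 20 (.n 10 (.n 23 (.g 23 23) (.n
  29 (.g 29 29) (.n 15 (.n 30 (.g 1 14) .c) .c))) (.n 15 (.n 30 (.g 1 14) (.n 23 (.n 29 (.g 1 10)
  .c) .c)) (.n 23 (.n 29 (.g 1 10) .c) .c))) (.d 16))))) (.n 10 (.n 17 (.n 22 (.g 22 9) (.n 29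
  (.g 29 29) (.n 28 (.d 1) (.n 15 (.n 20 (.g 15 15) (.n 23 (.n 30 (.g 1 22) .c) .c)) (.n 20 (.n
  23 (.n 30 (.g 1 22) .c) .c) .c))))) (.d 1)) (.d 8))))))) (.n 10 (.n 20 (.n 25 (.g 25 6) (.n 31
  (.g 31 6) (.n 23 (.n 9 (.g 23 23) (.n 15 (.g 1 24) (.n 17 (.n 22 (.g 8 22) (.n 26 (.g 4 9) (.n
  28 (.g 2 9) (.n 30 (.g 1 22) (.n 27 (.n 29 (.g 1 6) .c) .c))))) (.d 1)))) (.n 22 (.d 22) (.n 15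
  (.n 17 (.g 15 15) (.n 9 (.n 26 (.g 4 17) (.n 28 (.g 2 17) (.n 30 (.g 1 14) (.n 27 (.n 29 (.g 1
  6) .c) .c)))) (.d 1))) (.n 30 (.n 26 (.g 3 27) (.n 28 (.g 3 28) (.n 9 (.n 17 (.g 30 30) (.n 27
  (.n 29 (.g 1 6) .c) .c)) (.n 17 (.n 27 (.n 29 (.g 1 6) .c) .c) .c)))) (.n 26 (.d 4) (.n 28 (.d
  2) (.n 9 (.n 17 (.n 27 (.n 29 (.g 1 6) .c) .c) .c) .c))))))))) (.d 4)) (.d 2))))) (.n 9 (.n 10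
  (.n 17 (.n 20 (.n 25 (.g 25 6) (.n 30 (.g 30 30) (.n 22 (.d 8) (.n 26 (.d 26) (.n 28 (.d 28)
  (.n 31 (.g 31 6) (.n 27 (.n 6 (.g 27 27) (.n 19 (.g 12 19) (.n 21 (.g 8 6) (.n 29 (.g 1 6) (.n
  15 (.n 23 (.g 1 24) .c) .c))))) (.n 19 (.d 8) (.n 29 (.n 6 (.g 29 29) (.n 21 (.g 10 21) (.n 15
  (.n 23 (.g 1 24) .c) .c))) (.n 21 (.d 8) (.n 6 (.n 15 (.n 23 (.g 1 24) .c) .c) .c)))))))))))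
  (.d 16)) (.d 16)) (.d 8)) (.d 8))) (.n 6 (.n 10 (.n 17 (.n 20 (.n 24 (.n 22 (.g 22 9) (.n 27
  (.g 27 27) (.n 19 (.d 19) (.n 25 (.d 2) (.n 26 (.d 26) (.n 31 (.g 31 9) (.n 23 (.n 9 (.g 23 23)
  (.n 21 (.g 10 21) (.n 28 (.g 2 9) (.n 30 (.g 1 22) (.n 15 (.n 29 (.g 1 18) .c) .c))))) (.n 21
  (.d 2) (.n 30 (.n 9 (.g 30 30) (.n 28 (.g 3 28) (.n 15 (.n 29 (.g 1 18) .c) .c))) (.n 28 (.d 2)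
  (.n 9 (.n 15 (.n 29 (.g 1 18) .c) .c) .c))))))))))) (.d 16)) (.d 16)) (.d 16)) (.d 2)) (.d 2)))
  (.n 6 (.n 9 (.n 17 (.n 20 (.n 26 (.g 26 5) (.n 31 (.g 31 5) (.n 19 (.n 23 (.g 9 27) (.d 4)) (.n
  21 (.n 15 (.g 2 24) (.n 18 (.n 23 (.g 8 21) (.d 21)) (.d 16))) (.n 22 (.n 23 (.g 9 22) (.d 1))
  (.n 25 (.n 29 (.g 3 27) (.d 4)) (.n 28 (.n 29 (.g 3 28) (.d 1)) (.n 10 (.n 23 (.n 15 (.g 2 24)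
  (.n 24 (.g 23 23) (.n 18 (.n 29 (.g 8 21) (.n 27 (.n 30 (.g 1 26) .c) .c)) (.d 16)))) (.n 24
  (.n 15 (.n 18 (.g 15 15) (.n 29 (.g 1 18) (.n 27 (.n 30 (.g 1 26) .c) .c))) (.n 18 (.n 29 (.g
  29 29) (.n 27 (.n 30 (.g 1 26) .c) .c)) (.n 27 (.n 30 (.g 1 26) .c) .c))) (.n 18 (.n 29 (.g 29
  29) (.n 15 (.n 27 (.n 30 (.g 1 26) .c) .c) .c)) (.d 16)))) (.n 18 (.n 24 (.n 15 (.g 15 15) (.n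
  23 (.n 29 (.g 1 10) (.n 27 (.n 30 (.g 1 26) .c) .c)) (.n 27 (.n 30 (.g 1 26) .c) .c))) (.d 8))
  (.d 2)))))))))) (.d 4)) (.d 1)) (.d 1)) (.d 4))))) (.n 5 (.n 6 (.n 9 (.n 10 (.n 20 (.n 24 (.n
  19 (.g 19 12) (.n 31 (.g 31 12) (.n 29 (.n 14 (.g 1 18) (.n 15 (.g 1 18) (.n 13 (.d 13) (.n 18
  (.g 29 29) (.n 17 (.n 21 (.g 6 23) (.n 22 (.d 4) (.n 25 (.g 6 25) (.n 26 (.d 8) (.n 28 (.d 16)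
  (.n 30 (.g 2 28) (.n 23 (.n 27 (.g 1 12) .c) .c))))))) (.d 16)))))) (.n 13 (.d 13) (.n 21 (.d
  8) (.n 25 (.d 4) (.n 28 (.d 28) (.n 30 (.n 15 (.g 2 17) (.n 14 (.d 14) (.n 17 (.g 30 30) (.n 18
  (.n 22 (.g 5 23) (.n 26 (.g 5 26) (.n 23 (.n 27 (.g 1 12) .c) .c))) (.d 16))))) (.n 14 (.d 14)
  (.n 22 (.d 8) (.n 26 (.d 4) (.n 23 (.n 27 (.g 1 12) (.n 15 (.n 17 (.n 18 (.g 4 24) .c) .c) .c))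
  (.n 15 (.n 17 (.n 18 (.g 15 15) .c) .c) .c))))))))))))) (.d 8)) (.d 4)) (.d 8)) (.d 8)) (.d 4))
  (.d 4))) (.n 5 (.n 6 (.n 9 (.n 10 (.n 17 (.n 18 (.n 28 (.g 28 3) (.n 31 (.g 31 3) (.n 13 (.n 15
  (.g 17 29) (.d 2)) (.n 14 (.n 15 (.g 17 14) (.d 1)) (.n 19 (.n 15 (.g 4 24) (.n 20 (.n 23 (.g 8
  19) (.d 19)) (.d 16))) (.n 21 (.n 23 (.g 9 29) (.d 2)) (.n 22 (.n 23 (.g 9 22) (.d 1)) (.n 25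
  (.n 27 (.g 5 29) (.d 2)) (.n 26 (.n 27 (.g 5 26) (.d 1)) (.n 12 (.n 23 (.n 15 (.g 4 24) (.n 24
  (.g 23 23) (.n 20 (.n 27 (.g 8 19) (.n 29 (.n 30 (.g 1 28) .c) .c)) (.d 16)))) (.n 24 (.n 15
  (.n 20 (.g 15 15) (.n 27 (.g 1 20) (.n 29 (.n 30 (.g 1 28) .c) .c))) (.n 20 (.n 27 (.g 27 27)
  (.n 29 (.n 30 (.g 1 28) .c) .c)) (.n 27 (.n 29 (.n 30 (.g 1 28) .c) .c) .c))) (.n 20 (.n 27 (.g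
  27 27) (.n 15 (.n 29 (.n 30 (.g 1 28) .c) .c) .c)) (.d 16)))) (.n 20 (.n 24 (.n 15 (.g 15 15)
  (.n 23 (.n 27 (.g 1 12) (.n 29 (.n 30 (.g 1 28) .c) .c)) (.n 27 (.n 29 (.n 30 (.g 1 28) .c) .c)
  .c))) (.d 8)) (.d 4)))))))))))) (.d 2)) (.d 1)) (.d 2)) (.d 1)) (.d 2)) (.d 1)))))

def treeB : Tree :=
  (.n 3 (.n 12 (.n 5 (.n 10 (.n 6 (.n 7 (.n 14 (.n 11 .c (.n 13 .c (.n 17 (.g 17 25) (.n 18 (.g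
  18 9) (.n 20 (.g 20 9) (.n 23 (.g 23 25) (.n 24 (.g 24 25) (.n 27 (.g 27 9) .c)))))))) (.n 9
  (.n 11 (.n 13 .c (.n 17 (.g 17 12) (.n 18 (.g 18 12) (.n 20 (.g 20 28) (.n 23 (.g 23 28) (.n 24
  (.g 24 28) (.n 27 (.g 27 28) .c))))))) (.n 13 (.n 17 (.g 17 10) (.n 18 (.g 18 26) (.n 20 (.g 20
  10) (.n 23 (.g 23 26) (.n 24 (.g 24 26) (.n 27 (.g 27 10) .c)))))) (.n 15 (.n 17 (.g 17 23) (.n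
  18 (.g 18 23) (.n 20 (.g 20 23) (.n 23 (.g 23 23) (.n 24 (.g 24 7) .c))))) (.n 17 (.n 30 (.g 17
  23) (.n 18 (.n 29 (.g 18 23) (.n 20 (.n 23 (.g 7 24) (.n 27 (.g 12 15) .c)) (.n 23 (.n 24 (.g
  12 15) .c) .c))) (.n 20 (.n 27 (.g 20 23) (.n 23 (.n 24 (.g 10 15) .c) .c)) (.n 23 (.n 24 (.g
  23 23) .c) .c)))) (.n 18 (.n 29 (.g 18 23) (.n 20 (.n 27 (.g 20 23) (.n 23 (.n 24 (.g 9 15) .c)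
  .c)) (.n 23 (.n 24 (.g 23 23) .c) .c))) (.n 20 (.n 27 (.g 20 23) (.n 23 (.n 24 (.g 23 23) .c)
  .c)) (.n 23 (.n 24 (.g 23 23) .c) .c))))))) (.n 15 (.n 11 (.n 13 .c (.n 17 (.g 17 27) (.n 18
  (.g 18 27) (.n 20 (.g 20 11) (.n 23 (.g 23 11) (.n 24 (.g 24 27) .c)))))) (.n 13 (.n 17 (.g 17
  29) (.n 18 (.g 18 13) (.n 20 (.g 20 29) (.n 23 (.g 23 13) (.n 24 (.g 24 29) .c))))) (.n 17 (.n
  24 (.g 17 23) (.n 18 (.n 27 (.g 18 23) (.n 20 (.n 23 (.g 1 24) (.n 29 (.g 10 15) .c)) (.n 23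
  (.n 30 (.g 10 15) .c) .c))) (.n 20 (.n 29 (.g 20 23) (.n 23 (.n 30 (.g 12 15) .c) .c)) (.n 23
  (.n 30 (.g 23 23) .c) .c)))) (.n 18 (.n 27 (.g 18 23) (.n 20 (.n 29 (.g 20 23) (.n 23 (.n 30
  (.g 15 15) .c) .c)) (.n 23 (.n 30 (.g 23 23) .c) .c))) (.n 20 (.n 29 (.g 20 23) (.n 23 (.n 30
  (.g 23 23) .c) .c)) (.n 23 (.n 30 (.g 23 23) .c) .c)))))) (.d 8)))) (.n 9 (.n 11 (.n 13 (.n 14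
  .c (.n 17 (.g 17 6) (.n 18 (.g 18 22) (.n 20 (.g 20 22) (.n 23 (.g 23 6) (.n 24 (.g 24 6) (.n
  27 (.g 27 22) .c))))))) (.n 14 (.n 17 (.g 17 21) (.n 18 (.g 18 5) (.n 20 (.g 20 21) (.n 23 (.g
  23 5) (.n 24 (.g 24 5) (.n 27 (.g 27 21) .c)))))) (.n 15 (.n 17 (.g 17 27) (.n 18 (.g 18 27)
  (.n 20 (.g 20 11) (.n 23 (.g 23 11) (.n 24 (.g 24 27) .c))))) (.n 17 (.n 30 (.g 17 27) (.n 18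
  (.n 29 (.g 18 27) (.n 20 (.n 23 (.g 4 24) (.n 27 (.g 12 15) .c)) (.n 23 (.n 24 (.g 12 15) .c)
  .c))) (.n 20 (.n 27 (.g 20 11) (.n 23 (.n 24 (.g 23 11) .c) .c)) (.n 23 (.n 24 (.g 23 11) .c)
  .c)))) (.n 18 (.n 29 (.g 18 27) (.n 20 (.n 27 (.g 20 11) (.n 23 (.n 24 (.g 23 11) .c) .c)) (.n
  23 (.n 24 (.g 23 11) .c) .c))) (.n 20 (.n 27 (.g 20 11) (.n 23 (.n 24 (.g 23 11) .c) .c)) (.n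
  23 (.n 24 (.g 23 11) .c) .c))))))) (.n 13 (.n 14 (.n 17 (.g 17 19) (.n 18 (.g 18 19) (.n 20 (.g
  20 3) (.n 23 (.g 23 3) (.n 24 (.g 24 3) (.n 27 (.g 27 3) .c)))))) (.n 15 (.n 17 (.g 17 29) (.n
  18 (.g 18 13) (.n 20 (.g 20 29) (.n 23 (.g 23 13) (.n 24 (.g 24 29) .c))))) (.n 17 (.n 30 (.g
  17 29) (.n 18 (.n 29 (.g 18 13) (.n 20 (.n 23 (.g 2 24) (.n 27 (.g 20 29) .c)) (.n 23 (.n 24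
  (.g 23 13) .c) .c))) (.n 20 (.n 27 (.g 20 29) (.n 23 (.n 24 (.g 10 15) .c) .c)) (.n 23 (.n 24
  (.g 23 13) .c) .c)))) (.n 18 (.n 29 (.g 18 13) (.n 20 (.n 27 (.g 20 29) (.n 23 (.n 24 (.g 23
  13) .c) .c)) (.n 23 (.n 24 (.g 23 13) .c) .c))) (.n 20 (.n 27 (.g 20 29) (.n 23 (.n 24 (.g 23
  13) .c) .c)) (.n 23 (.n 24 (.g 23 13) .c) .c)))))) (.n 14 (.n 15 (.n 17 (.g 17 14) (.n 18 (.g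
  18 30) (.n 20 (.g 20 30) (.n 23 (.g 23 14) (.n 24 (.g 24 30) .c))))) (.n 17 (.n 30 (.g 17 14)
  (.n 18 (.n 29 (.g 18 30) (.n 20 (.n 23 (.g 1 24) (.n 27 (.g 20 30) .c)) (.n 23 (.n 24 (.g 23
  14) .c) .c))) (.n 20 (.n 27 (.g 20 30) (.n 23 (.n 24 (.g 23 14) .c) .c)) (.n 23 (.n 24 (.g 23
  14) .c) .c)))) (.n 18 (.n 29 (.g 18 30) (.n 20 (.n 27 (.g 20 30) (.n 23 (.n 24 (.g 9 15) .c)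
  .c)) (.n 23 (.n 24 (.g 23 14) .c) .c))) (.n 20 (.n 27 (.g 20 30) (.n 23 (.n 24 (.g 23 14) .c)
  .c)) (.n 23 (.n 24 (.g 23 14) .c) .c))))) .c))) (.n 11 (.n 15 (.n 17 (.g 17 27) (.n 18 (.g 18
  27) (.n 20 (.g 20 11) (.n 23 (.g 23 11) (.n 24 (.g 24 27) .c))))) (.d 11)) (.n 13 (.n 15 (.n 17
  (.g 17 29) (.n 18 (.g 18 13) (.n 20 (.g 20 29) (.n 23 (.g 23 13) (.n 24 (.g 24 29) .c))))) (.d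
  13)) (.n 14 (.n 15 (.n 17 (.n 24 (.g 17 14) (.n 18 (.n 27 (.g 18 30) (.n 20 (.n 23 (.g 1 24)
  (.n 29 (.g 20 30) .c)) (.n 23 (.n 30 (.g 23 14) .c) .c))) (.n 20 (.n 29 (.g 20 30) (.n 23 (.n
  30 (.g 23 14) .c) .c)) (.n 23 (.n 30 (.g 23 14) .c) .c)))) (.n 18 (.n 27 (.g 18 30) (.n 20 (.n
  29 (.g 20 30) (.n 23 (.n 30 (.g 15 15) .c) .c)) (.n 23 (.n 30 (.g 23 14) .c) .c))) (.n 20 (.n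
  29 (.g 20 30) (.n 23 (.n 30 (.g 23 14) .c) .c)) (.n 23 (.n 30 (.g 23 14) .c) .c)))) (.d 1))
  .c))))) (.n 7 (.n 9 (.n 15 (.n 17 (.g 17 23) (.n 18 (.g 18 23) (.n 20 (.g 20 23) (.n 23 (.g 23
  23) (.n 24 (.g 24 7) .c))))) (.d 7)) (.d 1)) (.n 9 (.n 14 (.n 15 (.n 17 (.g 17 14) (.n 18 (.g
  18 30) (.n 20 (.g 20 30) (.n 23 (.g 23 14) (.n 24 (.g 24 30) .c))))) (.d 14)) (.n 15 (.n 11 (.n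
  13 (.n 17 (.g 17 6) (.n 18 (.g 18 22) (.n 20 (.g 20 22) (.n 23 (.g 23 6) (.n 24 (.g 24 6)
  .c))))) (.n 17 (.n 23 (.g 17 27) (.n 18 (.n 20 (.g 18 27) (.n 24 (.n 27 (.g 2 20) (.n 30 (.g 5
  15) .c)) (.n 27 (.n 29 (.g 5 15) .c) .c))) (.n 24 (.n 30 (.g 24 27) (.n 20 (.n 29 (.g 2 13) .c)
  .c)) (.n 20 (.n 27 (.n 29 (.g 27 27) .c) .c) .c)))) (.n 18 (.n 20 (.g 18 27) (.n 24 (.n 30 (.g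
  24 27) (.n 23 (.n 29 (.g 2 21) .c) .c)) (.n 23 (.n 27 (.n 29 (.g 27 27) .c) .c) .c))) (.n 24
  (.n 30 (.g 24 27) (.n 20 (.n 23 (.n 27 (.g 2 12) .c) .c) .c)) (.n 20 (.n 23 (.n 27 (.n 29 (.g 5
  15) .c) .c) .c) .c))))) (.n 13 (.n 17 (.n 23 (.g 17 29) (.n 18 (.n 20 (.g 18 13) (.n 24 (.n 27
  (.g 2 20) (.n 30 (.g 24 29) .c)) (.n 27 (.n 29 (.g 27 13) .c) .c))) (.n 24 (.n 30 (.g 24 29)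
  (.n 20 (.n 29 (.g 2 13) .c) .c)) (.n 20 (.n 27 (.n 29 (.g 3 15) .c) .c) .c)))) (.n 18 (.n 20
  (.g 18 13) (.n 24 (.n 30 (.g 24 29) (.n 23 (.n 29 (.g 2 21) .c) .c)) (.n 23 (.n 27 (.n 29 (.g 3
  15) .c) .c) .c))) (.n 24 (.n 30 (.g 24 29) (.n 20 (.n 23 (.n 27 (.g 2 12) .c) .c) .c)) (.n 20
  (.n 23 (.n 27 (.n 29 (.g 27 13) .c) .c) .c) .c)))) .c)) (.n 11 (.d 4) (.n 13 (.d 2) .c)))) (.n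
  11 (.d 2) (.n 13 (.d 4) (.n 14 (.d 8) .c)))))) (.n 6 (.n 9 (.n 11 (.n 15 (.n 17 (.g 17 27) (.n
  18 (.g 18 27) (.n 20 (.g 20 11) (.n 23 (.g 23 11) (.n 24 (.g 24 27) .c))))) (.d 11)) (.n 14 (.n
  15 (.n 17 (.g 17 14) (.n 18 (.g 18 30) (.n 20 (.g 20 30) (.n 23 (.g 23 14) (.n 24 (.g 24 30)
  .c))))) (.d 14)) (.n 15 (.n 7 (.n 13 (.n 17 (.g 17 10) (.n 18 (.g 18 26) (.n 20 (.g 20 10) (.n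
  23 (.g 23 26) (.n 24 (.g 24 26) .c))))) (.n 17 (.n 27 (.g 17 23) (.n 18 (.n 24 (.g 18 23) (.n
  20 (.n 23 (.g 2 24) (.n 30 (.g 9 15) .c)) (.n 23 (.n 29 (.g 9 15) .c) .c))) (.n 20 (.n 30 (.g
  20 23) (.n 23 (.n 29 (.g 15 15) .c) .c)) (.n 23 (.n 29 (.g 23 23) .c) .c)))) (.n 18 (.n 24 (.g
  18 23) (.n 20 (.n 30 (.g 20 23) (.n 23 (.n 29 (.g 12 15) .c) .c)) (.n 23 (.n 29 (.g 23 23) .c)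
  .c))) (.n 20 (.n 30 (.g 20 23) (.n 23 (.n 29 (.g 23 23) .c) .c)) (.n 23 (.n 29 (.g 23 23) .c)
  .c))))) (.n 13 (.n 17 (.n 27 (.g 17 29) (.n 18 (.n 24 (.g 18 13) (.n 20 (.n 23 (.g 2 24) (.n 30
  (.g 20 29) .c)) (.n 23 (.n 29 (.g 23 13) .c) .c))) (.n 20 (.n 30 (.g 20 29) (.n 23 (.n 29 (.g
  15 15) .c) .c)) (.n 23 (.n 29 (.g 23 13) .c) .c)))) (.n 18 (.n 24 (.g 18 13) (.n 20 (.n 30 (.g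
  20 29) (.n 23 (.n 29 (.g 23 13) .c) .c)) (.n 23 (.n 29 (.g 23 13) .c) .c))) (.n 20 (.n 30 (.g
  20 29) (.n 23 (.n 29 (.g 23 13) .c) .c)) (.n 23 (.n 29 (.g 23 13) .c) .c)))) .c)) (.n 7 (.d 8)
  (.n 13 (.d 2) .c))))) (.d 8)) (.d 2))) (.n 6 (.n 9 (.n 7 (.n 10 (.n 15 (.n 17 (.g 17 23) (.n 18
  (.g 18 23) (.n 20 (.g 20 23) (.n 23 (.g 23 23) (.n 24 (.g 24 7) .c))))) (.d 7)) (.d 2)) (.n 10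
  (.n 13 (.n 15 (.n 17 (.g 17 29) (.n 18 (.g 18 13) (.n 20 (.g 20 29) (.n 23 (.g 23 13) (.n 24
  (.g 24 29) .c))))) (.d 13)) (.n 15 (.n 11 (.n 14 (.n 17 (.g 17 21) (.n 18 (.g 18 5) (.n 20 (.g
  20 21) (.n 23 (.g 23 5) (.n 24 (.g 24 5) .c))))) (.n 17 (.n 20 (.g 17 27) (.n 18 (.n 23 (.g 18
  27) (.n 24 (.n 27 (.g 1 20) (.n 29 (.g 6 15) .c)) (.n 27 (.n 30 (.g 6 15) .c) .c))) (.n 24 (.n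
  29 (.g 24 27) (.n 23 (.n 30 (.g 1 22) .c) .c)) (.n 23 (.n 27 (.n 29 (.g 1 30) .c) .c) .c))))
  (.n 18 (.n 23 (.g 18 27) (.n 24 (.n 29 (.g 24 27) (.n 20 (.n 30 (.g 1 14) .c) .c)) (.n 20 (.n
  27 (.n 29 (.g 1 6) .c) .c) .c))) (.n 24 (.n 29 (.g 24 27) (.n 20 (.n 23 (.n 27 (.g 1 12) .c)
  .c) .c)) (.n 20 (.n 23 (.n 27 (.n 30 (.g 6 15) .c) .c) .c) .c))))) (.n 14 (.n 17 (.n 20 (.g 17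
  14) (.n 18 (.n 23 (.g 18 30) (.n 24 (.n 27 (.g 1 20) (.n 29 (.g 24 30) .c)) (.n 27 (.n 30 (.g
  27 14) .c) .c))) (.n 24 (.n 29 (.g 24 30) (.n 23 (.n 30 (.g 1 22) .c) .c)) (.n 23 (.n 27 (.n 29
  (.g 1 30) .c) .c) .c)))) (.n 18 (.n 23 (.g 18 30) (.n 24 (.n 29 (.g 24 30) (.n 20 (.n 30 (.g 1
  14) .c) .c)) (.n 20 (.n 27 (.n 29 (.g 1 6) .c) .c) .c))) (.n 24 (.n 29 (.g 24 30) (.n 20 (.n 23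
  (.n 27 (.g 1 12) .c) .c) .c)) (.n 20 (.n 23 (.n 27 (.n 30 (.g 27 14) .c) .c) .c) .c)))) .c))
  (.n 11 (.d 4) (.n 14 (.d 1) .c)))) (.n 11 (.d 1) (.n 13 (.d 8) (.n 14 (.d 4) .c))))) (.d 1))
  (.d 4))) (.n 5 (.n 6 (.n 9 (.n 10 (.n 13 (.n 15 (.n 17 (.g 17 29) (.n 18 (.g 18 13) (.n 20 (.g
  20 29) (.n 23 (.g 23 13) (.n 24 (.g 24 29) .c))))) (.d 13)) (.n 14 (.n 15 (.n 17 (.g 17 14) (.n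
  18 (.g 18 30) (.n 20 (.g 20 30) (.n 23 (.g 23 14) (.n 24 (.g 24 30) .c))))) (.d 14)) (.n 15 (.n
  7 (.n 11 (.n 17 (.g 17 12) (.n 18 (.g 18 12) (.n 20 (.g 20 28) (.n 23 (.g 23 28) (.n 24 (.g 24
  28) .c))))) (.n 17 (.n 29 (.g 17 23) (.n 18 (.n 30 (.g 18 23) (.n 20 (.n 23 (.g 4 24) (.n 24
  (.g 15 15) .c)) (.n 23 (.n 27 (.g 15 15) .c) .c))) (.n 20 (.n 24 (.g 20 23) (.n 23 (.n 27 (.g 9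
  15) .c) .c)) (.n 23 (.n 27 (.g 23 23) .c) .c)))) (.n 18 (.n 30 (.g 18 23) (.n 20 (.n 24 (.g 20
  23) (.n 23 (.n 27 (.g 10 15) .c) .c)) (.n 23 (.n 27 (.g 23 23) .c) .c))) (.n 20 (.n 24 (.g 20
  23) (.n 23 (.n 27 (.g 23 23) .c) .c)) (.n 23 (.n 27 (.g 23 23) .c) .c))))) (.n 11 (.n 17 (.n 29
  (.g 17 27) (.n 18 (.n 30 (.g 18 27) (.n 20 (.n 23 (.g 4 24) (.n 24 (.g 15 15) .c)) (.n 23 (.n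
  27 (.g 15 15) .c) .c))) (.n 20 (.n 24 (.g 20 11) (.n 23 (.n 27 (.g 23 11) .c) .c)) (.n 23 (.n
  27 (.g 23 11) .c) .c)))) (.n 18 (.n 30 (.g 18 27) (.n 20 (.n 24 (.g 20 11) (.n 23 (.n 27 (.g 23
  11) .c) .c)) (.n 23 (.n 27 (.g 23 11) .c) .c))) (.n 20 (.n 24 (.g 20 11) (.n 23 (.n 27 (.g 23
  11) .c) .c)) (.n 23 (.n 27 (.g 23 11) .c) .c)))) .c)) (.n 7 (.d 8) (.n 11 (.d 4) .c))))) (.d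
  8)) (.d 8)) (.d 4)) (.d 4))) (.n 5 (.n 6 (.n 9 (.n 10 (.n 7 (.n 12 (.n 15 (.n 17 (.g 17 23) (.n
  18 (.g 18 23) (.n 20 (.g 20 23) (.n 23 (.g 23 23) (.n 24 (.g 24 7) .c))))) (.d 7)) (.d 4)) (.n
  11 (.n 12 (.n 15 (.n 17 (.g 17 27) (.n 18 (.g 18 27) (.n 20 (.g 20 11) (.n 23 (.g 23 11) (.n 24
  (.g 24 27) .c))))) (.d 11)) (.d 8)) (.n 12 (.n 15 (.n 13 (.n 14 (.n 17 (.g 17 19) (.n 18 (.g 18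
  19) (.n 20 (.g 20 3) (.n 23 (.g 23 3) (.n 24 (.g 24 3) .c))))) (.n 17 (.n 18 (.g 17 29) (.n 20
  (.n 23 (.g 20 29) (.n 24 (.n 27 (.g 6 15) (.n 29 (.g 1 18) .c)) (.n 27 (.n 30 (.g 1 26) .c)
  .c))) (.n 24 (.n 27 (.g 24 29) (.n 23 (.n 30 (.g 1 22) .c) .c)) (.n 23 (.n 27 (.n 29 (.g 1 30)
  .c) .c) .c)))) (.n 20 (.n 23 (.g 20 29) (.n 24 (.n 27 (.g 24 29) (.n 18 (.n 30 (.g 1 14) .c)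
  .c)) (.n 18 (.n 27 (.n 29 (.g 1 6) .c) .c) .c))) (.n 24 (.n 27 (.g 24 29) (.n 18 (.n 23 (.n 29
  (.g 1 10) .c) .c) .c)) (.n 18 (.n 23 (.n 27 (.n 30 (.g 1 2) .c) .c) .c) .c))))) (.n 14 (.n 17
  (.n 18 (.g 17 14) (.n 20 (.n 23 (.g 20 30) (.n 24 (.n 27 (.g 24 30) (.n 29 (.g 1 18) .c)) (.n
  27 (.n 30 (.g 1 26) .c) .c))) (.n 24 (.n 27 (.g 24 30) (.n 23 (.n 30 (.g 1 22) .c) .c)) (.n 23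
  (.n 27 (.n 29 (.g 1 30) .c) .c) .c)))) (.n 20 (.n 23 (.g 20 30) (.n 24 (.n 27 (.g 24 30) (.n 18
  (.n 30 (.g 1 14) .c) .c)) (.n 18 (.n 27 (.n 29 (.g 1 6) .c) .c) .c))) (.n 24 (.n 27 (.g 24 30)
  (.n 18 (.n 23 (.n 29 (.g 1 10) .c) .c) .c)) (.n 18 (.n 23 (.n 27 (.n 30 (.g 1 2) .c) .c) .c)
  .c)))) .c)) (.n 13 (.d 2) (.n 14 (.d 1) .c))) (.n 13 (.d 1) (.n 14 (.d 2) .c))))) (.d 2)) (.d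
  1)) (.d 2)) (.d 1)))

set_option maxRecDepth 20000 in
lemma checkA : check treeA 65814 1 = true := by decide +kernel

set_option maxRecDepth 20000 in
lemma checkB : check treeB 278 2523463681 = true := by decide +kernel

lemma testBit_lor_shift (m v n : ℕ) :
    (m ||| (1 <<< v)).testBit n = true → m.testBit n = true ∨ n = v := by
  rw [Nat.testBit_or, Nat.one_shiftLeft, Nat.testBit_two_pow]
  simp only [Bool.or_eq_true, decide_eq_true_eq]
  rintro (h | h)
  · exact Or.inl h
  · exact Or.inr h.symm

lemma check_sound (P : ℕ → Prop) [DecidablePred P]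
    (h6 : odds.countP (fun n => decide (P n)) ≤ 6) (h5 : 5 ≤ odds.countP (fun n => decide (P n)))
    (h16 : odds.countP (fun n => decide (P n)) + evens.countP (fun n => decide (P n)) = 16)
    (hdeg : ∀ c ∈ odds, P c → odds.countP (fun d => decide (P d ∧ ¬ P (c ^^^ d))) ≤ 2)
    (hfree : ∀ e a, P e → par (a &&& e) = false → (∃ x < 32, par (a &&& x) = true) →
      ∃ x < 32, par (a &&& x) = true ∧ ¬ P x ∧ ¬ P (x ^^^ e))
    (t : Tree) : ∀ i o : ℕ, (∀ n, i.testBit n = true → P n) → (∀ n, o.testBit n = true → ¬ P n) →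
      check t i o = true → False := by
  have hin : ∀ (l : List ℕ) (i : ℕ), (∀ n, i.testBit n = true → P n) →
      pc l i ≤ l.countP (fun n => decide (P n)) := by
    intro l i hi
    exact List.countP_mono_left fun n _ hn => decide_eq_true (hi n hn)
  have hout : ∀ (l : List ℕ) (o : ℕ), (∀ n, o.testBit n = true → ¬ P n) →
      pc l o + l.countP (fun n => decide (P n)) ≤ l.length := by
    intro l o ho
    have h1 : pc l o ≤ l.countP (fun n => !(decide (P n))) := by
      refine List.countP_mono_left fun n _ hn => ?_
      simpa using ho n hn
    have h2 := List.length_eq_countP_add_countP (l := l) (fun n => decide (P n))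
    simp only [Bool.decide_eq_true, decide_not, decide_eq_true_eq] at h2
    omega
  have hlo : odds.length = 16 := rfl
  have hle : evens.length = 15 := rfl
  induction t with
  | c =>
    intro i o hi ho hc
    have a1 := hin odds i hi
    have a2 := hout odds o ho
    have a3 := hout evens o ho
    simp only [check, Bool.or_eq_true, Nat.ble_eq] at hc
    omega
  | d c =>
    intro i o hi ho hc
    simp only [check, Bool.and_eq_true, Nat.ble_eq, List.contains_iff_mem] at hc
    obtain ⟨⟨h1, h2⟩, h3⟩ := hc
    have h4 := hdeg c h1 (hi c h2)
    have h5 := List.countP_mono_left (l := odds)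
      (p := fun d => i.testBit d && o.testBit (c ^^^ d))
      (q := fun d => decide (P d ∧ ¬ P (c ^^^ d)))
      (by
        intro d _ hd
        simp only [Bool.and_eq_true] at hd
        exact decide_eq_true ⟨hi d hd.1, ho _ hd.2⟩)
    omega
  | g e a =>
    intro i o hi ho hc
    simp only [check, Bool.and_eq_true, List.any_eq_true, List.all_eq_true, List.mem_range,
      Bool.or_eq_true, Bool.not_eq_true'] at hc
    obtain ⟨⟨⟨h1, h2⟩, h3⟩, h4⟩ := hc
    obtain ⟨x, hx, hx1, hx2, hx3⟩ := hfree e a (hi e h1) h2 h3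
    rcases h4 x hx with (h | h) | h
    · rw [h] at hx1; exact absurd hx1 (by decide)
    · exact hx2 (hi _ h)
    · exact hx3 (hi _ h)
  | n v l r ihl ihr =>
    intro i o hi ho hc
    simp only [check, Bool.and_eq_true] at hc
    by_cases hv : P v
    · refine ihl _ o ?_ ho hc.1
      intro n hn
      rcases testBit_lor_shift _ _ _ hn with h | rfl
      · exact hi n h
      · exact hv
    · refine ihr i _ hi ?_ hc.2
      intro n hn
      rcases testBit_lor_shift _ _ _ hn with h | rfl
      · exact ho n h
      · exact hv

end AGK

namespace AGK

/-! ### The bound in rank five -/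

/-- The vector coded by a natural number. -/
def vec (n : ℕ) : V 5 := fun i => if n.testBit i then 1 else 0

lemma vec_xor (a b : ℕ) : vec (a ^^^ b) = vec a + vec b := by
  funext i
  simp only [vec, Nat.testBit_xor, Pi.add_apply]
  cases a.testBit i <;> cases b.testBit i <;> decide

lemma vec_surj : ∀ x : V 5, ∃ n < 32, vec n = x := by decide +kernel

lemma dot_vec (a x : ℕ) : dotL (vec a) (vec x) = if par (a &&& x) then 1 else 0 := by
  have h : ∀ a0 a1 a2 a3 a4 x0 x1 x2 x3 x4 : Bool,
      ((if a0 then 1 else 0) * (if x0 then 1 else 0) + (if a1 then 1 else 0) * (if x1 then 1 else 0)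
      + (if a2 then 1 else 0) * (if x2 then 1 else 0) + (if a3 then 1 else 0) *
      (if x3 then 1 else 0) + (if a4 then 1 else 0) * (if x4 then 1 else 0) : ZMod 2) =
      if ((a0 && x0) ^^ (a1 && x1) ^^ (a2 && x2) ^^ (a3 && x3) ^^ (a4 && x4)) then 1 else 0 := by
    decide +kernel
  change vec a ⬝ᵥ vec x = _
  simp only [dotProduct, Fin.sum_univ_five, vec, par, Nat.testBit_and]
  exact h _ _ _ _ _ _ _ _ _ _

/-- The sum of the coordinates. -/
def sg : V 5 →ₗ[ZMod 2] ZMod 2 := dotL (fun _ => 1)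

lemma sg_apply (x : V 5) : sg x = ∑ i, x i := by
  change (fun _ => (1 : ZMod 2)) ⬝ᵥ x = _
  simp [dotProduct]

lemma odds_nodup : (odds.map vec).Nodup := by decide +kernel
lemma evens_nodup : (evens.map vec).Nodup := by decide +kernel

lemma mem_odds : ∀ x : V 5, x ∈ odds.map vec ↔ sg x = 1 := by
  simp_rw [sg_apply]; decide +kernel

lemma mem_evens : ∀ x : V 5, x ∈ evens.map vec ↔ sg x ≠ 1 ∧ x ≠ 0 := by
  simp_rw [sg_apply]; decide +kernel

lemma countP_vec (l : List ℕ) (hl : (l.map vec).Nodup) (p : V 5 → Prop) [DecidablePred p] :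
    l.countP (fun n => decide (p (vec n))) =
      (Finset.univ.filter fun x => x ∈ l.map vec ∧ p x).card := by
  have h1 : (Finset.univ.filter fun x => x ∈ l.map vec ∧ p x) =
      ((l.map vec).filter (fun x => decide (p x))).toFinset := by
    ext x; simp
  rw [h1, List.toFinset_card_of_nodup (hl.filter _), ← List.countP_eq_length_filter,
    List.countP_map]
  rfl

lemma no_arrangement (R : Finset (V 5)) (h0 : 0 ∉ R) (hR : Free5 R) (hcard : R.card = 16)
    (h6 : (R.filter fun x => sg x = 1).card ≤ 6) (h5 : 5 ≤ (R.filter fun x => sg x = 1).card)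
    (hdeg : ∀ c ∈ R, sg c = 1 → (R.filter fun y => sg y = 1 ∧ c + y ∉ R).card ≤ 2)
    (hc : ∀ i : Fin 4, (Pi.single i.castSucc 1 : V 5) ∈ R)
    (hAB : (Pi.single 4 1 : V 5) ∈ R ∨ ∀ x ∈ R, sg x = 1 → x 4 = 0) : False := by
  have eodd : odds.countP (fun n => decide (vec n ∈ R)) = (R.filter fun x => sg x = 1).card := by
    rw [countP_vec odds odds_nodup (fun x => x ∈ R)]
    congr 1
    ext x
    simp only [Finset.mem_filter, Finset.mem_univ, true_and, mem_odds]
    tauto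
  have eeven : evens.countP (fun n => decide (vec n ∈ R)) =
      (R.filter fun x => ¬ sg x = 1).card := by
    rw [countP_vec evens evens_nodup (fun x => x ∈ R)]
    congr 1
    ext x
    simp only [Finset.mem_filter, Finset.mem_univ, true_and, mem_evens]
    constructor
    · rintro ⟨⟨h1, h2⟩, h3⟩; exact ⟨h3, h1⟩
    · rintro ⟨h3, h1⟩
      refine ⟨⟨h1, ?_⟩, h3⟩
      rintro rfl
      exact h0 h3
  have hsum := Finset.card_filter_add_card_filter_not (s := R) (fun x => sg x = 1)
  have sound := check_sound (fun n => vec n ∈ R) (by omega) (by omega) (by omega)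
    (by
      intro c hc hcR
      have hc1 : sg (vec c) = 1 := (mem_odds _).1 (List.mem_map_of_mem hc)
      simp only [vec_xor]
      rw [countP_vec odds odds_nodup (fun x => x ∈ R ∧ vec c + x ∉ R)]
      refine le_trans (Finset.card_le_card ?_) (hdeg _ hcR hc1)
      intro x
      simp only [Finset.mem_filter, Finset.mem_univ, true_and, mem_odds]
      tauto)
    (by
      intro e a he hpar hex
      obtain ⟨x, _, hx⟩ := hex
      have hne : dotL (vec a) ≠ 0 := by
        intro h
        have h2 := dot_vec a x
        rw [h, hx] at h2
        simp at h2
      obtain ⟨y, hy1, hy2, hy3⟩ := hR (vec e) he (dotL (vec a)) hne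
        (by rw [dot_vec, hpar]; simp)
      obtain ⟨n, hn, rfl⟩ := vec_surj y
      refine ⟨n, hn, ?_, hy2, ?_⟩
      · rw [dot_vec] at hy1
        by_contra hcon
        simp [hcon] at hy1
      · rw [vec_xor]; exact hy3)
  have hvec : vec 1 = Pi.single 0 1 ∧ vec 2 = Pi.single 1 1 ∧ vec 4 = Pi.single 2 1 ∧
      vec 8 = Pi.single 3 1 ∧ vec 16 = Pi.single 4 1 := by decide +kernel
  obtain ⟨v0, v1, v2, v3, v4⟩ := hvec
  have m0 : vec 1 ∈ R := by rw [v0]; exact hc 0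
  have m1 : vec 2 ∈ R := by rw [v1]; exact hc 1
  have m2 : vec 4 ∈ R := by rw [v2]; exact hc 2
  have m3 : vec 8 ∈ R := by rw [v3]; exact hc 3
  have hz : vec 0 ∉ R := by
    have : vec 0 = 0 := by decide +kernel
    rwa [this]
  have bits : ∀ m < 2 ^ 32, ∀ n, m.testBit n = true → n < 32 := by
    intro m hm n hn
    by_contra hge
    rw [Nat.testBit_lt_two_pow (lt_of_lt_of_le hm (Nat.pow_le_pow_right (by norm_num) (by omega)))]
      at hn
    exact absurd hn (by decide)
  rcases hAB with hA | hB
  · rw [← v4] at hA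
    refine sound treeA 65814 1 ?_ ?_ checkA
    · intro n hn
      have hn2 := bits _ (by norm_num) n hn
      have : ∀ n < 32, (65814 : ℕ).testBit n = true → n = 1 ∨ n = 2 ∨ n = 4 ∨ n = 8 ∨ n = 16 := by
        decide
      rcases this n hn2 hn with rfl | rfl | rfl | rfl | rfl <;> assumption
    · intro n hn
      have hn2 := bits _ (by norm_num) n hn
      have : ∀ n < 32, (1 : ℕ).testBit n = true → n = 0 := by decide
      rcases this n hn2 hn with rfl
      exact hz
  · refine sound treeB 278 2523463681 ?_ ?_ checkB
    · intro n hn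
      have hn2 := bits _ (by norm_num) n hn
      have : ∀ n < 32, (278 : ℕ).testBit n = true → n = 1 ∨ n = 2 ∨ n = 4 ∨ n = 8 := by
        decide
      rcases this n hn2 hn with rfl | rfl | rfl | rfl <;> assumption
    · intro n hn hnR
      have hn2 := bits _ (by norm_num) n hn
      have : ∀ n < 32, (2523463681 : ℕ).testBit n = true →
          n = 0 ∨ (vec n ∈ odds.map vec ∧ vec n 4 = 1) := by decide +kernel
      rcases this n hn2 hn with rfl | ⟨h1, h2⟩
      · exact hz hnR
      · rw [hB _ hnR ((mem_odds _).1 h1)] at h2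
        exact zero_ne_one h2

/-- Four independent points outside a hyperplane. -/
lemma exists_frame {n : ℕ} (C : Finset (V n)) (h : V n →ₗ[ZMod 2] ZMod 2)
    (hC : ∀ x ∈ C, h x = 1) (h5 : 5 ≤ C.card) :
    ∃ c : Fin 4 → V n, LinearIndependent (ZMod 2) c ∧ ∀ i, c i ∈ C := by
  obtain ⟨a, ha, b, hb, c, hc, hab, hac, hbc⟩ := Finset.two_lt_card.mp (show 2 < C.card by omega)
  obtain ⟨d, hd, hdn⟩ : ∃ d ∈ C, d ∉ ({a, b, c, a + b + c} : Finset (V n)) := by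
    by_contra hcon
    push Not at hcon
    have h1 := Finset.card_le_card (show C ⊆ ({a, b, c, a + b + c} : Finset (V n)) from hcon)
    have h2 : ({a, b, c, a + b + c} : Finset (V n)).card ≤ 4 := Finset.card_le_four
    omega
  simp only [Finset.mem_insert, Finset.mem_singleton, not_or] at hdn
  obtain ⟨hda, hdb, hdc, hdabc⟩ := hdn
  refine ⟨![a, b, c, d], ?_, ?_⟩
  · rw [Fintype.linearIndependent_iff]
    intro g hg
    rw [Fin.sum_univ_four] at hg
    have hh := congrArg h hg
    simp only [Matrix.cons_val] at hg hh
    simp only [map_add, map_smul, hC a ha, hC b hb, hC c hc, hC d hd, map_zero, smul_eq_mul,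
      mul_one] at hh
    have key : g 0 = 0 ∧ g 1 = 0 ∧ g 2 = 0 ∧ g 3 = 0 := by
      rcases zmod_cases (g 0) with e0 | e0 <;> rcases zmod_cases (g 1) with e1 | e1 <;>
      rcases zmod_cases (g 2) with e2 | e2 <;> rcases zmod_cases (g 3) with e3 | e3 <;>
      rw [e0, e1, e2, e3] at hg hh <;>
      first
      | exact ⟨e0, e1, e2, e3⟩
      | exact absurd hh (by decide)
      | (exfalso
         simp only [zero_smul, one_smul, zero_add, add_zero] at hg
         have := eq_of_add_eq_zero hg
         first
         | exact hab this
         | exact hac this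
         | exact hbc this
         | exact hda this.symm
         | exact hdb this.symm
         | exact hdc this.symm
         | exact hdabc this.symm)
    intro i
    fin_cases i
    · exact key.1
    · exact key.2.1
    · exact key.2.2.1
    · exact key.2.2.2
  · intro i
    fin_cases i <;> assumption

/-- Lines through a point outside a hyperplane join it to points outside the hyperplane. -/
lemma half_lines {n : ℕ} (S : Finset (V n)) (h : V n →ₗ[ZMod 2] ZMod 2) (c : V n) (hc : h c = 1) :
    (S.filter fun y => c + y ∈ S).card ≤ 2 * (S.filter fun y => h y = 1 ∧ c + y ∈ S).card := by
  have h1 := Finset.card_filter_add_card_filter_not (s := S.filter fun y => c + y ∈ S)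
    (fun y => h y = 1)
  have e1 : ((S.filter fun y => c + y ∈ S).filter fun y => h y = 1) =
      S.filter fun y => h y = 1 ∧ c + y ∈ S := by
    ext x; simp only [Finset.mem_filter]; tauto
  have e2 : ((S.filter fun y => c + y ∈ S).filter fun y => ¬ h y = 1).card ≤
      (S.filter fun y => h y = 1 ∧ c + y ∈ S).card := by
    refine Finset.card_le_card_of_injOn (fun y => c + y) ?_ ?_
    · intro y hy
      simp only [Finset.coe_filter, Finset.mem_filter, Set.mem_ofPred_eq] at hy ⊢
      obtain ⟨⟨h1, h2⟩, h3⟩ := hy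
      refine ⟨h2, ?_, ?_⟩
      · have : h y = 0 := (zmod_cases _).resolve_right h3
        rw [map_add, hc, this, add_zero]
      · rw [← add_assoc, add_self_V, zero_add]
        exact h1
    · intro x _ y _ hxy
      exact add_left_cancel hxy
  rw [e1] at h1
  omega

lemma card_preimage {n : ℕ} (L : V n →ₗ[ZMod 2] V n) (hL : Function.Bijective L)
    (Q : Finset (V n)) (p : V n → Prop) [DecidablePred p] :
    ((Finset.univ.filter fun x => L x ∈ Q).filter fun x => p (L x)).card = (Q.filter p).card := by
  rw [← Finset.card_image_of_injective _ hL.1]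
  congr 1
  ext y
  simp only [Finset.mem_image, Finset.mem_filter, Finset.mem_univ, true_and]
  constructor
  · rintro ⟨x, hx, rfl⟩; exact hx
  · intro hy
    obtain ⟨x, rfl⟩ := hL.2 y
    exact ⟨x, hy, rfl⟩

lemma bound16 (Q : Finset (V 5)) (h0 : 0 ∉ Q) (hQ : Free5 Q) (hcard : Q.card = 16) : False := by
  classical
  have hl := lines5 Q h0 hQ hcard
  obtain ⟨h, hne, hlt⟩ := exists_large Q h0 8 (fun x hx => by exact_mod_cast hl x hx) 3 2
    (by rw [hcard]; norm_num)
  set C := Q.filter fun x => h x = 1 with hCdef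
  have h6 : C.card ≤ 6 := by rw [hcard] at hlt; omega
  have hadj : ∀ c ∈ C, 4 ≤ (C.filter fun y => c + y ∈ Q).card := by
    intro c hc
    rw [hCdef, Finset.mem_filter] at hc
    have h1 := hl c hc.1
    have h2 := half_lines Q h c hc.2
    rw [hCdef, Finset.filter_filter]
    omega
  obtain ⟨c', hc'⟩ : C.Nonempty := by
    rw [Finset.nonempty_iff_ne_empty]
    intro hemp
    obtain ⟨v, hv⟩ : ∃ v, h v ≠ 0 := by
      by_contra hcon
      push Not at hcon
      exact hne (LinearMap.ext hcon)
    have hv1 := zmod_ne_zero hv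
    have hker : ∀ x ∈ insert 0 Q, h x = 0 := by
      intro x hx
      rcases Finset.mem_insert.1 hx with rfl | hx
      · exact map_zero h
      · refine (zmod_cases _).resolve_right fun h1 => ?_
        have : x ∈ C := Finset.mem_filter.2 ⟨hx, h1⟩
        rw [hemp] at this
        exact absurd this (Finset.notMem_empty _)
    have hdis : Disjoint (insert 0 Q) ((insert 0 Q).image (· + v)) := by
      rw [Finset.disjoint_left]
      intro x hx hx'
      obtain ⟨y, hy, rfl⟩ := Finset.mem_image.1 hx'
      have h1 := hker _ hx
      rw [map_add, hker y hy, hv1] at h1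
      exact absurd h1 (by decide)
    have h1 := Finset.card_union_of_disjoint hdis
    rw [Finset.card_image_of_injective _ (add_left_injective v), Finset.card_insert_of_notMem h0,
      hcard] at h1
    have h2 := Finset.card_le_univ (insert 0 Q ∪ (insert 0 Q).image (· + v))
    rw [h1] at h2
    simp [ZMod.card] at h2
  have h5 : 5 ≤ C.card := by
    have h1 : (C.filter fun y => c' + y ∈ Q) ⊆ C.erase c' := by
      intro y hy
      rw [Finset.mem_filter] at hy
      refine Finset.mem_erase.2 ⟨?_, hy.1⟩
      rintro rfl
      rw [add_self_V] at hy
      exact h0 hy.2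
    have h2 := Finset.card_le_card h1
    rw [Finset.card_erase_of_mem hc'] at h2
    have := hadj c' hc'
    omega
  obtain ⟨c, hli, hcC⟩ := exists_frame C h (fun x hx => (Finset.mem_filter.1 hx).2) h5
  obtain ⟨d, hd, hd1, hdAB⟩ : ∃ d, d ∉ Submodule.span (ZMod 2) (Set.range c) ∧ h d = 1 ∧
      (d ∈ Q ∨ ∀ x ∈ C, x ∈ Submodule.span (ZMod 2) (Set.range c)) := by
    by_cases hex : ∃ d ∈ C, d ∉ Submodule.span (ZMod 2) (Set.range c)
    · obtain ⟨d, hdC, hd⟩ := hex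
      rw [hCdef, Finset.mem_filter] at hdC
      exact ⟨d, hd, hdC.2, Or.inl hdC.1⟩
    · push Not at hex
      obtain ⟨v, hv⟩ : ∃ v, v ∉ Submodule.span (ZMod 2) (Set.range c) := by
        by_contra hcon
        push Not at hcon
        have htop : Submodule.span (ZMod 2) (Set.range c) = ⊤ :=
          Submodule.eq_top_iff'.2 hcon
        have h1 := finrank_range_le_card (R := ZMod 2) c
        rw [Set.finrank, htop, finrank_top, Module.finrank_fin_fun] at h1
        simp at h1
      rcases zmod_cases (h v) with hv0 | hv1
      · refine ⟨v + c 0, ?_, ?_, Or.inr hex⟩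
        · intro hc
          apply hv
          have := Submodule.add_mem _ hc (Submodule.subset_span (Set.mem_range_self 0))
          rwa [add_cancel_V] at this
        · rw [map_add, hv0, zero_add]
          exact (Finset.mem_filter.1 (hcC 0)).2
      · exact ⟨v, hv, hv1, Or.inr hex⟩
  set b : Fin 5 → V 5 := Fin.snoc c d with hb
  have hb4 : b 4 = d := Fin.snoc_last (α := fun _ => V 5) d c
  have hbc : ∀ i : Fin 4, b i.castSucc = c i := fun i => Fin.snoc_castSucc (α := fun _ => V 5) d c i
  have hbli : LinearIndependent (ZMod 2) b := linearIndependent_finSnoc.2 ⟨hli, hd⟩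
  set L : V 5 →ₗ[ZMod 2] V 5 := Fintype.linearCombination (ZMod 2) b with hLdef
  have hLapp : ∀ x, L x = ∑ i, x i • b i := fun x => Fintype.linearCombination_apply _ _ _
  have hLinj : Function.Injective L := by
    rw [injective_iff_map_eq_zero]
    intro x hx
    rw [hLapp] at hx
    funext i
    exact Fintype.linearIndependent_iff.1 hbli x hx i
  have hLbij : Function.Bijective L := ⟨hLinj, LinearMap.injective_iff_surjective.1 hLinj⟩
  have hLs : ∀ i, L (Pi.single i 1) = b i := by
    intro i
    rw [hLdef, Fintype.linearCombination_apply_single, one_smul]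
  have hhb : ∀ i, h (b i) = 1 := by
    intro i
    refine Fin.lastCases ?_ (fun j => ?_) i
    · exact (congrArg h hb4).trans hd1
    · rw [hbc]; exact (Finset.mem_filter.1 (hcC j)).2
  have hhL : ∀ x, h (L x) = sg x := by
    intro x
    rw [hLapp, map_sum, sg_apply]
    refine Finset.sum_congr rfl fun i _ => ?_
    rw [map_smul, hhb, smul_eq_mul, mul_one]
  set R : Finset (V 5) := Finset.univ.filter fun x => L x ∈ Q with hRdef
  have hmemR : ∀ x, x ∈ R ↔ L x ∈ Q := by intro x; simp [hRdef]
  have hRC : (R.filter fun x => sg x = 1).card = C.card := by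
    rw [hCdef, ← card_preimage L hLbij Q (fun x => h x = 1)]
    simp only [hhL, hRdef]
  refine no_arrangement R ?_ ?_ ?_ (by omega) (by omega) ?_ ?_ ?_
  · rw [hmemR, map_zero]; exact h0
  · intro f hf k hk hkf
    let e := LinearEquiv.ofBijective L hLbij
    have he : ∀ x, e x = L x := fun x => rfl
    obtain ⟨x, hx1, hx2, hx3⟩ := hQ (L f) ((hmemR f).1 hf) (k.comp e.symm.toLinearMap)
      (by
        intro hcon
        apply hk
        apply LinearMap.ext
        intro x
        have := LinearMap.congr_fun hcon (e x)
        simpa using this)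
      (by rw [← he]; simpa using hkf)
    refine ⟨e.symm x, by simpa using hx1, ?_, ?_⟩
    · rw [hmemR, ← he, LinearEquiv.apply_symm_apply]; exact hx2
    · rw [hmemR, map_add, ← he (e.symm x), LinearEquiv.apply_symm_apply]; exact hx3
  · have := card_preimage L hLbij Q (fun _ => True)
    simpa [hRdef, hcard] using this
  · intro y hy hy1
    have hyC : L y ∈ C := by
      rw [hCdef, Finset.mem_filter, hhL]; exact ⟨(hmemR y).1 hy, hy1⟩
    have h1 := hadj _ hyC
    have h2 := Finset.card_filter_add_card_filter_not (s := C) (fun z => L y + z ∈ Q)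
    have h3 := card_preimage L hLbij Q (fun z => h z = 1 ∧ L y + z ∉ Q)
    have h4 : (R.filter fun z => sg z = 1 ∧ y + z ∉ R) =
        ((Finset.univ.filter fun x => L x ∈ Q).filter fun z => h (L z) = 1 ∧ L y + L z ∉ Q) := by
      ext z
      simp only [Finset.mem_filter, hmemR, hhL, map_add, Finset.mem_univ, true_and]
    rw [h4, h3, ← Finset.filter_filter]
    change (C.filter _).card ≤ 2
    omega
  · intro i
    rw [hmemR, hLs, hbc]
    exact (Finset.mem_filter.1 (hcC i)).1
  · rcases hdAB with hA | hB
    · left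
      rw [hmemR, hLs, hb4]
      exact hA
    · right
      intro x hx hx1
      by_contra hx4
      have hx41 := zmod_ne_zero hx4
      have hxC : L x ∈ C := by
        rw [hCdef, Finset.mem_filter, hhL]; exact ⟨(hmemR x).1 hx, hx1⟩
      have h1 := hB _ hxC
      rw [hLapp, Fin.sum_univ_castSucc] at h1
      have hlast : x (Fin.last 4) • b (Fin.last 4) = d := by
        change x 4 • b 4 = d
        rw [hx41, one_smul, hb4]
      rw [hlast] at h1
      apply hd
      refine (Submodule.add_mem_iff_right _ ?_).1 h1
      refine Submodule.sum_mem _ fun i _ => Submodule.smul_mem _ _ ?_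
      rw [hbc]
      exact Submodule.subset_span (Set.mem_range_self i)

/-- A set of nonzero vectors in rank five without AG(3,2)-minor has at most 15 elements. -/
lemma bound5 (Q : Finset (V 5)) (h0 : 0 ∉ Q) (hQ : Free5 Q) : Q.card ≤ 15 := by
  by_contra hcon
  obtain ⟨Q', hsub, hcard⟩ := Finset.exists_subset_card_eq (show 16 ≤ Q.card by omega)
  refine bound16 Q' (fun h => h0 (hsub h)) ?_ hcard
  intro f hf h hh hhf
  obtain ⟨x, hx1, hx2, hx3⟩ := hQ f (hsub hf) h hh hhf
  exact ⟨x, hx1, fun h => hx2 (hsub h), fun h => hx3 (hsub h)⟩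

end AGK

namespace AGK

/-! ### The structure in rank six -/

lemma erase_bound {n : ℕ} (S : Finset (V n)) (h0 : 0 ∉ S)
    (hl : ∀ e ∈ S, 10 ≤ (S.filter fun y => e + y ∈ S).card)
    (g : V n →ₗ[ZMod 2] ZMod 2) (c : V n) (hc : c ∈ S.filter fun x => g x = 1) :
    5 ≤ (S.filter fun y => g y = 1 ∧ c + y ∈ S).card ∧
      (S.filter fun y => g y = 1 ∧ c + y ∈ S) ⊆ (S.filter fun x => g x = 1).erase c := by
  rw [Finset.mem_filter] at hc
  have h1 := hl c hc.1
  have h2 := half_lines S g c hc.2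
  refine ⟨by omega, ?_⟩
  intro y hy
  rw [Finset.mem_filter] at hy
  refine Finset.mem_erase.2 ⟨?_, Finset.mem_filter.2 ⟨hy.1, hy.2.1⟩⟩
  rintro rfl
  rw [add_self_V] at hy
  exact h0 hy.2.2

lemma six_le {n : ℕ} (S : Finset (V n)) (h0 : 0 ∉ S)
    (hl : ∀ e ∈ S, 10 ≤ (S.filter fun y => e + y ∈ S).card)
    (g : V n →ₗ[ZMod 2] ZMod 2) (hg : ∃ x ∈ S, g x = 1) :
    6 ≤ (S.filter fun x => g x = 1).card := by
  obtain ⟨c, hcS, hc1⟩ := hg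
  have hc : c ∈ S.filter fun x => g x = 1 := Finset.mem_filter.2 ⟨hcS, hc1⟩
  obtain ⟨h1, h2⟩ := erase_bound S h0 hl g c hc
  have h3 := Finset.card_le_card h2
  rw [Finset.card_erase_of_mem hc] at h3
  omega

lemma lincomb_injective {m n : ℕ} (b : Fin m → V n) (hb : LinearIndependent (ZMod 2) b) :
    Function.Injective (Fintype.linearCombination (ZMod 2) b) := by
  rw [injective_iff_map_eq_zero]
  intro x hx
  rw [Fintype.linearCombination_apply] at hx
  funext i
  exact Fintype.linearIndependent_iff.1 hb x hx i

/-- Five independent points have ten sums of pairs. -/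
lemma ten_sums {n : ℕ} (b : Fin 5 → V n) (hb : LinearIndependent (ZMod 2) b) (T : Finset (V n))
    (hT : ∀ i j, i ≠ j → b i + b j ∈ T) : 10 ≤ T.card := by
  set L := Fintype.linearCombination (ZMod 2) b with hL
  have hinj := lincomb_injective b hb
  set P : Finset (V 5) := (Finset.univ.filter fun p : Fin 5 × Fin 5 => p.1 < p.2).image
    fun p => Pi.single p.1 1 + Pi.single p.2 1 with hP
  have hcard : P.card = 10 := by rw [hP]; decide +kernel
  rw [← hcard, ← Finset.card_image_of_injective _ hinj]
  refine Finset.card_le_card ?_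
  intro x hx
  rw [hP, Finset.image_image, Finset.mem_image] at hx
  obtain ⟨p, hp, rfl⟩ := hx
  rw [Finset.mem_filter] at hp
  simp only [Function.comp_apply, map_add, Fintype.linearCombination_apply_single, one_smul]
  exact hT _ _ (ne_of_lt hp.2)

lemma even_cases : ∀ x : V 4, x ≠ 0 → ∑ i, x i = 0 →
    x = (fun _ => 1) ∨ ∃ i j, i ≠ j ∧ x = Pi.single i 1 + Pi.single j 1 := by decide +kernel

lemma odd_cases : ∀ x : V 4, ∑ i, x i = 1 →
    ∃ i, x = Pi.single i 1 ∨ (fun _ => 1) = x + Pi.single i 1 := by decide +kernel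

/-- Five coplanar points: seven sums. -/
lemma seven_sums {n : ℕ} (b : Fin 4 → V n) (hb : LinearIndependent (ZMod 2) b) (T : Finset (V n))
    (hT : ∀ i j, i ≠ j → b i + b j ∈ T) (d : V n) (hdb : ∀ i, d ≠ b i)
    (hd : d ∈ Submodule.span (ZMod 2) (Set.range b)) (hdT : ∀ i, d + b i ∈ T)
    (h : V n →ₗ[ZMod 2] ZMod 2) (hh : ∀ i, h (b i) = 1) (hhd : h d = 1) : 7 ≤ T.card := by
  set L := Fintype.linearCombination (ZMod 2) b with hL
  have hinj := lincomb_injective b hb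
  have hLs : ∀ i, L (Pi.single i 1) = b i := by
    intro i
    rw [hL, Fintype.linearCombination_apply_single, one_smul]
  set P : Finset (V 4) := Finset.univ.filter fun x => x ≠ 0 ∧ ∑ i, x i = 0 with hP
  have hcard : P.card = 7 := by rw [hP]; decide +kernel
  have hones : L (fun _ => 1) ∈ T := by
    rw [← Fintype.range_linearCombination] at hd
    obtain ⟨y, rfl⟩ := hd
    have hy : ∑ i, y i = 1 := by
      rw [Fintype.linearCombination_apply, map_sum] at hhd
      rw [← hhd]
      refine Finset.sum_congr rfl fun i _ => ?_
      rw [map_smul, hh, smul_eq_mul, mul_one]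
    obtain ⟨i, hi | hi⟩ := odd_cases y hy
    · exact absurd ((congrArg L hi).trans (hLs i)) (hdb i)
    · rw [hi, map_add, hLs]
      exact hdT i
  rw [← hcard, ← Finset.card_image_of_injective _ hinj]
  refine Finset.card_le_card ?_
  intro x hx
  rw [Finset.mem_image] at hx
  obtain ⟨y, hy, rfl⟩ := hx
  rw [hP, Finset.mem_filter] at hy
  rcases even_cases y hy.2.1 hy.2.2 with rfl | ⟨i, j, hij, rfl⟩
  · exact hones
  · change L _ ∈ T
    rw [map_add, hLs, hLs]
    exact hT i j hij

lemma exists_one {n : ℕ} {g : V n →ₗ[ZMod 2] ZMod 2} (hg : g ≠ 0) : ∃ v, g v = 1 := by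
  by_contra hcon
  push Not at hcon
  exact hg (LinearMap.ext fun x => (zmod_cases _).resolve_right (hcon x))

lemma structure6 (S : Finset (V 6)) (h0 : 0 ∉ S) (hS : Free6 S) (hcard : S.card = 21)
    (hspan : ∀ g : V 6 →ₗ[ZMod 2] ZMod 2, g ≠ 0 → ∃ x ∈ S, g x = 1) :
    ∃ b : Fin 6 → V 6, LinearIndependent (ZMod 2) b ∧ (∀ i, b i ∈ S) ∧
      ∀ i j, i ≠ j → b i + b j ∈ S := by
  classical
  have hl := lines6 bound5 S h0 hS hcard
  obtain ⟨h, hne, hlt⟩ := exists_large S h0 10 (fun x hx => by exact_mod_cast hl x hx) 2 7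
    (by rw [hcard]; norm_num)
  have h6 : ∀ g : V 6 →ₗ[ZMod 2] ZMod 2, g ≠ 0 → 6 ≤ (S.filter fun x => g x = 1).card :=
    fun g hg => six_le S h0 hl g (hspan g hg)
  set C := S.filter fun x => h x = 1 with hCdef
  have hC6 : C.card = 6 := by
    have : 6 ≤ C.card := h6 h hne
    rw [hcard] at hlt
    omega
  have hCS : ∀ c ∈ C, c ∈ S := fun c hc => (Finset.mem_filter.1 hc).1
  have hC1 : ∀ c ∈ C, h c = 1 := fun c hc => (Finset.mem_filter.1 hc).2
  have hpair : ∀ c ∈ C, ∀ d ∈ C, c ≠ d → c + d ∈ S := by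
    intro c hc d hd hcd
    obtain ⟨h1, h2⟩ := erase_bound S h0 hl h c hc
    have h3 : (S.filter fun y => h y = 1 ∧ c + y ∈ S) = C.erase c := by
      refine Finset.eq_of_subset_of_card_le h2 ?_
      rw [Finset.card_erase_of_mem hc, hC6]
      exact h1
    have h4 : d ∈ C.erase c := Finset.mem_erase.2 ⟨hcd.symm, hd⟩
    rw [← h3, Finset.mem_filter] at h4
    exact h4.2.2
  -- no nonzero functional vanishes on `C`
  have hkill : ∀ g : V 6 →ₗ[ZMod 2] ZMod 2, (∀ c ∈ C, g c = 0) → g = 0 := by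
    intro g hgC
    by_contra hg
    obtain ⟨c, hli, hcC⟩ := exists_frame C h hC1 (by omega)
    have hcinj := hli.injective
    by_cases hex : ∃ d ∈ C, d ∉ Submodule.span (ZMod 2) (Set.range c)
    · obtain ⟨d, hdC, hd⟩ := hex
      set b : Fin 5 → V 6 := Fin.snoc c d with hb
      have hbli : LinearIndependent (ZMod 2) b := linearIndependent_finSnoc.2 ⟨hli, hd⟩
      have hbC : ∀ i, b i ∈ C := by
        intro i
        refine Fin.lastCases ?_ (fun j => ?_) i
        · rw [hb, Fin.snoc_last]; exact hdC
        · rw [hb, Fin.snoc_castSucc]; exact hcC j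
      set T := S.filter fun x => ¬ g x = 1 ∧ ¬ h x = 1 with hT
      have hT10 : 10 ≤ T.card := by
        refine ten_sums b hbli T fun i j hij => ?_
        rw [hT, Finset.mem_filter]
        refine ⟨hpair _ (hbC i) _ (hbC j) (fun h => hij (hbli.injective h)), ?_, ?_⟩
        · rw [map_add, hgC _ (hbC i), hgC _ (hbC j)]; decide
        · rw [map_add, hC1 _ (hbC i), hC1 _ (hbC j)]; decide
      have hg6 := h6 g hg
      have e1 := Finset.card_filter_add_card_filter_not (s := S) (fun x => h x = 1)
      have e2 := Finset.card_filter_add_card_filter_not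
        (s := S.filter fun x => ¬ h x = 1) (fun x => g x = 1)
      have e3 : (S.filter fun x => ¬ h x = 1).filter (fun x => ¬ g x = 1) = T := by
        rw [hT]; ext x; simp only [Finset.mem_filter]; tauto
      have e4 : (S.filter fun x => ¬ h x = 1).filter (fun x => g x = 1) =
          S.filter fun x => g x = 1 := by
        ext x; simp only [Finset.mem_filter]
        constructor
        · rintro ⟨⟨h1, _⟩, h2⟩; exact ⟨h1, h2⟩
        · rintro ⟨h1, h2⟩
          refine ⟨⟨h1, fun h3 => ?_⟩, h2⟩
          rw [hgC x (Finset.mem_filter.2 ⟨h1, h3⟩)] at h2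
          exact absurd h2 (by decide)
      rw [e3, e4] at e2
      change C.card + _ = _ at e1
      omega
    · push Not at hex
      obtain ⟨v, hv⟩ := exists_one hg
      obtain ⟨g', hg', hk'⟩ := exists_functional (insert v (Finset.univ.image c)) (by
        have h1 := Finset.card_insert_le v (Finset.univ.image c)
        have h2 : (Finset.univ.image c).card ≤ 4 := by
          simpa using Finset.card_image_le (s := Finset.univ) (f := c)
        omega)
      have hg'v : g' v = 0 := hk' v (Finset.mem_insert_self _ _)
      have hg'C : ∀ x ∈ C, g' x = 0 := by
        intro x hx
        have hle : Submodule.span (ZMod 2) (Set.range c) ≤ LinearMap.ker g' := by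
          rw [Submodule.span_le]
          rintro _ ⟨i, rfl⟩
          exact hk' _ (Finset.mem_insert_of_mem (Finset.mem_image_of_mem _ (Finset.mem_univ i)))
        exact hle (hex x hx)
      have hgg : g + g' ≠ 0 := by
        intro hcon
        have := LinearMap.congr_fun hcon v
        rw [LinearMap.add_apply, hv, hg'v, LinearMap.zero_apply] at this
        exact absurd this (by decide)
      obtain ⟨d, hdC, hd⟩ : ∃ d ∈ C, d ∉ Finset.univ.image c := by
        by_contra hcon
        push Not at hcon
        have h1 := Finset.card_le_card (show C ⊆ Finset.univ.image c from hcon)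
        have h2 : (Finset.univ.image c).card ≤ 4 := by
          simpa using Finset.card_image_le (s := Finset.univ) (f := c)
        omega
      have hdc : ∀ i, d ≠ c i := by
        rintro i rfl
        exact hd (Finset.mem_image_of_mem _ (Finset.mem_univ i))
      set T := S.filter fun x => h x = 0 ∧ g x = 0 ∧ g' x = 0 with hT
      have hTmem : ∀ x ∈ C, ∀ y ∈ C, x ≠ y → x + y ∈ T := by
        intro x hx y hy hxy
        rw [hT, Finset.mem_filter]
        refine ⟨hpair x hx y hy hxy, ?_, ?_, ?_⟩
        · rw [map_add, hC1 _ hx, hC1 _ hy]; decide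
        · rw [map_add, hgC _ hx, hgC _ hy]; decide
        · rw [map_add, hg'C _ hx, hg'C _ hy]; decide
      have hT7 : 7 ≤ T.card :=
        seven_sums c hli T (fun i j hij => hTmem _ (hcC i) _ (hcC j) fun h => hij (hcinj h))
          d hdc (hex d hdC) (fun i => hTmem _ hdC _ (hcC i) (hdc i)) h (fun i => hC1 _ (hcC i))
          (hC1 _ hdC)
      have k1 := h6 g hg
      have k2 := h6 g' hg'
      have k3 := h6 (g + g') hgg
      have key : (C.card + T.card) * 2 + (S.filter fun x => g x = 1).card +
          (S.filter fun x => g' x = 1).card + (S.filter fun x => (g + g') x = 1).card ≤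
          2 * S.card := by
        rw [hCdef, hT]
        simp only [Finset.card_filter, Finset.card_eq_sum_ones S, add_mul, Finset.sum_mul,
          Finset.mul_sum, ← Finset.sum_add_distrib]
        refine Finset.sum_le_sum fun x hx => ?_
        have a1 : h x = 1 → g x = 0 ∧ g' x = 0 := fun h1 =>
          have : x ∈ C := Finset.mem_filter.2 ⟨hx, h1⟩
          ⟨hgC x this, hg'C x this⟩
        rw [LinearMap.add_apply]
        revert a1
        generalize h x = u
        generalize g x = v
        generalize g' x = w
        revert u v w
        decide
      omega
  -- hence the six elements of `C` are independent
  let e : Fin 6 ≃ C := (Fintype.equivFinOfCardEq (by simpa using hC6)).symm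
  let b : Fin 6 → V 6 := fun i => (e i : V 6)
  have hbC : ∀ i, b i ∈ C := fun i => (e i).2
  have hbinj : Function.Injective b := Subtype.val_injective.comp e.injective
  refine ⟨b, ?_, fun i => hCS _ (hbC i), fun i j hij => hpair _ (hbC i) _ (hbC j)
    fun h => hij (hbinj h)⟩
  refine linearIndependent_of_top_le_span_of_card_eq_finrank ?_ (by simp)
  by_contra hcon
  have hlt : Submodule.span (ZMod 2) (Set.range b) < ⊤ := by
    rw [lt_top_iff_ne_top]; intro h; exact hcon h.ge
  obtain ⟨g, hg, hle⟩ := Submodule.exists_le_ker_of_lt_top _ hlt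
  apply hg
  apply hkill
  intro c hc
  apply hle
  apply Submodule.subset_span
  exact ⟨e.symm ⟨c, hc⟩, by simp [b]⟩

/-- The vectors representing the complete graph on seven vertices. -/
lemma kVecs_eq : kVecs 7 = (((Finset.univ.filter fun p : Fin 7 × Fin 7 => p.1 < p.2).image
    fun p => Pi.single p.1 1 + Pi.single p.2 1 : Finset (V 7)) : Set (V 7)) := by
  ext x
  simp only [kVecs, Set.mem_ofPred_eq, Finset.coe_image, Set.mem_image, Finset.coe_filter,
    Finset.mem_univ, true_and, Prod.exists]
  constructor
  · rintro ⟨i, j, hij, rfl⟩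
    rcases lt_or_gt_of_ne hij with hlt | hlt
    · exact ⟨i, j, hlt, rfl⟩
    · exact ⟨j, i, hlt, add_comm _ _⟩
  · rintro ⟨i, j, hij, rfl⟩
    exact ⟨i, j, ne_of_lt hij, rfl⟩

lemma exists_iso (S : Finset (V 6)) (h0 : 0 ∉ S) (hS : Free6 S) (hcard : S.card = 21)
    (hspan : ∀ g : V 6 →ₗ[ZMod 2] ZMod 2, g ≠ 0 → ∃ x ∈ S, g x = 1) :
    ∃ L : V 6 →ₗ[ZMod 2] V 7, Function.Injective L ∧ L '' (S : Set (V 6)) = kVecs 7 := by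
  obtain ⟨b, hli, hbS, hbp⟩ := structure6 S h0 hS hcard hspan
  have hinj := lincomb_injective b hli
  let E : V 6 ≃ₗ[ZMod 2] V 6 := LinearEquiv.ofBijective _
    ⟨hinj, LinearMap.injective_iff_surjective.1 hinj⟩
  have hE : ∀ i, E.symm (b i) = Pi.single i 1 := by
    intro i
    rw [LinearEquiv.symm_apply_eq]
    change b i = Fintype.linearCombination (ZMod 2) b (Pi.single i 1)
    rw [Fintype.linearCombination_apply_single, one_smul]
  let w : Fin 6 → V 7 := fun i => Pi.single i.castSucc 1 + Pi.single 6 1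
  have hw : LinearIndependent (ZMod 2) w := by
    rw [Fintype.linearIndependent_iff]
    simp only [w]
    intro g hg i
    have h1 := congrFun hg i.castSucc
    rw [Finset.sum_apply] at h1
    have h2 : ∀ j : Fin 6, (g j • (Pi.single j.castSucc 1 + Pi.single 6 1 : V 7)) i.castSucc =
        if j = i then g j else 0 := by
      intro j
      have h3 : (Pi.single (6 : Fin 7) (1 : ZMod 2) : V 7) i.castSucc = 0 :=
        Pi.single_eq_of_ne (by change i.castSucc ≠ Fin.last 6; exact (Fin.castSucc_lt_last i).ne) _
      rw [Pi.smul_apply, Pi.add_apply, h3, add_zero, Pi.single_apply]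
      by_cases hij : j = i
      · simp [hij]
      · have : i.castSucc ≠ j.castSucc := fun h => hij (Fin.castSucc_injective _ h).symm
        simp [hij, this]
    rw [Finset.sum_congr rfl fun j _ => h2 j] at h1
    simpa using h1
  have hwinj := lincomb_injective w hw
  let L : V 6 →ₗ[ZMod 2] V 7 := (Fintype.linearCombination (ZMod 2) w).comp E.symm.toLinearMap
  have hLinj : Function.Injective L := by
    intro x y hxy
    exact E.symm.injective (hwinj hxy)
  have hLb : ∀ i, L (b i) = w i := by
    intro i
    change Fintype.linearCombination (ZMod 2) w (E.symm (b i)) = w i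
    rw [hE, Fintype.linearCombination_apply_single, one_smul]
  refine ⟨L, hLinj, ?_⟩
  rw [kVecs_eq, ← Finset.coe_image]
  congr 1
  symm
  refine Finset.eq_of_subset_of_card_le ?_ ?_
  · intro x hx
    rw [Finset.mem_image] at hx
    obtain ⟨⟨i, j⟩, hij, rfl⟩ := hx
    rw [Finset.mem_filter] at hij
    have hij' : i < j := hij.2
    rw [Finset.mem_image]
    obtain ⟨i', rfl⟩ : ∃ i' : Fin 6, i = i'.castSucc :=
      ⟨i.castPred (ne_of_lt (lt_of_lt_of_le hij' (Fin.le_last j))), by simp⟩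
    refine Fin.lastCases (motive := fun j => i'.castSucc < j → ∃ a ∈ S, L a =
      Pi.single i'.castSucc 1 + Pi.single j 1) ?_ (fun j' => ?_) j hij'
    · intro _
      exact ⟨b i', hbS i', hLb i'⟩
    · intro hlt
      refine ⟨b i' + b j', hbp _ _ ?_, ?_⟩
      · rintro rfl; exact lt_irrefl _ hlt
      · rw [map_add, hLb, hLb]
        simp only [w]
        have h6 := add_self_V (Pi.single 6 1 : V 7)
        rw [add_add_add_comm, h6, add_zero]
  · rw [Finset.card_image_of_injective _ hLinj, hcard]
    decide +kernel

end AGK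

namespace AGK

/-! ### From matroids to sets of vectors -/

/-- A projection with prescribed kernel and prescribed first coordinate. -/
lemma exists_proj2 (e f : V 6) (he : e ≠ 0) (hf : f ≠ 0) (hef : e ≠ f)
    (h : V 6 →ₗ[ZMod 2] ZMod 2) (hh : h ≠ 0) (hhe : h e = 0) (hhf : h f = 0) :
    ∃ Λ : V 6 →ₗ[ZMod 2] V 4, Function.Surjective Λ ∧
      (∀ x, Λ x = 0 ↔ x = 0 ∨ x = e ∨ x = f ∨ x = f + e) ∧ ∀ x, Λ x 0 = h x := by
  obtain ⟨p, hps, hp⟩ := exists_proj e he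
  have hpf : p f ≠ 0 := by
    rw [Ne, hp]
    rintro (h1 | h1)
    · exact hf h1
    · exact hef h1.symm
  obtain ⟨q, hqs, hq⟩ := exists_proj (p f) hpf
  have hker : ∀ x, q (p x) = 0 ↔ x = 0 ∨ x = e ∨ x = f ∨ x = f + e := by
    intro x
    rw [hq, hp, proj_eq_iff hp]
    tauto
  have hkerh : ∀ x, q (p x) = 0 → h x = 0 := by
    intro x hx
    rcases (hker x).1 hx with rfl | rfl | rfl | rfl
    · exact map_zero h
    · exact hhe
    · exact hhf
    · rw [map_add, hhe, hhf, add_zero]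
  obtain ⟨v, hv⟩ := exists_one hh
  have hqv : q (p v) ≠ 0 := by
    intro h1
    rw [hkerh v h1] at hv
    exact absurd hv (by decide)
  obtain ⟨r, hrs, hr⟩ := exists_proj (q (p v)) hqv
  let Λ : V 6 →ₗ[ZMod 2] V 4 :=
    { toFun := fun x => Fin.cons (h x) (r (q (p x)))
      map_add' := by
        intro x y
        funext i
        refine Fin.cases ?_ (fun j => ?_) i
        · simp
        · simp
      map_smul' := by
        intro c x
        funext i
        refine Fin.cases ?_ (fun j => ?_) i
        · simp
        · simp }
  have hΛ : ∀ x, Λ x = Fin.cons (h x) (r (q (p x))) := fun x => rfl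
  refine ⟨Λ, ?_, ?_, ?_⟩
  · intro y
    obtain ⟨z3, hz3⟩ := hrs (fun i => y i.succ)
    obtain ⟨z2, rfl⟩ := hqs z3
    obtain ⟨z, rfl⟩ := hps z2
    have hrv : r (q (p v)) = 0 := (hr _).2 (Or.inr rfl)
    have hy : y = Fin.cons (y 0) (fun i => y i.succ) := (Fin.cons_self_tail y).symm
    by_cases hz : h z = y 0
    · refine ⟨z, ?_⟩
      rw [hΛ, hz, hz3]
      exact hy.symm
    · refine ⟨z + v, ?_⟩
      have h1 : h (z + v) = y 0 := by
        rw [map_add, hv]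
        revert hz
        generalize h z = a
        generalize y 0 = b
        revert a b
        decide
      rw [hΛ, h1, map_add, map_add, map_add, hrv, add_zero, hz3]
      exact hy.symm
  · intro x
    rw [← hker, hΛ]
    constructor
    · intro h1
      have h2 : h x = 0 := congrFun h1 0
      have h3 : r (q (p x)) = 0 := funext fun i => congrFun h1 i.succ
      rcases (hr _).1 h3 with h4 | h4
      · exact h4
      · exfalso
        have h5 : q (p (x + v)) = 0 := by rw [map_add, map_add, h4, add_self_V]
        have h6 := hkerh _ h5
        rw [map_add, h2, hv] at h6
        exact absurd h6 (by decide)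
    · intro h1
      rw [h1, hkerh x h1, map_zero]
      funext i
      refine Fin.cases ?_ (fun j => ?_) i
      · simp
      · simp
  · intro x
    rfl

/-- A minor obtained by contracting an independent set and restricting. -/
lemma minor_rep {W W' : Type*} [AddCommGroup W] [Module (ZMod 2) W]
    [AddCommGroup W'] [Module (ZMod 2) W'] (M : Matroid α) (φ : α → W)
    (hφ : M.IsRepBy (ZMod 2) φ) (C X : Set α) (hC : M.Indep C) (hX : X ⊆ M.E)
    (hCX : Disjoint X C) (Λ : W →ₗ[ZMod 2] W')
    (hker : LinearMap.ker Λ = Submodule.span (ZMod 2) (φ '' C)) :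
    ((M.con C).del (M.E \ X)).E = X ∧
      ((M.con C).del (M.E \ X)).IsRepBy (ZMod 2) (Λ ∘ φ) := by
  have hE : ((M.con C).del (M.E \ X)).E = X := by
    change (M.E \ C) \ (M.E \ X) = X
    ext x
    simp only [Set.mem_sdiff]
    constructor
    · rintro ⟨⟨h1, h2⟩, h3⟩
      by_contra hx
      exact h3 ⟨h1, hx⟩
    · intro hx
      exact ⟨⟨hX hx, fun hc => (Set.disjoint_left.1 hCX) hx hc⟩, fun h => h.2 hx⟩
  refine ⟨hE, ?_⟩
  intro I hI
  rw [hE] at hI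
  have hIC : Disjoint I C := hCX.mono_left hI
  have h1 : ((M.con C).del (M.E \ X)).Indep I ↔ M.Indep (I ∪ C) := by
    change ((M ／ C) ＼ (M.E \ X)).Indep I ↔ _
    rw [Matroid.delete_indep_iff, hC.contract_indep_iff]
    have : Disjoint I (M.E \ X) := by
      rw [Set.disjoint_left]
      intro x hx h2
      exact h2.2 (hI hx)
    tauto
  rw [h1, hφ _ (Set.union_subset (hI.trans hX) hC.subset_ground)]
  have h2 : LinearIndepOn (ZMod 2) φ C := (hφ C hC.subset_ground).1 hC
  have h3 := h2.quotient_iff_union hIC.symm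
  rw [Set.union_comm I C]
  change LinearIndepOn (ZMod 2) φ (C ∪ I) ↔ LinearIndepOn (ZMod 2) (Λ ∘ φ) I
  rw [← h3]
  have h4 : Λ ∘ φ = (Submodule.liftQ _ Λ hker.ge) ∘
      ((Submodule.span (ZMod 2) (φ '' C)).mkQ ∘ φ) := by
    funext x
    simp
  rw [h4]
  symm
  refine LinearMap.linearIndependent_iff (v := fun i : I =>
    ((Submodule.span (ZMod 2) (φ '' C)).mkQ ∘ φ) i) _ ?_
  exact Submodule.ker_liftQ_eq_bot _ _ _ hker.le

lemma free6_of_no_minor (M : Matroid α) (φ : α → V 6) (hφ : M.IsRepBy (ZMod 2) φ)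
    (hAG : ¬ M.HasAGMinor) (S : Finset (V 6)) (hS : (S : Set (V 6)) = φ '' M.E)
    (hinj : Set.InjOn φ M.E) (h0 : 0 ∉ S) (hsimple : M.IsSimpleM) : Free6 S := by
  have hmem : ∀ x, x ∈ S ↔ ∃ a ∈ M.E, φ a = x := by
    intro x
    rw [← Finset.mem_coe, hS]
    rfl
  intro e he f hf hef h hh hhe hhf
  by_contra hcon
  push Not at hcon
  apply hAG
  obtain ⟨Λ, hsurj, hker, hΛ0⟩ := exists_proj2 e f (fun h => h0 (h ▸ he)) (fun h => h0 (h ▸ hf))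
    hef h hh hhe hhf
  obtain ⟨a, ha, rfl⟩ := (hmem e).1 he
  obtain ⟨b, hb, rfl⟩ := (hmem f).1 hf
  have hΛa : Λ (φ a) = 0 := (hker _).2 (by tauto)
  have hΛb : Λ (φ b) = 0 := (hker _).2 (by tauto)
  have hex : ∀ y : V 4, ∃ c, y ∈ agVecs → c ∈ M.E ∧ Λ (φ c) = y := by
    intro y
    by_cases hy : y ∈ agVecs
    · obtain ⟨x, rfl⟩ := hsurj y
      have hx : h x = 1 := by rw [← hΛ0]; exact hy
      have hx2 : ∃ z ∈ S, Λ z = Λ x := by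
        by_cases h1 : x ∈ S
        · exact ⟨x, h1, rfl⟩
        by_cases h2 : x + φ a ∈ S
        · exact ⟨_, h2, by rw [map_add, hΛa, add_zero]⟩
        by_cases h3 : x + φ b ∈ S
        · exact ⟨_, h3, by rw [map_add, hΛb, add_zero]⟩
        exact ⟨_, hcon x hx h1 h2 h3, by rw [map_add, map_add, hΛa, hΛb, add_zero, add_zero]⟩
      obtain ⟨z, hz, hzx⟩ := hx2
      obtain ⟨c, hc, rfl⟩ := (hmem z).1 hz
      exact ⟨c, fun _ => ⟨hc, hzx⟩⟩
    · exact ⟨a, fun h => absurd h hy⟩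
  choose g hg using hex
  have hz : (0 : V 4) ∉ agVecs := by
    intro h
    exact absurd (show (0 : ZMod 2) = 1 from h) (by decide)
  have hkerspan : LinearMap.ker Λ = Submodule.span (ZMod 2) (φ '' {a, b}) := by
    apply le_antisymm
    · intro x hx
      have ma : φ a ∈ Submodule.span (ZMod 2) (φ '' {a, b}) :=
        Submodule.subset_span ⟨a, by simp, rfl⟩
      have mb : φ b ∈ Submodule.span (ZMod 2) (φ '' {a, b}) :=
        Submodule.subset_span ⟨b, by simp, rfl⟩
      rcases (hker x).1 hx with rfl | rfl | rfl | rfl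
      · exact Submodule.zero_mem _
      · exact ma
      · exact mb
      · exact Submodule.add_mem _ mb ma
    · rw [Submodule.span_le]
      rintro _ ⟨c, hc, rfl⟩
      rcases hc with rfl | rfl
      · exact hΛa
      · exact hΛb
  have hdis : Disjoint (g '' agVecs) {a, b} := by
    rw [Set.disjoint_left]
    rintro _ ⟨y, hy, rfl⟩ hc
    have h1 := (hg y hy).2
    apply hz
    rcases hc with hc | hc
    · rw [hc, hΛa] at h1
      rw [h1]; exact hy
    · rw [Set.mem_singleton_iff.1 hc, hΛb] at h1
      rw [h1]; exact hy
  obtain ⟨hE, hrep⟩ := minor_rep M φ hφ {a, b} (g '' agVecs) (hsimple a ha b hb)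
    (by rintro _ ⟨y, hy, rfl⟩; exact (hg y hy).1) hdis Λ hkerspan
  refine ⟨_, ⟨_, _, rfl⟩, Λ ∘ φ, hrep, ?_⟩
  rw [hE]
  refine ⟨?_, ?_, ?_⟩
  · rintro _ ⟨y, hy, rfl⟩
    change Λ (φ (g y)) ∈ agVecs
    rw [(hg y hy).2]; exact hy
  · rintro _ ⟨y, hy, rfl⟩ _ ⟨y', hy', rfl⟩ h1
    change Λ (φ (g y)) = Λ (φ (g y')) at h1
    rw [(hg y hy).2, (hg y' hy').2] at h1
    rw [h1]
  · intro y hy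
    exact ⟨g y, ⟨y, hy, rfl⟩, (hg y hy).2⟩

lemma rep_comp {W W' : Type*} [AddCommGroup W] [Module (ZMod 2) W]
    [AddCommGroup W'] [Module (ZMod 2) W'] (M : Matroid α) (φ : α → W)
    (hφ : M.IsRepBy (ZMod 2) φ) (L : W →ₗ[ZMod 2] W')
    (hL : Set.InjOn L (Submodule.span (ZMod 2) (φ '' M.E))) :
    M.IsRepBy (ZMod 2) (L ∘ φ) := by
  intro I hI
  rw [hφ I hI]
  symm
  refine L.linearIndependent_iff_of_injOn (v := I.restrict φ) (hL.mono ?_)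
  refine Submodule.span_mono ?_
  rintro _ ⟨i, rfl⟩
  exact ⟨i, hI i.2, rfl⟩

lemma ncard_eq_finrank {n : ℕ} (φ : α → V n) (I : Set α) (hI : LinearIndepOn (ZMod 2) φ I) :
    I.ncard = Module.finrank (ZMod 2) (Submodule.span (ZMod 2) (φ '' I)) := by
  have hfin : Finite I := LinearIndependent.finite_of_isNoetherian hI
  have : Fintype I := Fintype.ofFinite I
  have h1 := finrank_span_eq_card hI
  have h2 : Set.range (fun i : I => φ i) = φ '' I := by
    rw [Set.image_eq_range]
  rw [h2] at h1
  rw [h1, ← Nat.card_coe_set_eq, Nat.card_eq_fintype_card]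

lemma exists_rep6 (M : Matroid α) (hbin : M.IsBinaryM) (hrank : M.rkM = 6) :
    ∃ φ : α → V 6, M.IsRepBy (ZMod 2) φ ∧ Submodule.span (ZMod 2) (φ '' M.E) = ⊤ := by
  obtain ⟨n, φ, hφ⟩ := hbin
  set W : Submodule (ZMod 2) (V n) := Submodule.span (ZMod 2) (φ '' M.E) with hW
  obtain ⟨b, hbE, _, hbspan, hbli⟩ :=
    exists_linearIndepOn_extension (linearIndepOn_empty (ZMod 2) φ) (Set.empty_subset M.E)
  have hWb : W = Submodule.span (ZMod 2) (φ '' b) :=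
    le_antisymm (Submodule.span_le.2 hbspan) (Submodule.span_mono (Set.image_mono hbE))
  have hgreat : IsGreatest {k : ℕ | ∃ I ⊆ M.E, M.Indep I ∧ I.ncard = k}
      (Module.finrank (ZMod 2) W) := by
    constructor
    · exact ⟨b, hbE, (hφ b hbE).2 hbli, by rw [ncard_eq_finrank φ b hbli, hWb]⟩
    · rintro k ⟨I, hI, hind, rfl⟩
      rw [ncard_eq_finrank φ I ((hφ I hI).1 hind)]
      exact Submodule.finrank_mono (Submodule.span_mono (Set.image_mono hI))
  have hfr : Module.finrank (ZMod 2) W = 6 := by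
    rw [← hrank]
    exact hgreat.csSup_eq.symm
  let f : W ≃ₗ[ZMod 2] V 6 := LinearEquiv.ofFinrankEq W (V 6) (by rw [hfr]; simp)
  obtain ⟨L, hL⟩ := LinearMap.exists_extend f.toLinearMap
  have hLf : ∀ w : W, L w = f w := fun w => LinearMap.congr_fun hL w
  refine ⟨L ∘ φ, rep_comp M φ hφ L ?_, ?_⟩
  · intro x hx y hy hxy
    have h1 : f ⟨x, hx⟩ = f ⟨y, hy⟩ := by rw [← hLf, ← hLf]; exact hxy
    exact congrArg Subtype.val (f.injective h1)
  · rw [Set.image_comp, Submodule.span_image, Submodule.eq_top_iff']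
    intro y
    exact ⟨f.symm y, (f.symm y).2, by rw [hLf]; simp⟩

end AGK

theorem rank_six_extremal {α : Type*} (M : Matroid α)
    (hbin : M.IsBinaryM) (hsimple : M.IsSimpleM) (hrank : M.rkM = 6)
    (hAG : ¬ M.HasAGMinor) (hsize : M.E.ncard = 21) :
    M.IsBinaryIsoTo (kVecs 7) := by
  classical
  obtain ⟨φ, hφ, hspan⟩ := AGK.exists_rep6 M hbin hrank
  have hpair : ∀ a ∈ M.E, ∀ b ∈ M.E, LinearIndepOn (ZMod 2) φ {a, b} := by
    intro a ha b hb
    exact (hφ {a, b} (by rintro x (rfl | rfl) <;> assumption)).1 (hsimple a ha b hb)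
  have hinj : Set.InjOn φ M.E := by
    intro a ha b hb hab
    exact (hpair a ha b hb).injOn (by simp) (by simp) hab
  have hfin : M.E.Finite := Set.finite_of_ncard_ne_zero (by rw [hsize]; norm_num)
  have hfin2 : (φ '' M.E).Finite := hfin.image φ
  set S : Finset (AGK.V 6) := hfin2.toFinset with hSdef
  have hS : (S : Set (AGK.V 6)) = φ '' M.E := hfin2.coe_toFinset
  have hcard : S.card = 21 := by
    rw [← Set.ncard_coe_finset, hS, Set.ncard_image_of_injOn hinj, hsize]
  have h0 : 0 ∉ S := by
    rw [← Finset.mem_coe, hS]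
    rintro ⟨a, ha, h⟩
    exact (hpair a ha a ha).ne_zero (by simp) h
  have hfree := AGK.free6_of_no_minor M φ hφ hAG S hS hinj h0 hsimple
  obtain ⟨L, hLinj, hL⟩ := AGK.exists_iso S h0 hfree hcard (by
    intro g hg
    by_contra hcon
    push Not at hcon
    apply hg
    apply LinearMap.ext
    intro x
    have hle : Submodule.span (ZMod 2) (φ '' M.E) ≤ LinearMap.ker g := by
      rw [Submodule.span_le]
      intro y hy
      rw [← hS] at hy
      exact (AGK.zmod_cases _).resolve_right (hcon y hy)
    exact hle (by rw [hspan]; trivial))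
  refine ⟨L ∘ φ, AGK.rep_comp M φ hφ L hLinj.injOn, ?_⟩
  rw [← hL, hS, ← Set.image_comp]
  refine Set.InjOn.bijOn_image ?_
  intro a ha b hb hab
  exact hinj ha hb (hLinj hab)
end

section
/- Let M be the graft matroid of (G,T), where G is the complete bipartite graph K_{2,4} and T is the set of its four vertices of degree 2, and let t be the graft element of M. Then M/t is isomorphic to AG(3,2); in particular, M has an AG(3,2)-minor. -/
open Matroid Set

variable {α : Type*}

/-- The characteristic vector of the four degree-two vertices of `K_{2,4}`, whose
vertices are `{0, 1}` (degree four) and `{2, 3, 4, 5}` (degree two). -/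
def chiT24 : Fin 6 → ZMod 2 := fun i => if 2 ≤ (i : ℕ) then 1 else 0

/-- The columns of the representation of the graft matroid of `(K_{2,4}, T)`, where `T`
is the set of degree-two vertices: the incidence vectors of the edges together with the
characteristic vector of `T`. -/
def k24GraftVecs : Set (Fin 6 → ZMod 2) :=
  {x | ∃ u v : Fin 6, (u : ℕ) < 2 ∧ 2 ≤ (v : ℕ) ∧ x = Pi.single u 1 + Pi.single v 1} ∪
    {chiT24}

/-- The linear map whose kernel on the even vectors is spanned by `chiT24`. -/
def k24Map : (Fin 6 → ZMod 2) →ₗ[ZMod 2] (Fin 4 → ZMod 2) where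
  toFun x := ![x 0 + x 1, x 0, x 2 + x 3, x 3 + x 4]
  map_add' x y := by
    ext i; fin_cases i <;> simp <;> ring
  map_smul' c x := by
    ext i; fin_cases i <;> simp <;> ring

def k24Sum : (Fin 6 → ZMod 2) →ₗ[ZMod 2] ZMod 2 where
  toFun x := x 0 + x 1 + x 2 + x 3 + x 4 + x 5
  map_add' x y := by simp; ring
  map_smul' c x := by simp; ring

lemma k24Map_chi : k24Map chiT24 = 0 := by decide

lemma chi_ne_zero : chiT24 ≠ 0 := by decide

lemma k24Map_ker (x : Fin 6 → ZMod 2) (h : k24Map x = 0) (hs : k24Sum x = 0) :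
    x = 0 ∨ x = chiT24 := by
  revert x; decide

lemma k24Sum_edge (x : Fin 6 → ZMod 2) (hx : x ∈ k24GraftVecs) : k24Sum x = 0 := by
  rcases hx with ⟨u, v, hu, hv, rfl⟩ | rfl
  · revert u v; decide
  · decide

lemma k24_bij : Set.BijOn k24Map (k24GraftVecs \ {chiT24}) agVecs := by
  refine ⟨?_, ?_, ?_⟩
  · rintro x ⟨⟨u, v, hu, hv, rfl⟩ | h, hx⟩
    · change k24Map _ 0 = 1
      clear hx
      revert u v; decide
    · exact absurd h hx
  · rintro x ⟨⟨u, v, hu, hv, rfl⟩ | h, hx⟩ y ⟨⟨u', v', hu', hv', rfl⟩ | h', hy⟩ hxy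
    · clear hx hy
      revert u v u' v'
      decide
    · exact absurd h' hy
    · exact absurd h hx
    · exact absurd h hx
  · intro y hy
    have key : ∀ y : Fin 4 → ZMod 2, y 0 = 1 → ∃ u v : Fin 6, (u : ℕ) < 2 ∧ 2 ≤ (v : ℕ) ∧
        (Pi.single u 1 + Pi.single v 1 : Fin 6 → ZMod 2) ≠ chiT24 ∧
        k24Map (Pi.single u 1 + Pi.single v 1) = y := by decide
    obtain ⟨u, v, hu, hv, hne, h⟩ := key y hy
    exact ⟨_, ⟨Or.inl ⟨u, v, hu, hv, rfl⟩, hne⟩, h⟩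

theorem k24_graft_contract {α : Type*} (M : Matroid α) (φ : α → (Fin 6 → ZMod 2)) (t : α)
    (hrep : M.IsRepBy (ZMod 2) φ) (hbij : Set.BijOn φ M.E k24GraftVecs)
    (ht : t ∈ M.E) (hφt : φ t = chiT24) :
    (M.con {t}).IsBinaryIsoTo agVecs ∧ M.HasAGMinor := by
  have main : (M.con {t}).IsBinaryIsoTo agVecs := by
    have hcon : M.con {t} = M ／ {t} := rfl
    have hnl : M.IsNonloop t := by
      rw [← Matroid.indep_singleton, hrep _ (by simpa using ht)]
      change LinearIndepOn (ZMod 2) φ {t}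
      rw [linearIndepOn_singleton_iff, hφt]
      exact chi_ne_zero
    refine ⟨k24Map ∘ φ, ?_, ?_⟩
    · rw [hcon]
      intro I hI
      rw [Matroid.contract_ground] at hI
      have htI : t ∉ I := fun h => (hI h).2 rfl
      have hIE : I ⊆ M.E := fun x hx => (hI hx).1
      rw [hnl.contractElem_indep_iff, hrep _ (insert_subset ht hIE)]
      change _ ∧ LinearIndepOn (ZMod 2) φ (insert t I) ↔ LinearIndepOn (ZMod 2) (k24Map ∘ φ) I
      rw [linearIndepOn_insert htI, hφt]
      constructor
      · rintro ⟨-, hli, hchi⟩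
        refine LinearIndependent.map (f := k24Map) hli ?_
        rw [Submodule.disjoint_def]
        intro x hx hk
        have hx' : x ∈ Submodule.span (ZMod 2) (φ '' I) := by
          rwa [image_eq_range]
        have hsum : x ∈ LinearMap.ker k24Sum := by
          refine Submodule.span_le.2 ?_ hx'
          rintro _ ⟨i, hi, rfl⟩
          exact k24Sum_edge _ (hbij.mapsTo (hIE hi))
        rcases k24Map_ker x hk hsum with h | h
        · exact h
        · exact absurd (h ▸ hx') hchi
      · intro h
        refine ⟨htI, LinearIndependent.of_comp k24Map h, fun hc => ?_⟩
        rw [Finsupp.mem_span_image_iff_linearCombination] at hc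
        obtain ⟨l, hl, hlc⟩ := hc
        have h0 : l = 0 := by
          refine linearIndepOn_iff.1 h l hl ?_
          rw [← Finsupp.apply_linearCombination, hlc, k24Map_chi]
        rw [h0, map_zero] at hlc
        exact chi_ne_zero hlc.symm
    · rw [hcon, Matroid.contract_ground]
      refine k24_bij.comp ?_
      have := hbij.sdiff_singleton ht
      rwa [hφt] at this
  exact ⟨main, M.con {t}, ⟨{t}, ∅, by simp [Matroid.del]⟩, main⟩
end
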